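/- arXiv:math/0509668 — 4 statements merged into one kernel-verified Lean document; each statement's English description precedes it below -/
import Mathlib

section
/- For every α with 1/2 < α < 1 there exist a constant C and a measurable, locally integrable potential V : ℝ → ℝ with |V(x)| ≤ C·(1+|x|)^{−α} for all x, such that the set of momenta k > 0 for which there is NO solution u of −u'' + V u = k²u (in the integral sense) satisfying u(x)·exp(−i(kx − (1/(2k))·∫₀ˣ V(y) dy)) → 1 as x → +∞ has Hausdorff dimension equal to 2(1−α). -/
open Real Set MeasureTheory Filter

/-- `u : ℝ → ℂ` solves `-u'' + V u = E u` in the integral sense: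
`u` is differentiable and `u'(x) = u'(0) + ∫₀ˣ (V(y) - E) u(y) dy`. -/
def SchrodingerSolution (V : ℝ → ℝ) (E : ℝ) (u : ℝ → ℂ) : Prop :=
  Differentiable ℝ u ∧
    ∀ x : ℝ, deriv u x = deriv u 0 + ∫ y in (0:ℝ)..x, ((V y : ℂ) - (E : ℂ)) * u y

/-- `u` has WKB asymptotics at the filter `l` (`atTop` or `atBot`) for momentum `k`:
`u(x) exp(-i(kx - (1/(2k)) ∫₀ˣ V)) → 1`. -/
def HasWKBAsymptotics (V : ℝ → ℝ) (k : ℝ) (u : ℝ → ℂ) (l : Filter ℝ) : Prop :=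
  Tendsto (fun x : ℝ =>
      u x * Complex.exp (-(Complex.I *
        ((k * x - (1 / (2 * k)) * ∫ y in (0:ℝ)..x, V y : ℝ) : ℂ)))) l (nhds 1)

namespace KR

/-- first order operator -/
noncomputable def KK (k x : ℝ) : (ℂ × ℂ) →L[ℂ] (ℂ × ℂ) :=
  (2 * Complex.I * (k:ℂ))⁻¹ •
    ((ContinuousLinearMap.fst ℂ ℂ ℂ).prod (-(ContinuousLinearMap.snd ℂ ℂ ℂ))
      + Complex.exp (-(2 * Complex.I * k * x)) • (ContinuousLinearMap.snd ℂ ℂ ℂ).prod 0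
      + Complex.exp (2 * Complex.I * k * x) •
        (0 : (ℂ × ℂ) →L[ℂ] ℂ).prod (-(ContinuousLinearMap.fst ℂ ℂ ℂ)))

theorem KK_apply (k x : ℝ) (y : ℂ × ℂ) :
    KK k x y = ((2 * Complex.I * (k:ℂ))⁻¹ * (y.1 + Complex.exp (-(2 * Complex.I * k * x)) * y.2),
      -((2 * Complex.I * (k:ℂ))⁻¹ * (y.2 + Complex.exp (2 * Complex.I * k * x) * y.1))) := by
  simp only [KK]
  ext <;> simp <;> ring

theorem KK_cont (k : ℝ) : Continuous (KK k) := by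
  unfold KK
  fun_prop

theorem norm_e1 (k x : ℝ) : ‖Complex.exp (2 * Complex.I * k * x)‖ = 1 := by
  rw [Complex.norm_exp]; simp
theorem norm_e2 (k x : ℝ) : ‖Complex.exp (-(2 * Complex.I * k * x))‖ = 1 := by
  rw [Complex.norm_exp]; simp

theorem norm_2Ik {k : ℝ} (hk : 0 < k) : ‖(2 * Complex.I * (k:ℂ))⁻¹‖ = 1 / (2 * k) := by
  simp [abs_of_pos hk]

theorem KK_norm {k : ℝ} (hk : 0 < k) (x : ℝ) (y : ℂ × ℂ) : ‖KK k x y‖ ≤ 1 / k * ‖y‖ := by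
  rw [KK_apply, Prod.norm_def]
  have h1 : ‖y.1‖ ≤ ‖y‖ := norm_fst_le y
  have h2 : ‖y.2‖ ≤ ‖y‖ := norm_snd_le y
  apply max_le
  · rw [norm_mul, norm_2Ik hk]
    have : ‖y.1 + Complex.exp (-(2 * Complex.I * k * x)) * y.2‖ ≤ 2 * ‖y‖ := by
      refine (norm_add_le _ _).trans ?_
      rw [norm_mul, norm_e2]; linarith
    calc _ ≤ 1 / (2*k) * (2 * ‖y‖) := by gcongr
      _ = _ := by field_simp
  · rw [norm_neg, norm_mul, norm_2Ik hk]
    have : ‖y.2 + Complex.exp ((2 * Complex.I * k * x)) * y.1‖ ≤ 2 * ‖y‖ := by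
      refine (norm_add_le _ _).trans ?_
      rw [norm_mul, norm_e1]; linarith
    calc _ ≤ 1 / (2*k) * (2 * ‖y‖) := by gcongr
      _ = _ := by field_simp

/-- solutions of the first order system -/
def Sol (V : ℝ → ℝ) (k : ℝ) (Y : ℝ → ℂ × ℂ) : Prop :=
  ∀ x, HasDerivAt Y ((V x : ℂ) • KK k x (Y x)) x

theorem exists_sol_gen (A : ℝ → (ℂ × ℂ) →L[ℂ] (ℂ × ℂ)) (hA : Continuous A) (L : ℝ)
    (hL : ∀ x y, ‖A x y‖ ≤ L * ‖y‖) (y0 : ℂ × ℂ) :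
    ∃ Y : ℝ → ℂ × ℂ, Y 0 = y0 ∧ ∀ x, HasDerivAt Y (A x (Y x)) x := by
  obtain ⟨P, P0, Ps⟩ : ∃ P : ℕ → ℝ → ℂ × ℂ, (∀ x, P 0 x = y0) ∧
      (∀ n x, P (n+1) x = ∫ t in (0:ℝ)..x, A t (P n t)) :=
    ⟨fun n => Nat.rec (fun _ => y0) (fun _ p x => ∫ t in (0:ℝ)..x, A t (p t)) n,
      fun _ => rfl, fun _ _ => rfl⟩
  have hL0 : 0 ≤ L := by
    have h := hL 0 (1,1)
    have h2 : ‖((1:ℂ),(1:ℂ))‖ = 1 := by simp [Prod.norm_def]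
    rw [h2, mul_one] at h
    exact (norm_nonneg _).trans h
  have Pc : ∀ n, Continuous (P n) ∧ ∀ x, HasDerivAt (P (n+1)) (A x (P n x)) x := by
    intro n
    have key : ∀ n, Continuous (P n) → ∀ x, HasDerivAt (P (n+1)) (A x (P n x)) x := by
      intro n hn x
      have hc : Continuous fun t => A t (P n t) := hA.clm_apply hn
      rw [show P (n+1) = fun x => ∫ t in (0:ℝ)..x, A t (P n t) from funext (Ps n)]
      exact intervalIntegral.integral_hasDerivAt_right (hc.intervalIntegrable _ _)
        hc.aestronglyMeasurable.stronglyMeasurableAtFilter hc.continuousAt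
    have hc : ∀ n, Continuous (P n) := by
      intro n
      induction n with
      | zero => rw [show P 0 = fun _ => y0 from funext P0]; exact continuous_const
      | succ n ih => exact continuous_iff_continuousAt.2 fun x => (key n ih x).continuousAt
    exact ⟨hc n, key n (hc n)⟩
  have Pb : ∀ n x, ‖P n x‖ ≤ (L * |x|) ^ n / n.factorial * ‖y0‖ := by
    intro n
    induction n with
    | zero => intro x; simp [P0]
    | succ n ih =>
      intro x
      rw [Ps]
      have e1 : ∀ t, ‖A t (P n t)‖ ≤ L ^ (n+1) / n.factorial * ‖y0‖ * |t| ^ n := by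
        intro t
        calc _ ≤ L * ‖P n t‖ := hL _ _
          _ ≤ L * ((L * |t|) ^ n / n.factorial * ‖y0‖) := by gcongr; exact ih t
          _ = _ := by rw [mul_pow]; ring
      have e2 : ‖∫ t in (0:ℝ)..x, A t (P n t)‖ ≤
          |∫ t in (0:ℝ)..x, L ^ (n+1) / n.factorial * ‖y0‖ * |t| ^ n| := by
        apply intervalIntegral.norm_integral_le_abs_of_norm_le
        · exact Eventually.of_forall fun t => e1 t
        · apply Continuous.intervalIntegrable; fun_prop
      refine e2.trans ?_
      have e3 : |∫ t in (0:ℝ)..x, |t| ^ n| ≤ |x| ^ (n+1) / (n+1) := by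
        rcases le_total 0 x with h | h
        · have : ∫ t in (0:ℝ)..x, |t| ^ n = ∫ t in (0:ℝ)..x, t ^ n := by
            apply intervalIntegral.integral_congr
            intro t ht
            rw [uIcc_of_le h] at ht
            simp [abs_of_nonneg ht.1]
          rw [this, integral_pow]
          simp [abs_of_nonneg h]
          rw [abs_of_nonneg (by positivity)]
        · have : ∫ t in (0:ℝ)..x, |t| ^ n = ∫ t in (0:ℝ)..x, (-t) ^ n := by
            apply intervalIntegral.integral_congr
            intro t ht
            rw [uIcc_of_ge h] at ht
            simp [abs_of_nonpos ht.2]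
          rw [this, intervalIntegral.integral_comp_neg (fun t => t ^ n), integral_pow]
          simp [abs_of_nonpos h]
          rw [abs_div, abs_neg, abs_pow, abs_neg, abs_of_nonpos h, abs_of_pos (by positivity : (0:ℝ) < n+1)]
      rw [intervalIntegral.integral_const_mul, abs_mul, abs_of_nonneg (by positivity)]
      calc _ ≤ L ^ (n+1) / n.factorial * ‖y0‖ * (|x| ^ (n+1) / (n+1)) := by gcongr
        _ = _ := by
          rw [Nat.factorial_succ, mul_pow]; push_cast; field_simp
  have summ : ∀ c : ℝ, Summable fun n : ℕ => c ^ n / n.factorial * ‖y0‖ := fun c =>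
    (Real.summable_pow_div_factorial c).mul_right _
  have Psum : ∀ x, Summable fun n => P n x := fun x =>
    Summable.of_norm_bounded (summ (L * |x|)) (fun n => Pb n x)
  refine ⟨fun x => ∑' n, P n x, ?_, ?_⟩
  · have : ∀ n, n ≠ 0 → P n 0 = 0 := by
      intro n hn
      obtain ⟨m, rfl⟩ := Nat.exists_eq_succ_of_ne_zero hn
      simp [Ps]
    simp only
    rw [tsum_eq_single 0 this, P0]
  · intro x
    have h1 : ∀ x, ∑' n, P n x = y0 + ∑' n, P (n+1) x := by
      intro x; rw [(Psum x).tsum_eq_zero_add, P0]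
    have h2 : HasDerivAt (fun x => ∑' n, P (n+1) x) (∑' n, A x (P n x)) x := by
      have hx : x ∈ Ioo (-(|x|+1)) (|x|+1) := by
        constructor <;> [linarith [neg_abs_le x]; linarith [le_abs_self x]]
      refine hasDerivAt_tsum_of_isPreconnected (g := fun n x => P (n+1) x)
        (g' := fun n x => A x (P n x)) (y₀ := x)
        (u := fun n => L * ((L * (|x|+1)) ^ n / n.factorial * ‖y0‖)) (t := Ioo (-(|x|+1)) (|x|+1))
        ((summ _).mul_left L) isOpen_Ioo isPreconnected_Ioo
        (fun n y _ => (Pc n).2 y) ?_ hx ((summable_nat_add_iff 1).2 (Psum x)) hx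
      · intro n y hy
        refine (hL _ _).trans ?_
        gcongr
        refine (Pb n y).trans ?_
        gcongr
        exact (abs_lt.2 hy).le
    have h3 : A x (∑' n, P n x) = ∑' n, A x (P n x) := (A x).map_tsum (Psum x)
    rw [h3]
    simp_rw [h1]
    exact h2.const_add y0

theorem exists_sol (V : ℝ → ℝ) (hV : Continuous V) (hb : ∀ x, |V x| ≤ 1) {k : ℝ} (hk : 0 < k)
    (y0 : ℂ × ℂ) : ∃ Y, Y 0 = y0 ∧ Sol V k Y := by
  obtain ⟨Y, h0, h⟩ := exists_sol_gen (fun x => (V x : ℂ) • KK k x)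
    (by have := KK_cont k; fun_prop) (1/k) (by
      intro x y
      have := KK_norm hk x y
      simp only [_root_.smul_apply, norm_smul, Complex.norm_real, Real.norm_eq_abs]
      calc _ ≤ 1 * (1 / k * ‖y‖) := by gcongr; exact hb x
        _ = _ := one_mul _) y0
  exact ⟨Y, h0, fun x => by simpa using h x⟩

end KR

namespace KR

theorem exp2 (k x : ℝ) : Complex.exp (2 * Complex.I * k * x) =
    Complex.exp (Complex.I * k * x) * Complex.exp (Complex.I * k * x) := by
  rw [← Complex.exp_add]; congr 1; ring
theorem exp2' (k x : ℝ) : Complex.exp (-(2 * Complex.I * k * x)) =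
    Complex.exp (-(Complex.I * k * x)) * Complex.exp (-(Complex.I * k * x)) := by
  rw [← Complex.exp_add]; congr 1; ring
theorem exp_inv (k x : ℝ) :
    Complex.exp (Complex.I * k * x) * Complex.exp (-(Complex.I * k * x)) = 1 := by
  rw [← Complex.exp_add]; simp

theorem hasDeriv_e (k x : ℝ) : HasDerivAt (fun x : ℝ => Complex.exp (Complex.I * k * x))
    (Complex.I * k * Complex.exp (Complex.I * k * x)) x := by
  have h : HasDerivAt (fun x : ℝ => Complex.I * k * (x:ℂ)) (Complex.I * k) x := by
    simpa using (Complex.ofRealCLM.hasDerivAt (x := x)).const_mul (Complex.I * (k:ℂ))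
  convert! h.cexp using 1; ring
theorem hasDeriv_e' (k x : ℝ) : HasDerivAt (fun x : ℝ => Complex.exp (-(Complex.I * k * x)))
    (-(Complex.I * k * Complex.exp (-(Complex.I * k * x)))) x := by
  have h : HasDerivAt (fun x : ℝ => Complex.I * k * (x:ℂ)) (Complex.I * k) x := by
    simpa using (Complex.ofRealCLM.hasDerivAt (x := x)).const_mul (Complex.I * (k:ℂ))
  convert! h.fun_neg.cexp using 1; ring

theorem schrodinger_of_sol {V : ℝ → ℝ} (hV : Continuous V) {k : ℝ} (hk : 0 < k) {Y : ℝ → ℂ × ℂ}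
    (hY : Sol V k Y) : SchrodingerSolution V (k ^ 2) (fun x =>
      (Y x).1 * Complex.exp (Complex.I * k * x) + (Y x).2 * Complex.exp (-(Complex.I * k * x))) := by
  have hk' : (k:ℂ) ≠ 0 := by exact_mod_cast hk.ne'
  have hI := Complex.I_ne_zero
  have h1 : ∀ x, HasDerivAt (fun x => (Y x).1) ((V x : ℂ) • KK k x (Y x)).1 x := fun x =>
    (ContinuousLinearMap.fst ℝ ℂ ℂ).hasFDerivAt.comp_hasDerivAt x (hY x)
  have h2 : ∀ x, HasDerivAt (fun x => (Y x).2) ((V x : ℂ) • KK k x (Y x)).2 x := fun x =>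
    (ContinuousLinearMap.snd ℝ ℂ ℂ).hasFDerivAt.comp_hasDerivAt x (hY x)
  have hu : ∀ x, HasDerivAt (fun x : ℝ =>
      (Y x).1 * Complex.exp (Complex.I * k * x) + (Y x).2 * Complex.exp (-(Complex.I * k * x)))
      (Complex.I * k * ((Y x).1 * Complex.exp (Complex.I * k * x)
        - (Y x).2 * Complex.exp (-(Complex.I * k * x)))) x := by
    intro x
    convert! ((h1 x).mul (hasDeriv_e k x)).add ((h2 x).mul (hasDeriv_e' k x)) using 1
    rw [KK_apply, exp2, exp2']
    have := exp_inv k x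
    simp only [Prod.smul_fst, Prod.smul_snd, smul_eq_mul]
    generalize Complex.exp (Complex.I * k * x) = e at *
    generalize Complex.exp (-(Complex.I * k * x)) = f at *
    field_simp
    linear_combination (-(V x:ℂ) * f * (Y x).2 + V x * e * (Y x).1) * this
  have hu' : ∀ x, HasDerivAt (fun x : ℝ => (Complex.I * k * ((Y x).1 * Complex.exp (Complex.I * k * x)
        - (Y x).2 * Complex.exp (-(Complex.I * k * x)))))
      (((V x : ℂ) - ((k ^ 2 : ℝ) : ℂ)) * ((Y x).1 * Complex.exp (Complex.I * k * x) +
        (Y x).2 * Complex.exp (-(Complex.I * k * x)))) x := by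
    intro x
    convert! (((h1 x).mul (hasDeriv_e k x)).sub ((h2 x).mul (hasDeriv_e' k x))).const_mul
      (Complex.I * (k:ℂ)) using 1
    rw [KK_apply, exp2, exp2']
    have := exp_inv k x
    have h4 := Complex.I_sq
    simp only [Prod.smul_fst, Prod.smul_snd, smul_eq_mul]
    generalize Complex.exp (Complex.I * k * x) = e at *
    generalize Complex.exp (-(Complex.I * k * x)) = f at *
    push_cast
    field_simp
    ring_nf
    rw [h4]
    linear_combination (-(V x:ℂ) * f * (Y x).2 - V x * e * (Y x).1) * this
  refine ⟨fun x => (hu x).differentiableAt, fun x => ?_⟩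
  rw [(hu x).deriv, (hu 0).deriv]
  rw [intervalIntegral.integral_eq_sub_of_hasDerivAt (fun x _ => hu' x)]
  · ring
  · apply Continuous.intervalIntegrable
    have : Continuous Y := continuous_iff_continuousAt.2 fun x => (hY x).continuousAt
    fun_prop

theorem sol_of_schrodinger {V : ℝ → ℝ} (hV : Continuous V) {k : ℝ} (hk : 0 < k) {u : ℝ → ℂ}
    (hu : SchrodingerSolution V (k ^ 2) u) : ∃ Y, Sol V k Y ∧ ∀ x, u x =
      (Y x).1 * Complex.exp (Complex.I * k * x) + (Y x).2 * Complex.exp (-(Complex.I * k * x)) := by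
  have hk' : (k:ℂ) ≠ 0 := by exact_mod_cast hk.ne'
  have hI := Complex.I_ne_zero
  obtain ⟨hd, hi⟩ := hu
  have hu1 : ∀ x, HasDerivAt u (deriv u x) x := fun x => (hd x).hasDerivAt
  have hu2 : ∀ x, HasDerivAt (deriv u) (((V x : ℂ) - ((k ^ 2 : ℝ) : ℂ)) * u x) x := by
    intro x
    have hc : Continuous fun y => ((V y : ℂ) - ((k ^ 2 : ℝ) : ℂ)) * u y := by
      have := hd.continuous
      fun_prop
    have := (intervalIntegral.integral_hasDerivAt_right (hc.intervalIntegrable 0 x)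
        hc.aestronglyMeasurable.stronglyMeasurableAtFilter hc.continuousAt).const_add (deriv u 0)
    convert! this using 1
    exact funext hi
  refine ⟨fun x => (Complex.exp (-(Complex.I * k * x)) * (u x + (Complex.I * k)⁻¹ * deriv u x) / 2,
    Complex.exp (Complex.I * k * x) * (u x - (Complex.I * k)⁻¹ * deriv u x) / 2), ?_, ?_⟩
  · intro x
    have a1 := ((hasDeriv_e' k x).mul ((hu1 x).add ((hu2 x).const_mul (Complex.I * (k:ℂ))⁻¹))).div_const 2
    have a2 := ((hasDeriv_e k x).mul ((hu1 x).sub ((hu2 x).const_mul (Complex.I * (k:ℂ))⁻¹))).div_const 2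
    convert! a1.prodMk a2 using 1
    rw [KK_apply, exp2, exp2']
    have := exp_inv k x
    have h4 := Complex.I_sq
    ext
    · simp only [Prod.smul_fst, smul_eq_mul, Pi.add_apply, Pi.sub_apply]
      generalize Complex.exp (Complex.I * k * x) = e at *
      generalize Complex.exp (-(Complex.I * k * x)) = f at *
      push_cast
      field_simp
      ring_nf
      simp only [h4, Complex.I_pow_three]
      linear_combination ((V x:ℂ) * f * u x * Complex.I * k - V x * f * deriv u x) * this
    · simp only [Prod.smul_snd, smul_eq_mul, Pi.add_apply, Pi.sub_apply]
      generalize Complex.exp (Complex.I * k * x) = e at *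
      generalize Complex.exp (-(Complex.I * k * x)) = f at *
      push_cast
      field_simp
      ring_nf
      simp only [h4, Complex.I_pow_three]
      linear_combination (-(V x:ℂ) * e * u x * Complex.I * k - V x * e * deriv u x) * this
  · intro x
    have := exp_inv k x
    simp only
    generalize Complex.exp (Complex.I * k * x) = e at *
    generalize Complex.exp (-(Complex.I * k * x)) = f at *
    linear_combination (- u x) * this

end KR

namespace KR

/-- potential from cell amplitudes -/
noncomputable def VV (s : ℕ → ℝ) (x : ℝ) : ℝ := s ⌊x⌋₊ * sin (2 * π * x)

theorem VV_abs (s : ℕ → ℝ) (x : ℝ) : |VV s x| ≤ |s ⌊x⌋₊| := by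
  rw [VV, abs_mul]
  exact mul_le_of_le_one_right (abs_nonneg _) (abs_sin_le_one _)

theorem sin_nat (m : ℕ) : sin (2 * π * m) = 0 := by
  have := Real.sin_nat_mul_pi (2 * m)
  rw [← this]; congr 1; push_cast; ring

theorem VV_cell (s : ℕ → ℝ) (m : ℕ) {x : ℝ} (hx : x ∈ Icc (m:ℝ) (m+1)) :
    VV s x = s m * sin (2 * π * x) := by
  rcases eq_or_lt_of_le hx.2 with h | h
  · have h1 : sin (2 * π * x) = 0 := by
      have := sin_nat (m+1)
      rw [h]; push_cast at this; exact this
    simp [VV, h1]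
  · have : ⌊x⌋₊ = m := by
      rw [Nat.floor_eq_iff ((Nat.cast_nonneg m).trans hx.1)]
      exact ⟨hx.1, h⟩
    simp [VV, this]

theorem VV_cont (s : ℕ → ℝ) (hs : ∀ m, |s m| ≤ 1) : Continuous (VV s) := by
  rw [continuous_iff_continuousAt]
  intro x
  by_cases hz : sin (2 * π * x) = 0
  · have h0 : VV s x = 0 := by simp [VV, hz]
    rw [ContinuousAt, h0]
    have h1 : Tendsto (fun y => |sin (2 * π * y)|) (nhds x) (nhds 0) := by
      have : Continuous fun y : ℝ => |sin (2 * π * y)| := by fun_prop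
      have h2 := this.tendsto x
      simpa [hz] using h2
    refine squeeze_zero_norm (fun y => ?_) h1
    rw [Real.norm_eq_abs, VV, abs_mul]
    exact mul_le_of_le_one_left (abs_nonneg _) (hs _)
  · have hloc : ∀ᶠ y in nhds x, VV s y = s ⌊x⌋₊ * sin (2 * π * y) := by
      rcases lt_or_ge x 0 with h | h
      · filter_upwards [Iio_mem_nhds h] with y hy
        have h1 : ⌊y⌋₊ = 0 := Nat.floor_of_nonpos (le_of_lt hy)
        have h2 : ⌊x⌋₊ = 0 := Nat.floor_of_nonpos h.le
        rw [VV, h1, h2]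
      · have h1 := Nat.floor_le h
        have h2 := Nat.lt_floor_add_one x
        have h3 : (⌊x⌋₊:ℝ) < x := by
          refine lt_of_le_of_ne h1 fun h4 => hz ?_
          rw [← h4]; exact sin_nat _
        filter_upwards [Ioo_mem_nhds h3 h2] with y hy
        exact VV_cell s _ ⟨hy.1.le, hy.2.le⟩
    have : ContinuousAt (fun y => s ⌊x⌋₊ * sin (2 * π * y)) x := by fun_prop
    exact this.congr (hloc.mono fun y hy => hy.symm)

/-- cell transform -/
noncomputable def Gh (k : ℝ) : ℂ :=
  ∫ x in (0:ℝ)..1, (sin (2 * π * x) : ℂ) * Complex.exp (2 * Complex.I * k * x)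

theorem Gh_le (k : ℝ) : ‖Gh k‖ ≤ 1 := by
  have := intervalIntegral.norm_integral_le_of_norm_le_const (a := 0) (b := 1) (C := 1)
    (f := fun x : ℝ => (sin (2 * π * x) : ℂ) * Complex.exp (2 * Complex.I * k * x)) (by
      intro x _
      rw [norm_mul, norm_e1, mul_one]
      rw [Complex.norm_real]
      exact abs_sin_le_one _)
  simpa [Gh] using this

theorem Gh_ge {k : ℝ} (h1 : π / 4 ≤ k) (h2 : k ≤ 3 * π / 4) : 1 / (2 * π) ≤ ‖Gh k‖ := by
  have hp := pi_pos
  have hd : (4 * (π:ℂ)^2 - 4 * (k:ℂ)^2) ≠ 0 := by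
    have : 4 * π^2 - 4 * k^2 ≠ 0 := by nlinarith
    exact_mod_cast this
  have hder : ∀ x : ℝ, HasDerivAt (fun x : ℝ => (4 * (π:ℂ)^2 - 4 * (k:ℂ)^2)⁻¹ *
      (Complex.exp (2 * Complex.I * k * x) *
        (2 * Complex.I * k * Complex.sin (2 * π * x) - 2 * π * Complex.cos (2 * π * x))))
      (Complex.sin (2 * π * x) * Complex.exp (2 * Complex.I * k * x)) x := by
    intro x
    have i0 : HasDerivAt (fun x : ℝ => (x:ℂ)) 1 x := Complex.ofRealCLM.hasDerivAt
    have i1 := (i0.const_mul (2 * Complex.I * (k:ℂ))).cexp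
    have i2 := (i0.const_mul (2 * (π:ℂ)))
    have i3 := (Complex.hasDerivAt_sin (2 * (π:ℂ) * x)).comp x i2
    have i4 := (Complex.hasDerivAt_cos (2 * (π:ℂ) * x)).comp x i2
    convert! (i1.mul ((i3.const_mul (2 * Complex.I * (k:ℂ))).sub (i4.const_mul (2 * (π:ℂ))))).const_mul
      ((4 * (π:ℂ)^2 - 4 * (k:ℂ)^2)⁻¹) using 1
    simp only [Pi.sub_apply, Function.comp]
    rw [eq_inv_mul_iff_mul_eq₀ hd]
    linear_combination (-(4 * (k:ℂ) ^ 2 * Complex.sin (2 * π * x) *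
      Complex.exp (2 * Complex.I * k * x))) * Complex.I_sq
  have hG : Gh k = (4 * (π:ℂ)^2 - 4 * (k:ℂ)^2)⁻¹ * (2 * π) * (1 - Complex.exp (2 * Complex.I * k)) := by
    rw [Gh]
    have := intervalIntegral.integral_eq_sub_of_hasDerivAt (a := 0) (b := 1)
      (fun x _ => hder x) (by apply Continuous.intervalIntegrable; fun_prop)
    push_cast
    rw [this]
    simp
    ring
  rw [hG, norm_mul, norm_mul, norm_inv]
  have n1 : ‖(4 * (π:ℂ)^2 - 4 * (k:ℂ)^2)‖ = 4 * π^2 - 4 * k^2 := by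
    have : (4 * (π:ℂ)^2 - 4 * (k:ℂ)^2) = ((4 * π^2 - 4 * k^2 : ℝ):ℂ) := by push_cast; ring
    rw [this, Complex.norm_real, Real.norm_eq_abs, abs_of_nonneg]
    nlinarith
  have n2 : ‖(2 * (π:ℂ))‖ = 2 * π := by
    simp [abs_of_pos hp]
  have n3 : 1 ≤ ‖1 - Complex.exp (2 * Complex.I * k)‖ := by
    refine le_trans ?_ (Complex.re_le_norm _)
    have : 2 * Complex.I * (k:ℂ) = ((2 * k : ℝ):ℂ) * Complex.I := by push_cast; ring
    rw [this, Complex.sub_re, Complex.exp_ofReal_mul_I_re]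
    have := Real.cos_nonpos_of_pi_div_two_le_of_le (x := 2 * k) (by linarith) (by linarith)
    simp; linarith
  rw [n1, n2]
  have h3 : 0 < 4 * π^2 - 4 * k^2 := by nlinarith
  have h4 : 4 * π^2 - 4 * k^2 ≤ 4 * π^2 := by nlinarith
  calc 1 / (2 * π) = (4 * π^2)⁻¹ * (2 * π) * 1 := by field_simp; ring
    _ ≤ _ := by gcongr

theorem int_VV_cell (s : ℕ → ℝ) (m : ℕ) : ∫ x in (m:ℝ)..(m+1), VV s x = 0 := by
  have : ∫ x in (m:ℝ)..(m+1), VV s x = ∫ x in (m:ℝ)..(m+1), s m * sin (2 * π * x) := by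
    apply intervalIntegral.integral_congr
    intro x hx
    rw [uIcc_of_le (by linarith)] at hx
    exact VV_cell s m hx
  rw [this, intervalIntegral.integral_const_mul]
  rw [intervalIntegral.integral_comp_mul_left (fun x => sin x) (by positivity)]
  rw [integral_sin]
  have h1 : cos (2 * π * m) = 1 := by
    rw [show 2 * π * (m:ℝ) = m * (2 * π) by ring]; exact Real.cos_nat_mul_two_pi m
  have h2 : cos (2 * π * (m + 1)) = 1 := by
    rw [show 2 * π * ((m:ℝ)+1) = ((m+1:ℕ):ℝ) * (2 * π) by push_cast; ring]
    exact Real.cos_nat_mul_two_pi (m+1)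
  rw [h1, h2]; simp

theorem int_VVe_cell (s : ℕ → ℝ) (k : ℝ) (m : ℕ) :
    ∫ x in (m:ℝ)..(m+1), (VV s x : ℂ) * Complex.exp (2 * Complex.I * k * x) =
      Gh k * (s m * Complex.exp (2 * Complex.I * k * m)) := by
  have : ∫ x in (m:ℝ)..(m+1), (VV s x : ℂ) * Complex.exp (2 * Complex.I * k * x) =
      ∫ x in (m:ℝ)..(m+1), (s m * Complex.exp (2 * Complex.I * k * m)) * ((fun x : ℝ =>
        (sin (2 * π * x) : ℂ) * Complex.exp (2 * Complex.I * k * x)) (x - m)) := by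
    apply intervalIntegral.integral_congr
    intro x hx
    rw [uIcc_of_le (by linarith)] at hx
    simp only
    rw [VV_cell s m hx]
    have e1 : sin (2 * π * x) = sin (2 * π * (x - m)) := by
      rw [show 2 * π * (x - m) = 2 * π * x - m * (2 * π) by ring, Real.sin_sub_nat_mul_two_pi]
    have e2 : Complex.exp (2 * Complex.I * k * x) = Complex.exp (2 * Complex.I * k * m) *
        Complex.exp (2 * Complex.I * k * (x - m : ℝ)) := by
      rw [← Complex.exp_add]; congr 1; push_cast; ring
    rw [e1, e2]; push_cast; ring
  rw [this, intervalIntegral.integral_const_mul, intervalIntegral.integral_comp_sub_right (fun x : ℝ =>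
    (sin (2 * π * x) : ℂ) * Complex.exp (2 * Complex.I * k * x))]
  rw [Gh]; simp; ring

end KR

namespace KR

/-- off-diagonal first order increment -/
noncomputable def FF (k : ℝ) (c : ℂ) (y : ℂ × ℂ) : ℂ × ℂ :=
  ((2 * Complex.I * (k:ℂ))⁻¹ * (starRingEnd ℂ c * y.2), -((2 * Complex.I * (k:ℂ))⁻¹ * (c * y.1)))

theorem FF_norm {k : ℝ} (hk : 0 < k) (c : ℂ) (y : ℂ × ℂ) : ‖FF k c y‖ ≤ ‖c‖ / (2 * k) * ‖y‖ := by
  have h1 : ‖y.1‖ ≤ ‖y‖ := norm_fst_le y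
  have h2 : ‖y.2‖ ≤ ‖y‖ := norm_snd_le y
  rw [FF, Prod.norm_def]
  apply max_le
  · rw [norm_mul, norm_2Ik hk, norm_mul, RCLike.norm_conj]
    calc _ ≤ 1 / (2*k) * (‖c‖ * ‖y‖) := by gcongr
      _ = _ := by ring
  · rw [norm_neg, norm_mul, norm_2Ik hk, norm_mul]
    calc _ ≤ 1 / (2*k) * (‖c‖ * ‖y‖) := by gcongr
      _ = _ := by ring

theorem FF_add (k : ℝ) (c d : ℂ) (y : ℂ × ℂ) : FF k (c + d) y = FF k c y + FF k d y := by
  ext <;> simp [FF] <;> ring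

theorem FF_sub (k : ℝ) (c : ℂ) (y z : ℂ × ℂ) : FF k c (y - z) = FF k c y - FF k c z := by
  ext <;> simp [FF] <;> ring

section
variable {s : ℕ → ℝ} {k : ℝ} {Y : ℝ → ℂ × ℂ}

theorem cell1 (hk : 0 < k) (hY : Sol (VV s) k Y) {m : ℕ} {b : ℝ}
    (hb : 0 < b) (hbk : b / k ≤ 1) (hm : |s m| ≤ b) {x : ℝ} (hx : x ∈ Icc (m:ℝ) (m+1)) :
    ‖Y x - Y m‖ ≤ 2 * (b / k) * ‖Y m‖ := by
  have hK : 0 < b / k := by positivity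
  have hc : Continuous Y := continuous_iff_continuousAt.2 fun x => (hY x).continuousAt
  have := norm_le_gronwallBound_of_norm_deriv_right_le (f := fun x => Y x - Y m)
    (f' := fun x => (VV s x : ℂ) • KK k x (Y x)) (δ := 0) (K := b / k) (ε := b / k * ‖Y m‖)
    (a := m) (b := m + 1) (by fun_prop)
    (fun x _ => ((hY x).sub_const _).hasDerivWithinAt) (by simp) (by
      intro x hx
      rw [norm_smul, Complex.norm_real, Real.norm_eq_abs]
      have e1 : |VV s x| ≤ b := by
        rw [VV_cell s m ⟨hx.1, hx.2.le⟩, abs_mul]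
        exact (mul_le_of_le_one_right (abs_nonneg _) (abs_sin_le_one _)).trans hm
      have e2 := KK_norm hk x (Y x)
      have e3 : ‖Y x‖ ≤ ‖Y x - Y m‖ + ‖Y m‖ := by
        simpa using norm_add_le (Y x - Y m) (Y m)
      calc _ ≤ b * (1 / k * (‖Y x - Y m‖ + ‖Y m‖)) := by gcongr; exact e2.trans (by gcongr)
        _ = _ := by ring) x hx
  refine this.trans ?_
  rw [gronwallBound_of_K_ne_0 hK.ne']
  have h1 : exp (b / k * (x - m)) - 1 ≤ 2 * (b/k) := by
    have h2 : exp (b / k * (x - m)) ≤ exp (b/k) := by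
      apply exp_le_exp.2
      have : x - m ≤ 1 := by linarith [hx.2]
      nlinarith
    have h3 := Real.abs_exp_sub_one_le (x := b/k) (by rw [abs_of_pos hK]; exact hbk)
    rw [abs_of_pos hK] at h3
    linarith [le_abs_self (exp (b/k) - 1)]
  have h4 : b / k * ‖Y m‖ / (b/k) = ‖Y m‖ := by field_simp
  simp only [zero_mul, zero_add]
  rw [h4]
  calc _ ≤ ‖Y m‖ * (2 * (b/k)) := by gcongr
    _ = _ := by ring

theorem int_KK (hs : ∀ m, |s m| ≤ 1) (m : ℕ) (y : ℂ × ℂ) :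
    ∫ x in (m:ℝ)..(m+1), (VV s x : ℂ) • KK k x y =
      FF k (Gh k * (s m * Complex.exp (2 * Complex.I * k * m))) y := by
  have hV := VV_cont s hs
  have hKc := KK_cont k
  have hint : IntervalIntegrable (fun x : ℝ => (VV s x : ℂ) • KK k x y) volume m (m+1) := by
    apply Continuous.intervalIntegrable; fun_prop
  have h1 : ∫ x in (m:ℝ)..(m+1), (VV s x : ℂ) = 0 := by
    rw [intervalIntegral.integral_ofReal, int_VV_cell]; simp
  have h2 := int_VVe_cell s k m
  have h3 : ∫ x in (m:ℝ)..(m+1), (VV s x : ℂ) * Complex.exp (-(2 * Complex.I * k * x)) =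
      starRingEnd ℂ (Gh k * (s m * Complex.exp (2 * Complex.I * k * m))) := by
    rw [← h2, ← intervalIntegral.intervalIntegral_conj]
    congr 1; ext x
    rw [map_mul, ← Complex.exp_conj]
    simp [Complex.conj_ofNat]
  have i1 : IntervalIntegrable (fun x : ℝ => (VV s x : ℂ)) volume m (m+1) := by
    apply Continuous.intervalIntegrable; fun_prop
  have i2 : IntervalIntegrable (fun x : ℝ => (VV s x : ℂ) * Complex.exp (2 * Complex.I * k * x))
      volume m (m+1) := by
    apply Continuous.intervalIntegrable; fun_prop
  have i3 : IntervalIntegrable (fun x : ℝ => (VV s x : ℂ) * Complex.exp (-(2 * Complex.I * k * x)))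
      volume m (m+1) := by
    apply Continuous.intervalIntegrable; fun_prop
  refine Prod.ext ?_ ?_
  · have := (ContinuousLinearMap.fst ℂ ℂ ℂ).intervalIntegral_comp_comm hint
    simp only [ContinuousLinearMap.coe_fst'] at this
    rw [← this]
    have e : ∀ x : ℝ, ((VV s x : ℂ) • KK k x y).1 = ((2 * Complex.I * (k:ℂ))⁻¹ * y.1) * (VV s x : ℂ) +
        ((2 * Complex.I * (k:ℂ))⁻¹ * y.2) * ((VV s x : ℂ) * Complex.exp (-(2 * Complex.I * k * x))) := by
      intro x; rw [KK_apply]; simp; ring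
    simp_rw [e]
    rw [intervalIntegral.integral_add (i1.const_mul _) (i3.const_mul _),
      intervalIntegral.integral_const_mul, intervalIntegral.integral_const_mul, h1, h3]
    simp only [FF]; ring
  · have := (ContinuousLinearMap.snd ℂ ℂ ℂ).intervalIntegral_comp_comm hint
    simp only [ContinuousLinearMap.coe_snd'] at this
    rw [← this]
    have e : ∀ x : ℝ, ((VV s x : ℂ) • KK k x y).2 = (-(2 * Complex.I * (k:ℂ))⁻¹ * y.2) * (VV s x : ℂ) +
        (-(2 * Complex.I * (k:ℂ))⁻¹ * y.1) * ((VV s x : ℂ) * Complex.exp ((2 * Complex.I * k * x))) := by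
      intro x; rw [KK_apply]; simp; ring
    simp_rw [e]
    rw [intervalIntegral.integral_add (i1.const_mul _) (i2.const_mul _),
      intervalIntegral.integral_const_mul, intervalIntegral.integral_const_mul, h1, h2]
    simp only [FF]; ring

theorem cell2 (hs : ∀ m, |s m| ≤ 1) (hk : 0 < k) (hY : Sol (VV s) k Y) {m : ℕ} {b : ℝ}
    (hb : 0 < b) (hbk : b / k ≤ 1) (hm : |s m| ≤ b) :
    ‖Y (m+1) - Y m - FF k (Gh k * (s m * Complex.exp (2 * Complex.I * k * m))) (Y m)‖
      ≤ 2 * (b / k) ^ 2 * ‖Y m‖ := by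
  have hV := VV_cont s hs
  have hKc := KK_cont k
  have hc : Continuous Y := continuous_iff_continuousAt.2 fun x => (hY x).continuousAt
  rw [← int_KK hs]
  have e1 : Y (m+1) - Y m = ∫ x in (m:ℝ)..(m+1), (VV s x : ℂ) • KK k x (Y x) := by
    rw [intervalIntegral.integral_eq_sub_of_hasDerivAt (fun x _ => hY x)]
    apply Continuous.intervalIntegrable; fun_prop
  rw [e1, ← intervalIntegral.integral_sub]
  rotate_left
  · apply Continuous.intervalIntegrable; fun_prop
  · apply Continuous.intervalIntegrable; fun_prop
  have := intervalIntegral.norm_integral_le_of_norm_le_const (a := (m:ℝ)) (b := m+1)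
    (C := 2 * (b / k) ^ 2 * ‖Y m‖)
    (f := fun x : ℝ => (VV s x : ℂ) • KK k x (Y x) - (VV s x : ℂ) • KK k x (Y m)) (by
      intro x hx
      rw [uIoc_of_le (by linarith)] at hx
      have hx' : x ∈ Icc (m:ℝ) (m+1) := ⟨hx.1.le, hx.2⟩
      rw [← smul_sub, ← map_sub, norm_smul, Complex.norm_real, Real.norm_eq_abs]
      have e1 : |VV s x| ≤ b := by
        rw [VV_cell s m hx', abs_mul]
        exact (mul_le_of_le_one_right (abs_nonneg _) (abs_sin_le_one _)).trans hm
      have e2 := KK_norm hk x (Y x - Y m)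
      have e3 := cell1 hk hY hb hbk hm hx'
      calc _ ≤ b * (1 / k * (2 * (b / k) * ‖Y m‖)) := by gcongr; exact e2.trans (by gcongr)
        _ = _ := by ring)
  simpa using this

theorem gap (hY : Sol (VV s) k Y) {p q : ℕ} (h : ∀ m, p ≤ m → m < q → s m = 0) {x : ℝ}
    (hx : x ∈ Icc (p:ℝ) q) : Y x = Y p := by
  have hc : Continuous Y := continuous_iff_continuousAt.2 fun x => (hY x).continuousAt
  refine constant_of_has_deriv_right_zero (f := Y) hc.continuousOn (fun x hx => ?_) x hx
  have : VV s x = 0 := by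
    have h0 : (0:ℝ) ≤ x := (Nat.cast_nonneg p).trans hx.1
    rw [VV, h _ (Nat.le_floor hx.1) ((Nat.floor_lt h0).2 hx.2), zero_mul]
  simpa [this] using (hY x).hasDerivWithinAt (s := Ici x)

/-- exponential sum over cells -/
noncomputable def ww (s : ℕ → ℝ) (k : ℝ) (t l : ℕ) : ℂ :=
  ∑ m ∈ Finset.range l, (s (t + m) : ℂ) * Complex.exp (2 * Complex.I * k * (t + m : ℕ))

theorem ww_add (t l l' : ℕ) : ww s k t (l + l') = ww s k t l + ww s k (t + l) l' := by
  simp only [ww, Finset.sum_range_add, add_assoc]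

/-- dyadic smallness hypothesis -/
def HH (s : ℕ → ℝ) (k : ℝ) (f : ℕ → ℝ) : ℕ → ℕ → Prop
  | 0, t => ‖Gh k * ww s k t 1‖ ≤ 2 * k * f 0
  | j+1, t => HH s k f j t ∧ HH s k f j (t + 2 ^ j) ∧
      ‖Gh k * ww s k t (2 ^ (j+1))‖ ≤ 2 * k * f (j+1)

theorem HH_self {f : ℕ → ℝ} {j t : ℕ} (h : HH s k f j t) :
    ‖Gh k * ww s k t (2 ^ j)‖ ≤ 2 * k * f j := by
  cases j with
  | zero => simpa [HH] using h
  | succ j => exact h.2.2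

theorem dyadic (hs : ∀ m, |s m| ≤ 1) (hk : 0 < k) (hY : Sol (VV s) k Y) {b : ℝ}
    (hb : 0 < b) (hbk : b / k ≤ 1) {f e : ℕ → ℝ} {N : ℕ} (hf : ∀ j, 0 ≤ f j)
    (he0 : 2 * (b / k) ^ 2 ≤ e 0) (he : ∀ j < N, 2 * e j + (f j + e j) ^ 2 ≤ e (j+1)) :
    ∀ j ≤ N, ∀ t, (∀ m < 2 ^ j, |s (t + m)| ≤ b) → HH s k f j t →
      ‖Y (t + 2 ^ j : ℕ) - Y t - FF k (Gh k * ww s k t (2 ^ j)) (Y t)‖ ≤ e j * ‖Y t‖ := by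
  intro j
  induction j with
  | zero =>
    intro _ t ht _
    have := cell2 hs hk hY hb hbk (by simpa using ht 0)
    simp only [pow_zero, ww, Finset.sum_range_one, add_zero]
    push_cast
    refine this.trans ?_
    gcongr
  | succ j ih =>
    intro hj t ht hH
    obtain ⟨h1, h2, -⟩ := hH
    have hpow : 2 ^ (j+1) = 2 ^ j + 2 ^ j := by ring
    have a1 := ih (by omega) t (fun m hm => ht m (by omega)) h1
    have a2 := ih (by omega) (t + 2^j) (fun m hm => by
      have := ht (2^j + m) (by omega); rwa [← add_assoc] at this) h2
    have f1 := HH_self h1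
    have f2 := HH_self h2
    rw [hpow, ww_add, ← add_assoc t]
    set c1 := Gh k * ww s k t (2 ^ j)
    set c2 := Gh k * ww s k (t + 2 ^ j) (2 ^ j)
    rw [mul_add, FF_add]
    set y0 := Y t
    set y1 := Y (t + 2 ^ j : ℕ)
    set y2 := Y (t + 2 ^ j + 2 ^ j : ℕ)
    have g1 : ∀ y, ‖FF k c1 y‖ ≤ f j * ‖y‖ := fun y => (FF_norm hk c1 y).trans (by
      gcongr; rw [div_le_iff₀ (by positivity)]; linarith)
    have g2 : ∀ y, ‖FF k c2 y‖ ≤ f j * ‖y‖ := fun y => (FF_norm hk c2 y).trans (by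
      gcongr; rw [div_le_iff₀ (by positivity)]; linarith)
    have b1 : ‖y1 - y0‖ ≤ (f j + e j) * ‖y0‖ := by
      have : y1 - y0 = (y1 - y0 - FF k c1 y0) + FF k c1 y0 := by abel
      rw [this]
      refine (norm_add_le _ _).trans ?_
      linarith [g1 y0]
    have b2 : ‖y1‖ ≤ (1 + f j + e j) * ‖y0‖ := by
      have : y1 = (y1 - y0) + y0 := by abel
      rw [this]
      refine (norm_add_le _ _).trans ?_
      linarith
    have d : y2 - y0 - (FF k c1 y0 + FF k c2 y0) =
        (y2 - y1 - FF k c2 y1) + (y1 - y0 - FF k c1 y0) + FF k c2 (y1 - y0) := by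
      rw [FF_sub]; abel
    rw [d]
    have ej : 0 ≤ e j := by
      by_contra hneg
      push Not at hneg
      have : ∀ i ≤ N, 0 ≤ e i := by
        intro i
        induction i with
        | zero => intro _; exact le_trans (by positivity) he0
        | succ i ihi => intro hi; have := he i (by omega); have := ihi (by omega); nlinarith
      linarith [this j (by omega)]
    calc _ ≤ e j * ‖y1‖ + e j * ‖y0‖ + f j * ‖y1 - y0‖ :=
          (norm_add₃_le).trans (by gcongr; exact g2 _)
      _ ≤ e j * ((1 + f j + e j) * ‖y0‖) + e j * ‖y0‖ + f j * ((f j + e j) * ‖y0‖) := by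
          have := hf j; gcongr
      _ = (2 * e j + (f j + e j) ^ 2) * ‖y0‖ := by ring
      _ ≤ _ := by gcongr; exact he j (by omega)

theorem pre_bd (hs : ∀ m, |s m| ≤ 1) (hk : 0 < k) (hY : Sol (VV s) k Y) {b : ℝ}
    (hb : 0 < b) (hbk : b / k ≤ 1) {f e p : ℕ → ℝ} {N : ℕ} (hf : ∀ j, 0 ≤ f j)
    (hnn : ∀ j, 0 ≤ e j)
    (he0 : 2 * (b / k) ^ 2 ≤ e 0) (he : ∀ j < N, 2 * e j + (f j + e j) ^ 2 ≤ e (j+1))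
    (hp0 : 2 * (b / k) ≤ p 0) (hpn : ∀ j, 0 ≤ p j)
    (hp : ∀ j < N, (1 + p j) * (1 + f j + e j) - 1 ≤ p (j+1)) :
    ∀ j ≤ N, ∀ t : ℕ, (∀ m < 2 ^ j, |s (t + m)| ≤ b) → HH s k f j t →
      ∀ x ∈ Icc (t:ℝ) (t + 2 ^ j : ℕ), ‖Y x - Y t‖ ≤ p j * ‖Y t‖ := by
  intro j
  induction j with
  | zero =>
    intro _ t ht _ x hx
    refine (cell1 hk hY hb hbk (by simpa using ht 0) (by simpa using hx)).trans ?_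
    gcongr
  | succ j ih =>
    intro hj t ht hH x hx
    obtain ⟨h1, h2, -⟩ := hH
    have hpow : 2 ^ (j+1) = 2 ^ j + 2 ^ j := by ring
    have ht1 : ∀ m < 2 ^ j, |s (t + m)| ≤ b := fun m hm => ht m (by omega)
    have a1 := ih (by omega) t ht1 h1
    have a2 := ih (by omega) (t + 2^j) (fun m hm => by
      have := ht (2^j + m) (by omega); rwa [← add_assoc] at this) h2
    have hpj := hp j (by omega)
    have := hf j
    have := hnn j
    have := hpn j
    rcases le_total x (t + 2 ^ j : ℕ) with hx1 | hx1
    · refine (a1 x ⟨hx.1, hx1⟩).trans ?_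
      gcongr
      nlinarith
    · have c := a2 x ⟨hx1, by have := hx.2; rw [hpow, ← add_assoc] at this; exact this⟩
      have d := dyadic hs hk hY hb hbk hf he0 he j (by omega) t ht1 h1
      have f1 := HH_self h1
      set c1 := Gh k * ww s k t (2 ^ j)
      set y1 := Y (t + 2 ^ j : ℕ)
      have g1 : ‖FF k c1 (Y t)‖ ≤ f j * ‖Y t‖ := (FF_norm hk c1 _).trans (by
        gcongr; rw [div_le_iff₀ (by positivity)]; linarith)
      have b1 : ‖y1 - Y t‖ ≤ (f j + e j) * ‖Y t‖ := by
        have : y1 - Y t = (y1 - Y t - FF k c1 (Y t)) + FF k c1 (Y t) := by abel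
        rw [this]
        refine (norm_add_le _ _).trans ?_
        linarith
      have b2 : ‖y1‖ ≤ (1 + f j + e j) * ‖Y t‖ := by
        have : y1 = (y1 - Y t) + Y t := by abel
        rw [this]
        refine (norm_add_le _ _).trans ?_
        linarith
      have : Y x - Y t = (Y x - y1) + (y1 - Y t) := by abel
      rw [this]
      calc _ ≤ p j * ‖y1‖ + (f j + e j) * ‖Y t‖ := (norm_add_le _ _).trans (by gcongr)
        _ ≤ p j * ((1 + f j + e j) * ‖Y t‖) + (f j + e j) * ‖Y t‖ := by gcongr
        _ = ((1 + p j) * (1 + f j + e j) - 1) * ‖Y t‖ := by ring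
        _ ≤ _ := by gcongr

end
end KR

namespace KR

/-- sign -/
noncomputable def sg (β : Bool) : ℝ := if β then 1 else -1

theorem sg_abs (β : Bool) : |sg β| = 1 := by cases β <;> simp [sg]

/-- Rudin-Shapiro coefficients -/
noncomputable def rs : ℕ → Bool → ℕ → ℝ
  | 0, _, _ => 1
  | j+1, β, m => if m < 2 ^ j then rs j true m else sg β * rs j false (m - 2 ^ j)

theorem rs_abs (j : ℕ) : ∀ β m, |rs j β m| = 1 := by
  induction j with
  | zero => intro β m; simp [rs]
  | succ j ih =>
    intro β m
    rw [rs]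
    split_ifs
    · exact ih _ _
    · rw [abs_mul, sg_abs, ih, one_mul]

/-- Rudin-Shapiro polynomial values -/
noncomputable def RS (k : ℝ) (j : ℕ) (β : Bool) : ℂ := ww (rs j β) k 0 (2 ^ j)

theorem norm_e3 (k : ℝ) (t : ℕ) : ‖Complex.exp (2 * Complex.I * k * t)‖ = 1 := by
  have := norm_e1 k t
  simpa using this

theorem ww_shift {s s' : ℕ → ℝ} {k : ℝ} {t l : ℕ} {c : ℝ} (h : ∀ m < l, s (t + m) = c * s' m) :
    ww s k t l = Complex.exp (2 * Complex.I * k * t) * c * ww s' k 0 l := by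
  rw [ww, ww, Finset.mul_sum]
  apply Finset.sum_congr rfl
  intro m hm
  rw [h m (Finset.mem_range.1 hm)]
  push_cast
  rw [mul_add, Complex.exp_add, zero_add, zero_add]
  ring

theorem RS_succ (k : ℝ) (j : ℕ) (β : Bool) :
    RS k (j+1) β = RS k j true + Complex.exp (2 * Complex.I * k * (2 ^ j : ℕ)) * sg β * RS k j false := by
  rw [RS, pow_succ, mul_two, ww_add]
  congr 1
  · rw [ww_shift (s' := rs j true) (c := 1)]
    · simp [RS]
    · intro m hm; simp [rs, hm]
  · rw [ww_shift (s' := rs j false) (c := sg β)]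
    · simp [RS]
    · intro m hm; simp [rs]

theorem RS_sq (k : ℝ) (j : ℕ) : ‖RS k j true‖ ^ 2 + ‖RS k j false‖ ^ 2 = 2 ^ (j+1) := by
  induction j with
  | zero => simp [RS, ww, rs]; norm_num
  | succ j ih =>
    rw [RS_succ, RS_succ]
    simp only [sg, if_true, Bool.false_eq_true, if_false]
    set A := RS k j true
    set E := Complex.exp (2 * Complex.I * k * (2 ^ j : ℕ))
    set B := RS k j false
    have hE : ‖E‖ = 1 := norm_e3 k _
    have h := parallelogram_law_with_norm ℝ A (E * B)
    rw [norm_mul, hE, one_mul] at h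
    have e1 : A + E * (1:ℝ) * B = A + E * B := by push_cast; ring
    have e2 : A + E * (-1:ℝ) * B = A - E * B := by push_cast; ring
    rw [e1, e2, pow_succ 2 (j+1), ← ih]
    linarith

theorem RS_le (k : ℝ) (j : ℕ) (β : Bool) : ‖RS k j β‖ ≤ √2 * √2 ^ j := by
  have h := RS_sq k j
  rw [← pow_succ']
  apply abs_le_of_sq_le_sq' _ (by positivity) |>.2
  rw [← pow_mul, mul_comm, pow_mul, Real.sq_sqrt (by norm_num)]
  cases β <;> nlinarith [sq_nonneg ‖RS k j true‖, sq_nonneg ‖RS k j false‖]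

theorem RS_ge (k : ℝ) (j : ℕ) : ∃ β, √2 ^ j ≤ ‖RS k j β‖ := by
  by_contra! h
  have h1 := h true
  have h2 := h false
  have h3 := RS_sq k j
  have : (√2 ^ j) ^ 2 = 2 ^ j := by
    rw [← pow_mul, mul_comm, pow_mul, Real.sq_sqrt (by norm_num)]
  have h1' := pow_lt_pow_left₀ h1 (norm_nonneg _) (two_ne_zero)
  have h2' := pow_lt_pow_left₀ h2 (norm_nonneg _) (two_ne_zero)
  rw [pow_succ 2 j] at h3
  linarith

section
variable {s : ℕ → ℝ} {k : ℝ} {f : ℕ → ℝ}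

theorem HH_low {b : ℝ} (j : ℕ) (hf : ∀ i ≤ j, b * (√2 * √2 ^ i) ≤ 2 * k * f i) :
    ∀ (β : Bool) (t : ℕ) (c : ℝ), |c| ≤ b → (∀ m < 2 ^ j, s (t + m) = c * rs j β m) → HH s k f j t := by
  have key : ∀ (j : ℕ) (_ : b * (√2 * √2 ^ j) ≤ 2 * k * f j) (β : Bool) (t : ℕ) (c : ℝ), |c| ≤ b →
      (∀ m < 2 ^ j, s (t + m) = c * rs j β m) → ‖Gh k * ww s k t (2 ^ j)‖ ≤ 2 * k * f j := by
    intro j hj β t c hc h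
    refine le_trans ?_ hj
    rw [ww_shift h, norm_mul, norm_mul, norm_mul, norm_e3, Complex.norm_real, Real.norm_eq_abs, one_mul]
    have h1 := Gh_le k
    have h2 := RS_le k j β
    rw [RS] at h2
    have hb : 0 ≤ b := (abs_nonneg _).trans hc
    calc _ ≤ 1 * (b * (√2 * √2 ^ j)) := by gcongr
      _ = _ := one_mul _
  induction j with
  | zero =>
    intro β t c hc h
    simpa [HH] using key 0 (hf 0 le_rfl) β t c hc h
  | succ j ih =>
    intro β t c hc h
    have hpow : 2 ^ (j+1) = 2 ^ j + 2 ^ j := by ring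
    refine ⟨ih (fun i hi => hf i (by omega)) true t c hc ?_,
      ih (fun i hi => hf i (by omega)) false (t + 2 ^ j) (c * sg β) (by rwa [abs_mul, sg_abs, mul_one]) ?_,
      key (j+1) (hf _ le_rfl) β t c hc h⟩
    · intro m hm
      rw [h m (by omega)]; simp [rs, hm]
    · intro m hm
      rw [add_assoc, h _ (by omega)]; simp [rs, mul_assoc]

/-- geometric sum -/
noncomputable def GS (k : ℝ) (r i : ℕ) : ℂ :=
  ∑ l ∈ Finset.range (2 ^ i), Complex.exp (2 * Complex.I * k * (2 ^ r : ℕ)) ^ l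

theorem GS_succ (k : ℝ) (r i : ℕ) : GS k r (i+1) =
    GS k r i + Complex.exp (2 * Complex.I * k * (2 ^ (r + i) : ℕ)) * GS k r i := by
  rw [GS, pow_succ, mul_two, Finset.sum_range_add]
  congr 1
  rw [GS, Finset.mul_sum]
  apply Finset.sum_congr rfl
  intro l _
  rw [pow_add]
  congr 1
  rw [← Complex.exp_nat_mul]
  congr 1
  push_cast; ring

theorem GS_le (k : ℝ) (r i : ℕ) : ‖GS k r i‖ ≤ 2 ^ i := by
  refine (norm_sum_le _ _).trans ?_
  simp only [norm_pow, norm_e3, one_pow]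
  simp

theorem norm_exp_sub_one (x : ℝ) : ‖Complex.exp (2 * Complex.I * x) - 1‖ = 2 * |sin x| := by
  have : Complex.exp (2 * Complex.I * x) - 1 = Complex.exp (Complex.I * x) * (2 * Complex.I * (sin x : ℝ)) := by
    rw [Complex.ofReal_sin, Complex.sin]
    have e : Complex.exp (2 * Complex.I * x) = Complex.exp (Complex.I * x) * Complex.exp (Complex.I * x) := by
      rw [← Complex.exp_add]; ring_nf
    have e2 : Complex.exp (Complex.I * x) * Complex.exp (-(Complex.I * x)) = 1 := by
      rw [← Complex.exp_add]; simp
    rw [show -(x:ℂ) * Complex.I = -(Complex.I * x) by ring, show (x:ℂ) * Complex.I = Complex.I * x by ring]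
    linear_combination e + e2 + (-Complex.exp (Complex.I * x) * Complex.exp (-(Complex.I * x))
       + Complex.exp (Complex.I * x)^2) * Complex.I_sq
  rw [this, norm_mul, norm_mul, norm_mul, mul_comm Complex.I, Complex.norm_exp_ofReal_mul_I, Complex.norm_real, Real.norm_eq_abs]
  simp

theorem GS_sin (k : ℝ) (r i : ℕ) : ‖GS k r i‖ * |sin (k * 2 ^ r)| ≤ 1 := by
  have h := norm_exp_sub_one (k * 2 ^ r)
  have h2 := geom_sum_mul (Complex.exp (2 * Complex.I * k * (2 ^ r : ℕ))) (2 ^ i)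
  have h3 : Complex.exp (2 * Complex.I * k * (2 ^ r : ℕ)) = Complex.exp (2 * Complex.I * (k * 2 ^ r : ℝ)) := by
    congr 1; push_cast; ring
  have h4 : ‖GS k r i * (Complex.exp (2 * Complex.I * k * (2 ^ r : ℕ)) - 1)‖ ≤ 2 := by
    rw [GS, h2]
    refine (norm_sub_le _ _).trans ?_
    rw [norm_pow, norm_e3]; norm_num
  rw [norm_mul, h3, h] at h4
  linarith

theorem ww_high {b : ℝ} {r : ℕ} {β : Bool} (i : ℕ) : ∀ t : ℕ,
    (∀ m < 2 ^ (r + i), s (t + m) = b * rs r β (m % 2 ^ r)) →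
    ww s k t (2 ^ (r + i)) = Complex.exp (2 * Complex.I * k * t) * b * RS k r β * GS k r i := by
  induction i with
  | zero =>
    intro t h
    rw [add_zero, ww_shift (s' := rs r β) (c := b)]
    · simp [GS, RS]
    · intro m hm; rw [h m (by simpa using hm), Nat.mod_eq_of_lt hm]
  | succ i ih =>
    intro t h
    have hpow : 2 ^ (r + (i+1)) = 2 ^ (r + i) + 2 ^ (r + i) := by ring
    rw [hpow, ww_add, ih t, ih (t + 2 ^ (r + i)), GS_succ]
    · push_cast
      rw [mul_add, Complex.exp_add]; ring
    · intro m hm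
      rw [add_assoc, h _ (by omega)]
      congr 2
      rw [pow_add, Nat.mul_add_mod]
    · intro m hm; exact h m (by omega)

theorem HH_high {b : ℝ} (hb : 0 ≤ b) {r : ℕ} {β : Bool}
    (hf : ∀ i ≤ r, b * (√2 * √2 ^ i) ≤ 2 * k * f i) (i : ℕ)
    (hf' : ∀ l ≤ i, b * (√2 * √2 ^ r) * ‖GS k r l‖ ≤ 2 * k * f (r + l)) :
    ∀ t : ℕ, (∀ m < 2 ^ (r + i), s (t + m) = b * rs r β (m % 2 ^ r)) → HH s k f (r + i) t := by
  induction i with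
  | zero =>
    intro t h
    apply HH_low r hf β t b (abs_of_nonneg hb).le
    intro m hm; rw [h m (by simpa using hm), Nat.mod_eq_of_lt hm]
  | succ i ih =>
    intro t h
    have hpow : 2 ^ (r + (i+1)) = 2 ^ (r + i) + 2 ^ (r + i) := by ring
    have ih' := ih (fun l hl => hf' l (by omega))
    refine ⟨ih' t fun m hm => h m (by omega), ih' (t + 2 ^ (r+i)) fun m hm => ?_, ?_⟩
    · rw [add_assoc, h _ (by omega)]
      congr 2
      rw [pow_add, Nat.mul_add_mod]
    · refine le_trans ?_ (hf' (i+1) le_rfl)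
      change ‖Gh k * ww s k t (2 ^ (r + (i+1)))‖ ≤ _
      rw [ww_high (i+1) t h]
      rw [norm_mul, norm_mul, norm_mul, norm_mul, norm_e3, Complex.norm_real, Real.norm_eq_abs, one_mul,
        abs_of_nonneg hb]
      have h1 := Gh_le k
      have h2 := RS_le k r β
      calc _ ≤ 1 * (b * (√2 * √2 ^ r) * ‖GS k r (i+1)‖) := by gcongr
        _ = _ := one_mul _

end
end KR

namespace KR

theorem s2sq (j : ℕ) : (√2 ^ j) ^ 2 = (2:ℝ) ^ j := by
  rw [← pow_mul, mul_comm, pow_mul, Real.sq_sqrt (by norm_num)]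

theorem s2_mul (j : ℕ) : √2 ^ j * √2 ^ j = (2:ℝ) ^ j := by
  rw [← sq, s2sq]

theorem s2_one : 1 ≤ √2 := by
  rw [Real.one_le_sqrt]; norm_num

theorem s2_le : √2 ≤ 2 := by
  rw [Real.sqrt_le_left (by norm_num)]; norm_num

theorem s2_ge : 1.4 ≤ √2 := by
  apply Real.le_sqrt_of_sq_le; norm_num

theorem s2_mono {i j : ℕ} (h : i ≤ j) : √2 ^ i ≤ √2 ^ j := pow_le_pow_right₀ s2_one h

theorem GS_W {k : ℝ} {r i : ℕ} {W : ℝ} (hW : 0 ≤ W) (hS : 1 ≤ W ^ 2 * |sin (k * 2 ^ r)|) :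
    ‖GS k r i‖ ≤ √2 ^ i * W := by
  have h1 := GS_le k r i
  have h2 := GS_sin k r i
  apply abs_le_of_sq_le_sq' _ (by positivity) |>.2
  rw [mul_pow, s2sq]
  have h3 : ‖GS k r i‖ ≤ W ^ 2 := by
    by_contra! h
    have hs : 0 < |sin (k * 2 ^ r)| := by
      by_contra! h0
      have : |sin (k * 2 ^ r)| = 0 := le_antisymm h0 (abs_nonneg _)
      rw [this] at hS; linarith
    nlinarith
  rw [sq]
  gcongr

section
variable {s : ℕ → ℝ} {k : ℝ} {Y : ℝ → ℂ × ℂ} {b : ℝ} {N r t : ℕ} {β : Bool}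

theorem form_abs (hb : 0 < b) (hform : ∀ m < 2 ^ N, s (t + m) = b * rs r β (m % 2 ^ r)) :
    ∀ m < 2 ^ N, |s (t + m)| ≤ b := by
  intro m hm
  rw [hform m hm, abs_mul, rs_abs, mul_one, abs_of_pos hb]

theorem block_nonres {φ W : ℝ} (hs : ∀ m, |s m| ≤ 1) (hk : 0 < k) (hY : Sol (VV s) k Y)
    (hb : 0 < b) (hrN : r ≤ N)
    (hform : ∀ m < 2 ^ N, s (t + m) = b * rs r β (m % 2 ^ r))
    (hbφ : b / k ≤ φ) (hGS : ∀ l, ‖GS k r l‖ ≤ √2 ^ l * W) (hφ : b / k * W ≤ φ)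
    (hsmall : 10 * φ * (1 + N) * √2 ^ N ≤ 1) :
    ∀ x ∈ Icc (t:ℝ) (t + 2 ^ N : ℕ), ‖Y x - Y t‖ ≤ 10 * φ * √2 ^ N * ‖Y t‖ := by
  have hbk0 : 0 < b / k := by positivity
  have hφ0 : 0 < φ := by linarith
  have hone : 1 ≤ √2 ^ N := one_le_pow₀ s2_one
  have hsm2 : 10 * φ * √2 ^ N ≤ 1 := by
    refine le_trans ?_ hsmall
    have : (0:ℝ) ≤ N := Nat.cast_nonneg _
    nlinarith [show 0 ≤ 10 * φ * √2 ^ N * N by positivity]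
  have hφ1 : 10 * φ ≤ 1 := by nlinarith
  have hef : ∀ j ≤ N, 2 ^ j * (2 * φ ^ 2 * (1 + j)) ≤ φ * √2 ^ j := by
    intro j hj
    rw [← s2_mul]
    have h1 : 10 * φ * (1 + j) * √2 ^ j ≤ 1 := by
      refine le_trans ?_ hsmall
      have := s2_mono hj
      gcongr
    have h2 : 0 < √2 ^ j := by positivity
    have h3 : 0 < φ * √2 ^ j := by positivity
    have h4 : 0 ≤ φ * (1 + j) * √2 ^ j := by positivity
    nlinarith
  refine pre_bd (f := fun j => φ * √2 ^ j) (e := fun j => 2 ^ j * (2 * φ ^ 2 * (1 + j)))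
    (p := fun j => 10 * φ * √2 ^ j) hs hk hY hb (by linarith) (fun j => by positivity)
    (fun j => by positivity) ?_ ?_ ?_ (fun j => by positivity) ?_ N le_rfl t (form_abs hb hform) ?_
  · simp; gcongr
  · intro j hj
    have := hef j hj.le
    have h0 : (0:ℝ) ≤ 2 ^ j * (2 * φ ^ 2 * (1 + j)) := by positivity
    have h1 : (φ * √2 ^ j + 2 ^ j * (2 * φ ^ 2 * (1 + j))) ^ 2 ≤ (2 * (φ * √2 ^ j)) ^ 2 := by
      gcongr; linarith
    have h2 : (2 * (φ * √2 ^ j)) ^ 2 = 4 * φ ^ 2 * 2 ^ j := by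
      rw [mul_pow, mul_pow, s2sq]; ring
    push_cast
    rw [pow_succ 2 j]
    nlinarith
  · simp; linarith
  · intro j hj
    have := hef j hj.le
    have h1 : 10 * φ * √2 ^ j ≤ 1 := le_trans (by have := s2_mono hj.le; gcongr) hsm2
    have h2 : 0 < φ * √2 ^ j := by positivity
    have h3 : 1.4 * (10 * φ * √2 ^ j) ≤ 10 * φ * √2 ^ (j+1) := by
      rw [pow_succ]; nlinarith [s2_ge]
    have h0 : (0:ℝ) ≤ 2 ^ j * (2 * φ ^ 2 * (1 + j)) := by positivity
    nlinarith
  · obtain ⟨i, rfl⟩ := Nat.exists_eq_add_of_le hrN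
    refine HH_high hb.le (β := β) ?_ i ?_ t hform
    · intro i _
      have h1 : b ≤ φ * k := by rwa [div_le_iff₀ hk] at hbφ
      calc _ ≤ (φ * k) * (2 * √2 ^ i) := by gcongr; exact s2_le
        _ = _ := by ring
    · intro l _
      have h1 : b * W ≤ φ * k := by rwa [div_mul_eq_mul_div, div_le_iff₀ hk] at hφ
      calc _ ≤ b * (2 * √2 ^ r) * (√2 ^ l * W) := by
            gcongr
            · exact s2_le
            · exact hGS l
        _ = (b * W) * (2 * √2 ^ (r + l)) := by rw [pow_add]; ring
        _ ≤ (φ * k) * (2 * √2 ^ (r + l)) := by gcongr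
        _ = _ := by ring

theorem block_res {D h : ℝ} (hs : ∀ m, |s m| ≤ 1) (hk : 0 < k) (hY : Sol (VV s) k Y)
    (hD : 0 < D) (hh : 0 < h) (hbD : b = k * D * h) (hrN : r ≤ N)
    (hform : ∀ m < 2 ^ N, s (t + m) = b * rs r β (m % 2 ^ r))
    (hD4 : 4 * D ≤ 1) (hhN : √2 ^ N * h * (N + 1) ≤ 1 / 4) (hr : h * 2 ^ N ≤ √2 * √2 ^ r) :
    ‖Y (t + 2 ^ N : ℕ) - Y t - FF k (Gh k * ww s k t (2 ^ N)) (Y t)‖ ≤ 5 * D ^ 2 * ‖Y t‖ := by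
  have hb : 0 < b := by rw [hbD]; positivity
  have hbk : b / k = D * h := by rw [hbD]; field_simp
  have hone : 1 ≤ √2 ^ N := one_le_pow₀ s2_one
  have hN0 : (0:ℝ) ≤ N := Nat.cast_nonneg _
  have hX : √2 ^ N * h ≤ 1 / 4 := by
    nlinarith [show 0 ≤ √2 ^ N * h * N by positivity]
  have hh1 : h ≤ 1 := by nlinarith
  have hef : ∀ j ≤ N, 2 ^ j * (4 * D ^ 2 * ((j + 1) * h ^ 2 + 2 ^ j / 4 ^ N)) ≤
      D * (√2 ^ j * h + 2 ^ j / 2 ^ N) := by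
    intro j hj
    have h1 : 2 ^ j * (4 * D ^ 2 * ((j + 1) * h ^ 2)) ≤ D * (√2 ^ j * h) := by
      rw [← s2_mul]
      have h1 : √2 ^ j * h * (j + 1) ≤ 1 / 4 := by
        refine le_trans ?_ hhN
        have := s2_mono hj
        gcongr
      calc _ = (4 * D) * (√2 ^ j * h * (j + 1)) * (D * (√2 ^ j * h)) := by ring
        _ ≤ 1 * 1 * (D * (√2 ^ j * h)) := by gcongr; linarith
        _ = _ := by ring
    have h2 : 2 ^ j * (4 * D ^ 2 * (2 ^ j / 4 ^ N)) ≤ D * (2 ^ j / 2 ^ N) := by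
      have e : (4:ℝ) ^ N = 2 ^ N * 2 ^ N := by rw [← mul_pow]; norm_num
      have h3 : (2:ℝ) ^ j / 2 ^ N ≤ 1 := by
        rw [div_le_one (by positivity)]; exact pow_le_pow_right₀ (by norm_num) hj
      calc _ = (4 * D) * (2 ^ j / 2 ^ N) * (D * (2 ^ j / 2 ^ N)) := by rw [e]; field_simp
        _ ≤ 1 * 1 * (D * (2 ^ j / 2 ^ N)) := by gcongr
        _ = _ := by ring
    nlinarith
  have := dyadic (f := fun j => D * (√2 ^ j * h + 2 ^ j / 2 ^ N))
    (e := fun j => 2 ^ j * (4 * D ^ 2 * ((j + 1) * h ^ 2 + 2 ^ j / 4 ^ N)))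
    (N := N) hs hk hY hb (by rw [hbk]; nlinarith) (fun j => by positivity) ?_ ?_ N le_rfl t
    (form_abs hb hform) ?_
  · refine this.trans ?_
    apply mul_le_mul_of_nonneg_right _ (norm_nonneg _)
    have e : (4:ℝ) ^ N = 2 ^ N * 2 ^ N := by rw [← mul_pow]; norm_num
    have h3 : (2:ℝ) ^ N * ((N + 1) * h ^ 2) ≤ 1 / 4 := by
      rw [← s2_mul]
      calc _ = (√2 ^ N * h) * (√2 ^ N * h * (N + 1)) := by ring
        _ ≤ (1/4) * (1/4) := by gcongr
        _ ≤ _ := by norm_num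
    calc _ = 4 * D ^ 2 * (2 ^ N * ((N + 1) * h ^ 2) + 1) := by rw [e]; field_simp
      _ ≤ 4 * D ^ 2 * (1 / 4 + 1) := by gcongr
      _ = _ := by ring
  · rw [hbk]; simp
    have : 0 ≤ D ^ 2 * (4 ^ N)⁻¹ := by positivity
    nlinarith [show 0 ≤ D ^ 2 * h ^ 2 by positivity]
  · intro j hj
    have := hef j hj.le
    have h0 : (0:ℝ) ≤ 2 ^ j * (4 * D ^ 2 * ((j + 1) * h ^ 2 + 2 ^ j / 4 ^ N)) := by positivity
    have h1 : (D * (√2 ^ j * h + 2 ^ j / 2 ^ N) +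
        2 ^ j * (4 * D ^ 2 * ((j + 1) * h ^ 2 + 2 ^ j / 4 ^ N))) ^ 2 ≤
        (2 * (D * (√2 ^ j * h + 2 ^ j / 2 ^ N))) ^ 2 := by
      gcongr; linarith
    have h2 : (√2 ^ j * h + 2 ^ j / 2 ^ N) ^ 2 ≤ 2 * (2 ^ j * h ^ 2 + 2 ^ j * 2 ^ j / 4 ^ N) := by
      have e : (4:ℝ) ^ N = 2 ^ N * 2 ^ N := by rw [← mul_pow]; norm_num
      have := add_sq_le (a := √2 ^ j * h) (b := 2 ^ j / 2 ^ N)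
      refine this.trans (le_of_eq ?_)
      rw [mul_pow, s2sq, e, div_pow]; ring
    have h3 : (2 * (D * (√2 ^ j * h + 2 ^ j / 2 ^ N))) ^ 2 ≤
      4 * D ^ 2 * (2 * (2 ^ j * h ^ 2 + 2 ^ j * 2 ^ j / 4 ^ N)) := by
      calc _ = 4 * D ^ 2 * (√2 ^ j * h + 2 ^ j / 2 ^ N) ^ 2 := by ring
        _ ≤ _ := by gcongr
    push_cast
    rw [pow_succ 2 j]
    calc _ ≤ 2 * (2 ^ j * (4 * D ^ 2 * ((j + 1) * h ^ 2 + 2 ^ j / 4 ^ N))) +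
        4 * D ^ 2 * (2 * (2 ^ j * h ^ 2 + 2 ^ j * 2 ^ j / 4 ^ N)) := by linarith
      _ = _ := by ring
  · obtain ⟨i, rfl⟩ := Nat.exists_eq_add_of_le hrN
    refine HH_high hb.le (β := β) ?_ i ?_ t hform
    · intro i _
      have : (0:ℝ) ≤ 2 ^ i / 2 ^ (r + i) := by positivity
      calc _ ≤ b * (2 * √2 ^ i) := by gcongr; exact s2_le
        _ = 2 * k * (D * (√2 ^ i * h + 0)) := by rw [hbD]; ring
        _ ≤ _ := by gcongr; positivity
    · intro l _
      have h1 : b * √2 ^ r * √2 ≤ k * D * 2 * (2 ^ r / 2 ^ (r + i)) := by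
        rw [hbD, mul_div_assoc', le_div_iff₀ (by positivity)]
        calc _ = k * D * (h * 2 ^ (r + i)) * √2 ^ r * √2 := by ring
          _ ≤ k * D * (√2 * √2 ^ r) * √2 ^ r * √2 := by gcongr
          _ = k * D * (√2 * √2) * (√2 ^ r * √2 ^ r) := by ring
          _ = _ := by rw [s2_mul, Real.mul_self_sqrt (by norm_num)]
      calc _ ≤ b * (√2 * √2 ^ r) * 2 ^ l := by gcongr; exact GS_le k r l
        _ = (b * √2 ^ r * √2) * 2 ^ l := by ring
        _ ≤ (k * D * 2 * (2 ^ r / 2 ^ (r + i))) * 2 ^ l := by gcongr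
        _ = 2 * k * (D * (0 + 2 ^ (r + l) / 2 ^ (r + i))) := by rw [pow_add 2 r l]; ring
        _ ≤ _ := by gcongr; positivity

end
end KR

namespace KR

/-- exponents -/
def nn (n : ℕ) : ℕ := (n + 3).factorial

/-- period exponents -/
noncomputable def rr (α : ℝ) (n : ℕ) : ℕ := ⌊2 * (1 - α) * nn n⌋₊

/-- amplitudes -/
noncomputable def bb (α : ℝ) (n : ℕ) : ℝ := 1 / 1000 * (2:ℝ) ^ (-α * nn n)

theorem nn_succ (n : ℕ) : nn (n+1) = (n + 4) * nn n := by
  rw [nn, nn, show n + 1 + 3 = (n + 3) + 1 by ring, Nat.factorial_succ]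

theorem nn_ge (n : ℕ) : n + 6 ≤ nn n := by
  induction n with
  | zero => simp [nn, Nat.factorial]
  | succ n ih => rw [nn_succ]; nlinarith

theorem nn_step (n : ℕ) : nn n + 3 ≤ nn (n+1) := by
  rw [nn_succ]; nlinarith [nn_ge n]

theorem nn_strict : StrictMono nn := strictMono_nat_of_lt_succ fun n => by
  have := nn_step n; omega

theorem nn_lt {m n : ℕ} (h : m < n) : nn m + 3 ≤ nn n := (nn_step m).trans (nn_strict.monotone h)

theorem a_lt {m n : ℕ} (h : m < n) : 8 * 2 ^ nn m ≤ 2 ^ nn n := by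
  calc 8 * 2 ^ nn m = 2 ^ (nn m + 3) := by ring
    _ ≤ _ := Nat.pow_le_pow_right (by norm_num) (nn_lt h)

theorem nn_tendsto : Tendsto nn atTop atTop := nn_strict.tendsto_atTop

/-- values inside a block -/
noncomputable def cellv (α : ℝ) (n m : ℕ) : ℝ :=
  if m < 2 * 2 ^ nn n then bb α n * rs (rr α n) true ((m - 2 ^ nn n) % 2 ^ rr α n)
  else if 3 * 2 ^ nn n ≤ m then bb α n * rs (rr α n) false ((m - 3 * 2 ^ nn n) % 2 ^ rr α n)
  else 0

open Classical in
/-- cell amplitudes -/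
noncomputable def sig (α : ℝ) (m : ℕ) : ℝ :=
  if h : ∃ n, 2 ^ nn n ≤ m ∧ m < 4 * 2 ^ nn n then cellv α h.choose m else 0

theorem a_uniq {m n l : ℕ} (h : 2 ^ nn n ≤ m ∧ m < 4 * 2 ^ nn n)
    (h' : 2 ^ nn l ≤ m ∧ m < 4 * 2 ^ nn l) : n = l := by
  rcases lt_trichotomy n l with h1 | h1 | h1
  · have := a_lt h1; omega
  · exact h1
  · have := a_lt h1; omega

theorem sig_eq (α : ℝ) {m n : ℕ} (h : 2 ^ nn n ≤ m ∧ m < 4 * 2 ^ nn n) : sig α m = cellv α n m := by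
  have hx : ∃ n, 2 ^ nn n ≤ m ∧ m < 4 * 2 ^ nn n := ⟨n, h⟩
  rw [sig, dif_pos hx, a_uniq hx.choose_spec h]

theorem sig_P (α : ℝ) (n : ℕ) : ∀ m < 2 ^ nn n,
    sig α (2 ^ nn n + m) = bb α n * rs (rr α n) true (m % 2 ^ rr α n) := by
  intro m hm
  rw [sig_eq α (n := n) (by omega), cellv, if_pos (by omega)]; simp

theorem sig_Q (α : ℝ) (n : ℕ) : ∀ m < 2 ^ nn n,
    sig α (3 * 2 ^ nn n + m) = bb α n * rs (rr α n) false (m % 2 ^ rr α n) := by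
  intro m hm
  rw [sig_eq α (n := n) (by omega), cellv, if_neg (by omega), if_pos (by omega)]; simp

theorem sig_gap1 (α : ℝ) (n : ℕ) : ∀ m, 2 * 2 ^ nn n ≤ m → m < 3 * 2 ^ nn n → sig α m = 0 := by
  intro m hm hm'
  rw [sig_eq α (n := n) (by omega), cellv, if_neg (by omega), if_neg (by omega)]

theorem sig_gap2 (α : ℝ) (n : ℕ) : ∀ m, 4 * 2 ^ nn n ≤ m → m < 2 ^ nn (n+1) → sig α m = 0 := by
  intro m hm hm'
  rw [sig, dif_neg]
  rintro ⟨l, hl⟩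
  rcases lt_trichotomy l n with h | h | h
  · have := a_lt h; omega
  · subst h; omega
  · have : 2 ^ nn (n+1) ≤ 2 ^ nn l := Nat.pow_le_pow_right (by norm_num) (nn_strict.monotone h)
    omega

theorem bb_pos (α : ℝ) (n : ℕ) : 0 < bb α n := by unfold bb; positivity

theorem sig_abs_cell (α : ℝ) {m n : ℕ} (h : 2 ^ nn n ≤ m ∧ m < 4 * 2 ^ nn n) : |sig α m| ≤ bb α n := by
  rw [sig_eq α h, cellv]
  have := bb_pos α n
  split_ifs
  · rw [abs_mul, rs_abs, mul_one, abs_of_pos this]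
  · rw [abs_mul, rs_abs, mul_one, abs_of_pos this]
  · simp [this.le]

theorem bb_le {α : ℝ} (h0 : 0 < α) (n : ℕ) : bb α n ≤ 1 := by
  rw [bb]
  have : (2:ℝ) ^ (-α * nn n) ≤ 1 := by
    apply Real.rpow_le_one_of_one_le_of_nonpos (by norm_num)
    have : (0:ℝ) ≤ nn n := Nat.cast_nonneg _
    nlinarith
  linarith

theorem sig_le_one {α : ℝ} (h0 : 0 < α) (m : ℕ) : |sig α m| ≤ 1 := by
  by_cases h : ∃ n, 2 ^ nn n ≤ m ∧ m < 4 * 2 ^ nn n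
  · obtain ⟨n, h⟩ := h
    exact (sig_abs_cell α h).trans (bb_le h0 n)
  · rw [sig, dif_neg h]; simp

theorem sig_decay {α : ℝ} (h0 : 0 < α) (h1 : α < 1) (m : ℕ) : |sig α m| ≤ (2 + m : ℝ) ^ (-α) := by
  by_cases h : ∃ n, 2 ^ nn n ≤ m ∧ m < 4 * 2 ^ nn n
  · obtain ⟨n, h⟩ := h
    refine (sig_abs_cell α h).trans ?_
    have e : (2 + m : ℝ) ≤ 8 * 2 ^ nn n := by
      have : 2 + m ≤ 8 * 2 ^ nn n := by have := Nat.one_le_two_pow (n := nn n); omega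
      exact_mod_cast this
    have e2 : (8 * 2 ^ nn n : ℝ) ^ (-α) ≤ (2 + m : ℝ) ^ (-α) :=
      Real.rpow_le_rpow_of_nonpos (by positivity) e (by linarith)
    refine le_trans ?_ e2
    rw [Real.mul_rpow (by norm_num) (by positivity), bb, ← Real.rpow_natCast, ← Real.rpow_mul (by norm_num),
      mul_comm (nn n : ℝ)]
    gcongr
    calc (1/1000 : ℝ) ≤ 8 ^ (-1:ℝ) := by norm_num [Real.rpow_neg_one]
      _ ≤ _ := Real.rpow_le_rpow_of_exponent_le (by norm_num) (by linarith)
  · rw [sig, dif_neg h]; simp; positivity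

theorem V_decay {α : ℝ} (h0 : 0 < α) (h1 : α < 1) (x : ℝ) : |VV (sig α) x| ≤ 1 * (1 + |x|) ^ (-α) := by
  rw [one_mul]
  rcases lt_or_ge x 0 with hx | hx
  · have : sig α 0 = 0 := by
      rw [sig, dif_neg]; rintro ⟨n, hn⟩
      have := Nat.one_le_two_pow (n := nn n); omega
    have hf : ⌊x⌋₊ = 0 := Nat.floor_of_nonpos hx.le
    rw [VV, hf, this]; simp; positivity
  · refine (VV_abs _ _).trans ((sig_decay h0 h1 _).trans ?_)
    apply Real.rpow_le_rpow_of_nonpos (by positivity) _ (by linarith)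
    rw [abs_of_nonneg hx]
    linarith [Nat.lt_floor_add_one x]

theorem V_cont {α : ℝ} (h0 : 0 < α) : Continuous (VV (sig α)) := VV_cont _ (sig_le_one h0)

theorem rr_le {α : ℝ} (h0 : 1/2 < α) (n : ℕ) : rr α n ≤ nn n := by
  rw [rr]
  apply Nat.floor_le_of_le
  have : (0:ℝ) ≤ nn n := Nat.cast_nonneg _
  nlinarith

theorem rr_le' {α : ℝ} (h1 : α < 1) (n : ℕ) : (rr α n : ℝ) ≤ 2 * (1 - α) * nn n := by
  apply Nat.floor_le
  have : (0:ℝ) ≤ nn n := Nat.cast_nonneg _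
  have : 0 < 1 - α := by linarith
  positivity

theorem rr_gt (α : ℝ) (n : ℕ) : 2 * (1 - α) * nn n < rr α n + 1 := Nat.lt_floor_add_one _

end KR

namespace KR

theorem s2_rpow (j : ℕ) : √2 ^ j = (2:ℝ) ^ ((j:ℝ) / 2) := by
  rw [Real.sqrt_eq_rpow, ← Real.rpow_natCast, ← Real.rpow_mul (by norm_num)]; congr 1; ring

theorem s2_rpow_one : √2 = (2:ℝ) ^ ((1:ℝ) / 2) := Real.sqrt_eq_rpow 2

theorem hr_upper {α : ℝ} (n : ℕ) : (2:ℝ) ^ (-α * nn n) * 2 ^ nn n ≤ √2 * √2 ^ rr α n := by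
  rw [s2_rpow, s2_rpow_one, ← Real.rpow_natCast, ← Real.rpow_add (by norm_num), ← Real.rpow_add (by norm_num)]
  apply Real.rpow_le_rpow_of_exponent_le (by norm_num)
  have := rr_gt α n
  linarith

theorem hr_lower {α : ℝ} (h1 : α < 1) (n : ℕ) : √2 ^ rr α n ≤ (2:ℝ) ^ (-α * nn n) * 2 ^ nn n := by
  rw [s2_rpow, ← Real.rpow_natCast, ← Real.rpow_add (by norm_num)]
  apply Real.rpow_le_rpow_of_exponent_le (by norm_num)
  have := rr_le' h1 n
  linarith

theorem decay_aux {α : ℝ} (h0 : 1/2 < α) (p : ℕ) :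
    Tendsto (fun n : ℕ => √2 ^ nn n * (2:ℝ) ^ (-α * nn n) * (nn n : ℝ) ^ p) atTop (nhds 0) := by
  have hc : 0 < (α - 1/2) * Real.log 2 := by
    have := Real.log_pos (x := 2) (by norm_num)
    have : 0 < α - 1/2 := by linarith
    positivity
  have h := tendsto_rpow_mul_exp_neg_mul_atTop_nhds_zero (p:ℝ) _ hc
  have h2 := h.comp (tendsto_natCast_atTop_atTop.comp nn_tendsto)
  refine h2.congr fun n => ?_
  simp only [Function.comp]
  rw [s2_rpow, ← Real.rpow_add (by norm_num), Real.rpow_natCast, mul_comm, Real.rpow_def_of_pos (by norm_num)]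
  congr 2; ring

/-- non-resonance threshold -/
noncomputable def thr (α : ℝ) (n : ℕ) : ℝ := (nn n : ℝ) ^ 4 * 2 ^ rr α n / 2 ^ nn n

theorem combine {Y : ℝ → ℂ × ℂ} (A A' : ℕ) {η η' : ℝ} (hη0 : 0 < η) (hη2 : η ≤ 1)
    (B1 : ∀ x ∈ Icc (A:ℝ) (2 * A : ℕ), ‖Y x - Y A‖ ≤ η * ‖Y A‖)
    (B2 : ∀ x ∈ Icc ((3 * A : ℕ):ℝ) (4 * A : ℕ), ‖Y x - Y (3 * A : ℕ)‖ ≤ η * ‖Y (3 * A : ℕ)‖)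
    (G1 : ∀ x ∈ Icc ((2 * A : ℕ):ℝ) (3 * A : ℕ), Y x = Y (2 * A : ℕ))
    (G2 : ∀ x ∈ Icc ((4 * A : ℕ):ℝ) A', Y x = Y (4 * A : ℕ)) (hfin : 3 * η ≤ η') :
    ∀ x ∈ Icc (A:ℝ) A', ‖Y x - Y A‖ ≤ η' * ‖Y A‖ := by
  have c12 : ((A : ℕ):ℝ) ≤ (2 * A : ℕ) := by exact_mod_cast (by omega)
  have c23 : ((2 * A : ℕ):ℝ) ≤ (3 * A : ℕ) := by exact_mod_cast (by omega)
  have c34 : ((3 * A : ℕ):ℝ) ≤ (4 * A : ℕ) := by exact_mod_cast (by omega)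
  have D2 := B1 _ ⟨c12, le_rfl⟩
  have D3 := G1 _ ⟨c23, le_rfl⟩
  rw [D3] at B2
  set y := Y (A : ℕ)
  set y2 := Y (2 * A : ℕ)
  have n2 : ‖y2‖ ≤ 2 * ‖y‖ := by
    have : y2 = (y2 - y) + y := by abel
    rw [this]
    refine (norm_add_le _ _).trans ?_
    nlinarith [norm_nonneg y]
  have E2 : ∀ x ∈ Icc ((3 * A : ℕ):ℝ) (4 * A : ℕ), ‖Y x - y‖ ≤ 3 * η * ‖y‖ := by
    intro x hx
    have := B2 x hx
    have e : Y x - y = (Y x - y2) + (y2 - y) := by abel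
    rw [e]
    refine (norm_add_le _ _).trans ?_
    nlinarith [norm_nonneg y]
  have E1 : ∀ x ∈ Icc ((A : ℕ):ℝ) (2 * A : ℕ), ‖Y x - y‖ ≤ 3 * η * ‖y‖ := by
    intro x hx
    have := B1 x hx
    nlinarith [norm_nonneg y]
  intro x hx
  refine le_trans ?_ (mul_le_mul_of_nonneg_right hfin (norm_nonneg _))
  rcases le_total x (2 * A : ℕ) with h1 | h1
  · exact E1 x ⟨hx.1, h1⟩
  rcases le_total x (3 * A : ℕ) with h2 | h2
  · rw [G1 x ⟨h1, h2⟩]; exact E1 _ ⟨c12, le_rfl⟩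
  rcases le_total x (4 * A : ℕ) with h3 | h3
  · exact E2 x ⟨h2, h3⟩
  · rw [G2 x ⟨h3, hx.2⟩]; exact E2 _ ⟨c34, le_rfl⟩

theorem nonres {α k : ℝ} (h0 : 1/2 < α) (hk : 0 < k) : ∀ᶠ n in atTop,
    thr α n ≤ |sin (k * 2 ^ rr α n)| → ∀ Y, Sol (VV (sig α)) k Y →
    ∀ x ∈ Icc ((2 ^ nn n : ℕ) : ℝ) (2 ^ nn (n+1) : ℕ),
      ‖Y x - Y (2 ^ nn n : ℕ)‖ ≤ 30 / (k * (nn n) ^ 2) * ‖Y (2 ^ nn n : ℕ)‖ := by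
  have e1 := (decay_aux h0 2).eventually (ge_mem_nhds (show (0:ℝ) < 1 by norm_num))
  have e2 := (tendsto_natCast_atTop_atTop (R := ℝ).comp nn_tendsto).eventually_ge_atTop (20 / k)
  filter_upwards [e1, e2] with n e1 e2 hres Y hY
  simp only [Function.comp] at e2
  have hs := sig_le_one (α := α) (by linarith)
  have hr := hr_upper (α := α) n
  have hrN := rr_le h0 n
  have hP := sig_P α n
  have hQ := sig_Q α n
  have hg1 := sig_gap1 α n
  have hg2 := sig_gap2 α n
  have hstep : 8 * 2 ^ nn n ≤ 2 ^ nn (n+1) := a_lt (Nat.lt_succ_self n)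
  have hb := bb_pos α n
  have hbb : bb α n = 1 / 1000 * (2:ℝ) ^ (-α * nn n) := rfl
  have hN1 : (6:ℝ) ≤ nn n := by
    have := nn_ge n
    exact_mod_cast (by omega : 6 ≤ nn n)
  rw [thr] at hres
  set N := nn n
  set r := rr α n
  set b := bb α n
  set h := (2:ℝ) ^ (-α * N)
  have hh : 0 < h := by positivity
  set W := √2 ^ N / (√2 ^ r * (N:ℝ) ^ 2) with hW
  have hN0 : (0:ℝ) < N := by linarith
  have hW0 : 0 < W := by positivity
  have hGS : ∀ l, ‖GS k r l‖ ≤ √2 ^ l * W := by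
    intro l
    apply GS_W hW0.le
    calc (1:ℝ) = W ^ 2 * (N ^ 4 * 2 ^ r / 2 ^ N) := by
          rw [hW, div_pow, mul_pow, s2sq, s2sq]; field_simp
      _ ≤ _ := by gcongr
  set φ := b / k * (1 + W) with hφ
  have hφN : φ * √2 ^ N ≤ 1 / (k * N ^ 2) := by
    have a1 : h * √2 ^ N ≤ 1 / N ^ 2 := by
      rw [le_div_iff₀ (by positivity)]; linarith
    have a2 : h * W * √2 ^ N ≤ √2 * (1 / N ^ 2) := by
      have : h * W * √2 ^ N = h * 2 ^ N / (√2 ^ r * (N:ℝ) ^ 2) := by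
        rw [hW, ← s2_mul N]; field_simp
      rw [this, div_le_iff₀ (by positivity)]
      calc _ ≤ _ := hr
        _ = _ := by field_simp
    have a3 : √2 * (1 / (N:ℝ) ^ 2) ≤ 2 * (1 / (N:ℝ) ^ 2) := by gcongr; exact s2_le
    have : φ * √2 ^ N = 1 / (1000 * k) * (h * √2 ^ N + h * W * √2 ^ N) := by
      rw [hφ, hbb]; field_simp
    rw [this]
    calc _ ≤ 1 / (1000 * k) * (1 / (N:ℝ) ^ 2 + 2 * (1 / (N:ℝ) ^ 2)) := by
            apply mul_le_mul_of_nonneg_left _ (by positivity); linarith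
      _ = 3 / 1000 * (1 / (k * N ^ 2)) := by field_simp; norm_num
      _ ≤ 1 * (1 / (k * N ^ 2)) := by gcongr; norm_num
      _ = _ := one_mul _
  have hφ0 : 0 < φ := by positivity
  have hkN : 20 ≤ k * N := by rw [div_le_iff₀ hk] at e2; linarith
  have hsmall : 10 * φ * (1 + N) * √2 ^ N ≤ 1 := by
    calc _ = 10 * (1 + N) * (φ * √2 ^ N) := by ring
      _ ≤ 10 * (N + N) * (1 / (k * N ^ 2)) := by gcongr; linarith
      _ = 20 / (k * N) := by field_simp; norm_num
      _ ≤ 1 := by rw [div_le_one (by positivity)]; exact hkN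
  have hbφ : b / k ≤ φ := by rw [hφ]; nlinarith [show 0 < b / k * W by positivity]
  have hbφ' : b / k * W ≤ φ := by rw [hφ]; nlinarith [show 0 < b / k by positivity]
  have B1 := block_nonres hs hk hY hb hrN hP hbφ hGS hbφ' hsmall
  have B2 := block_nonres hs hk hY hb hrN hQ hbφ hGS hbφ' hsmall
  set η := 10 * φ * √2 ^ N with hη
  have hη0 : 0 < η := by positivity
  have hη1 : η ≤ 10 / (k * N ^ 2) := by
    calc η = 10 * (φ * √2 ^ N) := by ring
      _ ≤ 10 * (1 / (k * N ^ 2)) := by gcongr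
      _ = _ := by ring
  have hη2 : η ≤ 1 := by
    refine le_trans ?_ hsmall
    nlinarith [show 0 ≤ 10 * φ * √2 ^ N * N by positivity]
  have hfin : 3 * η ≤ 30 / (k * N ^ 2) := by
    calc _ ≤ 3 * (10 / (k * N ^ 2)) := by linarith
      _ = _ := by ring
  have G1 : ∀ x ∈ Icc ((2 * 2 ^ N : ℕ):ℝ) (3 * 2 ^ N : ℕ), Y x = Y (2 * 2 ^ N : ℕ) :=
    fun x hx => gap hY hg1 hx
  have G2 : ∀ x ∈ Icc ((4 * 2 ^ N : ℕ):ℝ) (2 ^ nn (n+1) : ℕ), Y x = Y (4 * 2 ^ N : ℕ) :=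
    fun x hx => gap hY hg2 hx
  rw [show 2 ^ N + 2 ^ N = 2 * 2 ^ N by ring] at B1
  rw [show 3 * 2 ^ N + 2 ^ N = 4 * 2 ^ N by ring] at B2
  exact combine (2 ^ N) _ hη0 hη2 B1 B2 G1 G2 hfin

theorem exists_block {a : ℕ → ℝ} (ha : Tendsto a atTop atTop) {n0 : ℕ} {x : ℝ} (hx : a n0 ≤ x) :
    ∃ n ≥ n0, a n ≤ x ∧ x ≤ a (n+1) := by
  by_contra! h
  have : ∀ n ≥ n0, a n ≤ x := by
    intro n hn
    induction n, hn using Nat.le_induction with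
    | base => exact hx
    | succ n hn ih => exact (h n hn ih).le
  obtain ⟨n, hn⟩ := ((ha.eventually_gt_atTop x).and (eventually_ge_atTop n0)).exists
  exact absurd (this n hn.2) (not_le.2 hn.1)

theorem conv_abs {E : Type*} [NormedAddCommGroup E] [CompleteSpace E] {Y : ℝ → E} {a η : ℕ → ℝ}
    (ha : Tendsto a atTop atTop) (ham : Monotone a) (hη : Summable η) (hη0 : ∀ n, 0 ≤ η n)
    (h : ∀ᶠ n in atTop, ∀ x ∈ Icc (a n) (a (n+1)), ‖Y x - Y (a n)‖ ≤ η n * ‖Y (a n)‖) :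
    ∃ l, Tendsto Y atTop (nhds l) := by
  obtain ⟨n0, hn0⟩ := eventually_atTop.1 h
  have hM : ∀ n, ‖Y (a (n + n0))‖ ≤ ‖Y (a n0)‖ * exp (∑ i ∈ Finset.range n, η (i + n0)) := by
    intro n
    induction n with
    | zero => simp
    | succ n ih =>
      have := hn0 (n + n0) (by omega) _ ⟨ham (by omega), le_rfl⟩
      have e : Y (a (n + 1 + n0)) = (Y (a (n + n0 + 1)) - Y (a (n + n0))) + Y (a (n + n0)) := by
        rw [show n + 1 + n0 = n + n0 + 1 by ring]; abel
      rw [e, Finset.sum_range_succ, exp_add]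
      calc _ ≤ η (n + n0) * ‖Y (a (n + n0))‖ + ‖Y (a (n + n0))‖ := (norm_add_le _ _).trans (by gcongr)
        _ = ‖Y (a (n + n0))‖ * (η (n + n0) + 1) := by ring
        _ ≤ (‖Y (a n0)‖ * exp (∑ i ∈ Finset.range n, η (i + n0))) * exp (η (n + n0)) := by
            have := hη0 (n + n0)
            gcongr; exact add_one_le_exp _
        _ = _ := by ring
  set M := ‖Y (a n0)‖ * exp (∑' i, η (i + n0))
  have hη' : Summable fun i => η (i + n0) := (summable_nat_add_iff n0).2 hη
  have hM' : ∀ n ≥ n0, ‖Y (a n)‖ ≤ M := by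
    intro n hn
    obtain ⟨i, rfl⟩ := Nat.exists_eq_add_of_le' hn
    refine (hM i).trans ?_
    apply mul_le_mul_of_nonneg_left _ (norm_nonneg _)
    apply exp_le_exp.2
    exact hη'.sum_le_tsum _ (fun _ _ => hη0 _)
  have hM0 : 0 ≤ M := by positivity
  have hC : CauchySeq fun n => Y (a (n + n0)) := by
    apply cauchySeq_of_dist_le_of_summable (fun n => η (n + n0) * M) _ (hη'.mul_right M)
    intro n
    rw [dist_comm, dist_eq_norm, show n.succ + n0 = n + n0 + 1 by omega]
    refine (hn0 (n + n0) (by omega) _ ⟨ham (by omega), le_rfl⟩).trans ?_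
    have := hη0 (n + n0)
    have := hM' (n + n0) (by omega)
    gcongr
  obtain ⟨l, hl⟩ := cauchySeq_tendsto_of_complete hC
  have hl' : Tendsto (fun n => Y (a n)) atTop (nhds l) := (tendsto_add_atTop_iff_nat n0).1 hl
  refine ⟨l, ?_⟩
  rw [Metric.tendsto_atTop]
  intro ε hε
  have t1 : Tendsto (fun n => η n * M + dist (Y (a n)) l) atTop (nhds (0 * M + 0)) :=
    (hη.tendsto_atTop_zero.mul_const M).add (tendsto_iff_dist_tendsto_zero.1 hl')
  simp only [zero_mul, add_zero] at t1
  obtain ⟨n1, hn1⟩ := eventually_atTop.1 (t1.eventually (gt_mem_nhds hε))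
  refine ⟨a (max n0 n1), fun x hx => ?_⟩
  obtain ⟨n, hn, hx1, hx2⟩ := exists_block ha hx
  have hn0' : n0 ≤ n := le_trans (le_max_left _ _) hn
  refine lt_of_le_of_lt ?_ (hn1 n (le_trans (le_max_right _ _) hn))
  refine (dist_triangle _ (Y (a n)) _).trans ?_
  gcongr
  rw [dist_eq_norm]
  refine (hn0 n hn0' x ⟨hx1, hx2⟩).trans ?_
  have := hη0 n
  have := hM' n hn0'
  gcongr

theorem a_tendsto : Tendsto (fun n => ((2 ^ nn n : ℕ) : ℝ)) atTop atTop :=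
  tendsto_natCast_atTop_atTop.comp ((tendsto_pow_atTop_atTop_of_one_lt (r := 2) (by norm_num)).comp nn_tendsto)

theorem a_mono : Monotone (fun n => ((2 ^ nn n : ℕ) : ℝ)) := fun m n h => by
  have : 2 ^ nn m ≤ 2 ^ nn n := Nat.pow_le_pow_right (by norm_num) (nn_strict.monotone h)
  exact Nat.cast_le.2 this

theorem sol_conv {α k : ℝ} (h0 : 1/2 < α) (hk : 0 < k)
    (hn : ∀ᶠ n in atTop, thr α n ≤ |sin (k * 2 ^ rr α n)|) {Y : ℝ → ℂ × ℂ}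
    (hY : Sol (VV (sig α)) k Y) : ∃ l, Tendsto Y atTop (nhds l) := by
  refine conv_abs (η := fun n => 30 / (k * (nn n) ^ 2)) a_tendsto a_mono ?_ (fun n => by positivity) ?_
  · have : Summable fun n : ℕ => (30 / k) * (1 / ((n:ℝ) ^ 2)) :=
      (Real.summable_one_div_nat_pow.2 (by norm_num)).mul_left _
    have := (summable_nat_add_iff 1).2 this
    refine this.of_nonneg_of_le (fun n => by positivity) fun n => ?_
    have : ((n + 1 : ℕ):ℝ) ≤ nn n := by
      have := nn_ge n
      exact_mod_cast (by omega)
    calc 30 / (k * (nn n : ℝ) ^ 2) ≤ 30 / (k * ((n+1:ℕ):ℝ) ^ 2) := by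
          have : (0:ℝ) < (n+1 : ℕ) := by positivity
          gcongr
      _ = _ := by field_simp
  · filter_upwards [hn, nonres h0 hk] with n h1 h2
    exact h2 h1 Y hY

end KR

namespace KR

theorem wronsk {V : ℝ → ℝ} {k : ℝ} {Y Z : ℝ → ℂ × ℂ} (hY : Sol V k Y) (hZ : Sol V k Z) (x : ℝ) :
    (Y x).1 * (Z x).2 - (Z x).1 * (Y x).2 = (Y 0).1 * (Z 0).2 - (Z 0).1 * (Y 0).2 := by
  have hd : ∀ x, HasDerivAt (fun x => (Y x).1 * (Z x).2 - (Z x).1 * (Y x).2) 0 x := by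
    intro x
    have f1 : ∀ {Y : ℝ → ℂ × ℂ}, Sol V k Y → HasDerivAt (fun x => (Y x).1) (((V x:ℂ)• KK k x (Y x)).1) x :=
      fun h => (ContinuousLinearMap.fst ℝ ℂ ℂ).hasFDerivAt.comp_hasDerivAt x (h x)
    have f2 : ∀ {Y : ℝ → ℂ × ℂ}, Sol V k Y → HasDerivAt (fun x => (Y x).2) (((V x:ℂ)• KK k x (Y x)).2) x :=
      fun h => (ContinuousLinearMap.snd ℝ ℂ ℂ).hasFDerivAt.comp_hasDerivAt x (h x)
    refine (((f1 hY).mul (f2 hZ)).sub ((f1 hZ).mul (f2 hY))).congr_deriv ?_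
    simp only [KK_apply, Prod.smul_fst, Prod.smul_snd, smul_eq_mul]
    ring
  exact is_const_of_deriv_eq_zero (fun x => (hd x).differentiableAt) (fun x => (hd x).deriv) x 0

theorem int_V {s : ℕ → ℝ} (hs : ∀ m, |s m| ≤ 1) {x : ℝ} (hx : 0 ≤ x) :
    |∫ y in (0:ℝ)..x, VV s y| ≤ |s ⌊x⌋₊| := by
  have hc := VV_cont s hs
  have hii : ∀ a b : ℝ, IntervalIntegrable (VV s) volume a b := fun a b => hc.intervalIntegrable a b
  have h0 : ∀ n : ℕ, ∫ y in (0:ℝ)..n, VV s y = 0 := by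
    intro n
    induction n with
    | zero => simp
    | succ n ih =>
      rw [← intervalIntegral.integral_add_adjacent_intervals (hii 0 n) (hii n _), ih]
      push_cast
      rw [int_VV_cell, add_zero]
  rw [← intervalIntegral.integral_add_adjacent_intervals (hii 0 ⌊x⌋₊) (hii _ x), h0, zero_add]
  have h1 : (⌊x⌋₊:ℝ) ≤ x := Nat.floor_le hx
  have h2 : x ≤ ⌊x⌋₊ + 1 := (Nat.lt_floor_add_one x).le
  have := intervalIntegral.norm_integral_le_of_norm_le_const (f := VV s) (a := ⌊x⌋₊) (b := x)
    (C := |s ⌊x⌋₊|) (by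
      intro y hy
      rw [uIoc_of_le h1] at hy
      rw [VV_cell s ⌊x⌋₊ ⟨hy.1.le, hy.2.trans h2⟩, norm_mul]
      exact mul_le_of_le_one_right (abs_nonneg _) (abs_sin_le_one _))
  refine this.trans ?_
  rw [abs_of_nonneg (show 0 ≤ x - ⌊x⌋₊ by linarith)]
  exact mul_le_of_le_one_right (abs_nonneg _) (by linarith)

theorem int_V_tendsto {α : ℝ} (h0 : 0 < α) (h1 : α < 1) :
    Tendsto (fun x : ℝ => ∫ y in (0:ℝ)..x, VV (sig α) y) atTop (nhds 0) := by
  apply squeeze_zero_norm' (a := fun x : ℝ => (1 + x) ^ (-α))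
  · filter_upwards [eventually_ge_atTop 0] with x hx
    refine (int_V (sig_le_one h0) hx).trans ((sig_decay h0 h1 _).trans ?_)
    apply Real.rpow_le_rpow_of_nonpos (by positivity) _ (by linarith)
    linarith [Nat.lt_floor_add_one x]
  · exact (tendsto_rpow_neg_atTop h0).comp (tendsto_atTop_add_const_left _ _ tendsto_id)

theorem phase_tendsto {α : ℝ} (h0 : 0 < α) (h1 : α < 1) (k : ℝ) :
    Tendsto (fun x : ℝ => Complex.exp (Complex.I * ((1 / (2 * k)) * ∫ y in (0:ℝ)..x, VV (sig α) y : ℝ)))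
      atTop (nhds 1) := by
  have h := int_V_tendsto h0 h1
  have h2 : Tendsto (fun x : ℝ => Complex.exp (Complex.I * ((1 / (2 * k)) * ∫ y in (0:ℝ)..x, VV (sig α) y : ℝ)))
      atTop (nhds (Complex.exp (Complex.I * ((1 / (2 * k)) * 0 : ℝ)))) := by
    have hc : Continuous fun z : ℝ => Complex.exp (Complex.I * ((1 / (2 * k)) * z : ℝ)) := by fun_prop
    exact (hc.tendsto 0).comp h
  simpa using h2

theorem wkb_iff {α : ℝ} (h0 : 0 < α) (h1 : α < 1) {k : ℝ} {Y : ℝ → ℂ × ℂ} {u : ℝ → ℂ}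
    (hu : ∀ x, u x = (Y x).1 * Complex.exp (Complex.I * k * x) + (Y x).2 * Complex.exp (-(Complex.I * k * x))) :
    HasWKBAsymptotics (VV (sig α)) k u atTop ↔
    Tendsto (fun x : ℝ => (Y x).1 + (Y x).2 * Complex.exp (-(2 * Complex.I * k * x))) atTop (nhds 1) := by
  have hp := phase_tendsto h0 h1 k
  rw [HasWKBAsymptotics]
  have e : ∀ x : ℝ, u x * Complex.exp (-(Complex.I *
        ((k * x - (1 / (2 * k)) * ∫ y in (0:ℝ)..x, VV (sig α) y : ℝ) : ℂ))) =
      ((Y x).1 + (Y x).2 * Complex.exp (-(2 * Complex.I * k * x))) *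
        Complex.exp (Complex.I * ((1 / (2 * k)) * ∫ y in (0:ℝ)..x, VV (sig α) y : ℝ)) := by
    intro x
    have e1 : -(Complex.I * ((k * x - (1 / (2 * k)) * ∫ y in (0:ℝ)..x, VV (sig α) y : ℝ) : ℂ)) =
      -(Complex.I * k * x) + Complex.I * ((1 / (2 * k)) * ∫ y in (0:ℝ)..x, VV (sig α) y : ℝ) := by
      push_cast; ring
    have e2 : Complex.exp (-(2 * Complex.I * k * x)) =
      Complex.exp (-(Complex.I * k * x)) * Complex.exp (-(Complex.I * k * x)) := by
      rw [← Complex.exp_add]; ring_nf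
    have e3 : Complex.exp (Complex.I * k * x) * Complex.exp (-(Complex.I * k * x)) = 1 := by
      rw [← Complex.exp_add]; simp
    rw [e1, Complex.exp_add, hu, e2, ← mul_assoc]
    congr 1
    linear_combination (Y x).1 * e3
  simp_rw [e]
  constructor
  · intro h
    have := h.div hp one_ne_zero
    simp only [div_one] at this
    refine this.congr fun x => ?_
    simp only [Pi.div_apply]
    rw [mul_div_cancel_right₀ _ (Complex.exp_ne_zero _)]
  · intro h
    simpa using h.mul hp

theorem good {α k : ℝ} (h0 : 1/2 < α) (h1 : α < 1) (hk : 0 < k)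
    (hn : ∀ᶠ n in atTop, thr α n ≤ |sin (k * 2 ^ rr α n)|) :
    ∃ u, SchrodingerSolution (VV (sig α)) (k ^ 2) u ∧ HasWKBAsymptotics (VV (sig α)) k u atTop := by
  have hα : 0 < α := by linarith
  have hV := V_cont hα
  have hb : ∀ x, |VV (sig α) x| ≤ 1 := fun x => (VV_abs _ _).trans (sig_le_one hα _)
  obtain ⟨Y, hY0, hY⟩ := exists_sol (VV (sig α)) hV hb hk (1, 0)
  obtain ⟨Z, hZ0, hZ⟩ := exists_sol (VV (sig α)) hV hb hk (0, 1)
  obtain ⟨p, hp⟩ := sol_conv h0 hk hn hY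
  obtain ⟨q, hq⟩ := sol_conv h0 hk hn hZ
  have hp1 := (continuous_fst.tendsto p).comp hp
  have hp2 := (continuous_snd.tendsto p).comp hp
  have hq1 := (continuous_fst.tendsto q).comp hq
  have hq2 := (continuous_snd.tendsto q).comp hq
  have hW : p.1 * q.2 - q.1 * p.2 = 1 := by
    refine tendsto_nhds_unique ((hp1.mul hq2).sub (hq1.mul hp2)) ?_
    refine tendsto_const_nhds.congr fun x => ?_
    have := wronsk hY hZ x
    simp [hY0, hZ0] at this
    simpa using this.symm
  set X : ℝ → ℂ × ℂ := fun x => q.2 • Y x - p.2 • Z x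
  have hX : Sol (VV (sig α)) k X := by
    intro x
    refine (((hY x).const_smul q.2).sub ((hZ x).const_smul p.2)).congr_deriv ?_
    simp only [X, map_sub, map_smul, smul_sub]
    rw [smul_comm q.2, smul_comm p.2]
  refine ⟨_, schrodinger_of_sol hV hk hX, (wkb_iff hα h1 (Y := X) fun x => rfl).2 ?_⟩
  have t1 : Tendsto (fun x => (X x).1) atTop (nhds 1) := by
    rw [← hW]
    have := (hp1.const_mul q.2).sub (hq1.const_mul p.2)
    refine (this.congr fun x => ?_).trans (by rw [mul_comm, mul_comm p.2])
    simp [X]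
  have t2 : Tendsto (fun x => (X x).2) atTop (nhds 0) := by
    have := (hp2.const_mul q.2).sub (hq2.const_mul p.2)
    rw [mul_comm, sub_self] at this
    refine this.congr fun x => ?_
    simp [X]
  have t3 : Tendsto (fun x : ℝ => (X x).2 * Complex.exp (-(2 * Complex.I * k * x))) atTop (nhds 0) := by
    apply squeeze_zero_norm (a := fun x => ‖(X x).2‖)
    · intro x; rw [norm_mul, norm_e2, mul_one]
    · simpa using t2.norm
  simpa using t1.add t3

/-- resonance -/
def Reso (α k : ℝ) (n : ℕ) : Prop := ∃ j : ℤ, |k * 2 ^ rr α n - π * j| ≤ 2 ^ rr α n / 2 ^ nn n / 2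

theorem GS_ge {k : ℝ} {r i : ℕ} {j : ℤ} (h : |k * 2 ^ r - π * j| * 2 ^ i ≤ 1 / 2) :
    2 ^ i / 2 ≤ ‖GS k r i‖ := by
  refine le_trans ?_ (Complex.re_le_norm _)
  rw [GS, Complex.re_sum]
  have : ∀ l ∈ Finset.range (2 ^ i), (1/2 : ℝ) ≤ (Complex.exp (2 * Complex.I * k * (2 ^ r : ℕ)) ^ l).re := by
    intro l hl
    have e : Complex.exp (2 * Complex.I * k * (2 ^ r : ℕ)) =
        Complex.exp ((2 * (k * 2 ^ r - π * j) : ℝ) * Complex.I) := by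
      rw [Complex.exp_eq_exp_iff_exists_int]
      exact ⟨j, by push_cast; ring⟩
    rw [e, ← Complex.exp_nat_mul, ← mul_assoc, ← Complex.ofReal_natCast, ← Complex.ofReal_mul,
      Complex.exp_ofReal_mul_I_re]
    refine le_trans ?_ (Real.one_sub_sq_div_two_le_cos)
    have hl' : (l:ℝ) ≤ 2 ^ i := by exact_mod_cast (Finset.mem_range.1 hl).le
    have : |(l:ℝ) * (2 * (k * 2 ^ r - π * j))| ≤ 1 := by
      rw [abs_mul, abs_mul, Nat.abs_cast, abs_two]
      nlinarith [abs_nonneg (k * 2 ^ r - π * j)]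
    have := (sq_le_one_iff_abs_le_one _).2 this
    linarith
  have := Finset.sum_le_sum this
  simp only [Finset.sum_const, Finset.card_range, nsmul_eq_mul] at this
  refine le_trans (le_of_eq ?_) this
  push_cast; ring

theorem gap_lim {k : ℝ} (hk : 0 < k) {Y : ℝ → ℂ × ℂ}
    (hY : Tendsto (fun x : ℝ => (Y x).1 + (Y x).2 * Complex.exp (-(2 * Complex.I * k * x))) atTop (nhds 1))
    {p : ℕ → ℝ} (hp : Tendsto p atTop atTop) (hg : ∀ᶠ n in atTop, Y (p n + π / (2 * k)) = Y (p n)) :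
    Tendsto (fun n => Y (p n)) atTop (nhds (1, 0)) := by
  have hp' : Tendsto (fun n => p n + π / (2 * k)) atTop atTop := tendsto_atTop_add_const_right _ _ hp
  have t1 := hY.comp hp
  have t2 := hY.comp hp'
  have hE : ∀ x : ℝ, Complex.exp (-(2 * Complex.I * k * (x + π / (2 * k) : ℝ))) =
      - Complex.exp (-(2 * Complex.I * k * x)) := by
    intro x
    have hk' : (k:ℂ) ≠ 0 := by exact_mod_cast hk.ne'
    have : -(2 * Complex.I * k * (x + π / (2 * k) : ℝ)) = -(2 * Complex.I * k * x) - π * Complex.I := by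
      have e : 2 * Complex.I * k * (π / (2 * k)) = π * Complex.I := by field_simp
      push_cast
      linear_combination -e
    rw [this, Complex.exp_sub, Complex.exp_pi_mul_I, div_neg, div_one]
  have tA : Tendsto (fun n => (Y (p n)).1) atTop (nhds 1) := by
    have := (t1.add t2).div_const 2
    rw [show ((1:ℂ)+1)/2 = 1 by norm_num] at this
    refine this.congr' ?_
    filter_upwards [hg] with n hn
    simp only [Function.comp, hn, hE]; ring
  have tB : Tendsto (fun n => (Y (p n)).2) atTop (nhds 0) := by
    have := ((t1.sub t2).div_const 2).norm
    rw [show ‖((1:ℂ)-1)/2‖ = 0 by simp] at this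
    rw [tendsto_zero_iff_norm_tendsto_zero]
    refine this.congr' ?_
    filter_upwards [hg] with n hn
    simp only [Function.comp, hn, hE]
    have e := norm_e2 k (p n)
    rw [show ((Y (p n)).1 + (Y (p n)).2 * Complex.exp (-(2 * Complex.I * k * (p n))) -
       ((Y (p n)).1 + (Y (p n)).2 * -Complex.exp (-(2 * Complex.I * k * (p n))))) =
       2 * (Y (p n)).2 * Complex.exp (-(2 * Complex.I * k * (p n))) by ring, norm_div, norm_mul, e]
    simp
  exact tA.prodMk_nhds tB

end KR

namespace KR

theorem ends_lim {α k : ℝ} (hk : 0 < k) {Y : ℝ → ℂ × ℂ} (hS : Sol (VV (sig α)) k Y)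
    (hY : Tendsto (fun x : ℝ => (Y x).1 + (Y x).2 * Complex.exp (-(2 * Complex.I * k * x))) atTop (nhds 1)) :
    Tendsto (fun n => Y (2 ^ nn n : ℕ)) atTop (nhds (1, 0)) ∧
    Tendsto (fun n => Y (2 * 2 ^ nn n : ℕ)) atTop (nhds (1, 0)) ∧
    Tendsto (fun n => Y (3 * 2 ^ nn n : ℕ)) atTop (nhds (1, 0)) ∧
    Tendsto (fun n => Y (4 * 2 ^ nn n : ℕ)) atTop (nhds (1, 0)) := by
  have hbig := a_tendsto.eventually_ge_atTop (π / (2 * k))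
  have hpos : 0 < π / (2 * k) := by positivity
  have t2 : Tendsto (fun n => Y (2 * 2 ^ nn n : ℕ)) atTop (nhds (1, 0)) := by
    apply gap_lim hk hY (p := fun n => ((2 * 2 ^ nn n : ℕ) : ℝ))
    · apply tendsto_atTop_mono _ a_tendsto
      intro n; exact Nat.cast_le.2 (by omega)
    · filter_upwards [hbig] with n hn
      apply gap hS (sig_gap1 α n)
      refine ⟨by linarith, ?_⟩
      push_cast at hn ⊢; linarith
  have t4 : Tendsto (fun n => Y (4 * 2 ^ nn n : ℕ)) atTop (nhds (1, 0)) := by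
    apply gap_lim hk hY (p := fun n => ((4 * 2 ^ nn n : ℕ) : ℝ))
    · apply tendsto_atTop_mono _ a_tendsto
      intro n; exact Nat.cast_le.2 (by omega)
    · filter_upwards [hbig] with n hn
      apply gap hS (sig_gap2 α n)
      refine ⟨by linarith, ?_⟩
      have h := a_lt (Nat.lt_succ_self n)
      have h' : ((8 * 2 ^ nn n : ℕ):ℝ) ≤ (2 ^ nn (n+1) : ℕ) := Nat.cast_le.2 h
      push_cast at hn h' ⊢
      have : (0:ℝ) < 2 ^ nn n := by positivity
      linarith
  refine ⟨?_, t2, ?_, t4⟩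
  · rw [← tendsto_add_atTop_iff_nat 1]
    refine t4.congr fun n => ?_
    have h := a_lt (Nat.lt_succ_self n)
    exact (gap hS (sig_gap2 α n) ⟨Nat.cast_le.2 (by simp only [Nat.succ_eq_add_one] at h; omega), le_rfl⟩).symm
  · refine t2.congr fun n => ?_
    exact (gap hS (sig_gap1 α n) ⟨Nat.cast_le.2 (by omega), le_rfl⟩).symm

theorem bad_num {ε D p : ℝ} (hD : 0 < D) (hD2 : D ≤ 4 / (1000 * π)) {A B y : ℝ} (hε : ε = D / 100)
    (hp : D / (8 * π) * A ≤ p) (hA : 1 - ε ≤ A) (hy : y ≤ 1 + ε)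
    (h : p ≤ B + 5 * D ^ 2 * y) (hB : B ≤ 2 * ε) : False := by
  have hπ := Real.pi_gt_three
  have hπ' := Real.pi_lt_four
  have hπ2 := Real.pi_lt_d2
  have hD3 : D ≤ 1 / 500 := by
    refine hD2.trans ?_
    rw [div_le_div_iff₀ (by positivity) (by norm_num)]; nlinarith
  have h1 : 1 / 26 ≤ 1 / (8 * π) := by
    rw [div_le_div_iff₀ (by norm_num) (by positivity)]; nlinarith
  have h2 : D / 26 * (1 - ε) ≤ D / (8 * π) * A := by
    have : D / 26 ≤ D / (8 * π) := by
      calc D / 26 = D * (1/26) := by ring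
        _ ≤ D * (1 / (8 * π)) := by gcongr
        _ = _ := by ring
    apply mul_le_mul this hA _ (by positivity)
    rw [hε]; linarith
  have h3 : 5 * D ^ 2 * y ≤ D / 100 * (1 + ε) := by
    have : 5 * D ^ 2 ≤ D / 100 := by nlinarith
    calc 5 * D ^ 2 * y ≤ 5 * D ^ 2 * (1 + ε) := by gcongr
      _ ≤ _ := by
        apply mul_le_mul_of_nonneg_right this; rw [hε]; linarith
  have h4 : ε ≤ 1 / 1000 := by rw [hε]; linarith
  have h5 : D / 26 * (999/1000) ≤ D / 26 * (1 - ε) := by gcongr; linarith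
  have h6 : D / 100 * (1 + ε) ≤ D / 100 * (1001/1000) := by gcongr; linarith
  have : D / 26 * (999/1000) ≤ 2 * (D/100) + D / 100 * (1001/1000) := by
    rw [hε] at hB; linarith
  linarith

theorem bad {α k : ℝ} (h0 : 1/2 < α) (h1 : α < 1) (hk1 : π / 4 ≤ k) (hk2 : k ≤ 3 * π / 4)
    (hn : ∃ᶠ n in atTop, Reso α k n) :
    ¬ ∃ u, SchrodingerSolution (VV (sig α)) (k ^ 2) u ∧ HasWKBAsymptotics (VV (sig α)) k u atTop := by
  rintro ⟨u, hu, hw⟩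
  have hα : 0 < α := by linarith
  have hπ := Real.pi_pos
  have hk : 0 < k := by linarith
  obtain ⟨Y, hY, hYu⟩ := sol_of_schrodinger (V_cont hα) hk hu
  rw [wkb_iff hα h1 hYu] at hw
  obtain ⟨t1, t2, t3, t4⟩ := ends_lim hk hY hw
  set D := 1 / (1000 * k) with hD
  have hD0 : 0 < D := by positivity
  have hDle : D ≤ 4 / (1000 * π) := by
    rw [hD, div_le_div_iff₀ (by positivity) (by positivity)]; linarith
  have hD4 : 4 * D ≤ 1 := by
    have : 4 / (1000 * π) ≤ 1/4 := by
      rw [div_le_div_iff₀ (by positivity) (by norm_num)]; linarith [Real.pi_gt_three]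
    linarith
  set ε := D / 100 with hε
  have hε0 : 0 < ε := by positivity
  have n1 := t1.eventually (Metric.closedBall_mem_nhds _ hε0)
  have n2 := t2.eventually (Metric.closedBall_mem_nhds _ hε0)
  have n3 := t3.eventually (Metric.closedBall_mem_nhds _ hε0)
  have n4 := t4.eventually (Metric.closedBall_mem_nhds _ hε0)
  have e1 := (decay_aux h0 2).eventually (ge_mem_nhds (show (0:ℝ) < 1/4 by norm_num))
  obtain ⟨n, ⟨j, hres⟩, n1, n2, n3, n4, e1⟩ :=
    (hn.and_eventually (n1.and (n2.and (n3.and (n4.and e1))))).exists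
  have key : ∀ (β : Bool) (t : ℕ), (∀ m < 2 ^ nn n, sig α (t + m) = bb α n * rs (rr α n) β (m % 2 ^ rr α n)) →
      √2 ^ rr α n ≤ ‖RS k (rr α n) β‖ → ‖Y t - (1, 0)‖ ≤ ε → ‖Y (t + 2 ^ nn n : ℕ) - (1, 0)‖ ≤ ε → False := by
    intro β t hform hRS hyt hyt'
    have hN1 : (6:ℝ) ≤ nn n := by
      have := nn_ge n
      exact_mod_cast (by omega : 6 ≤ nn n)
    have hrN := rr_le h0 n
    have hlow := hr_lower h1 n
    have hr := hr_upper (α := α) n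
    have hGh := Gh_ge hk1 hk2
    have hbb : bb α n = k * D * (2:ℝ) ^ (-α * nn n) := by rw [bb, hD]; field_simp
    have hs := sig_le_one hα
    set h := (2:ℝ) ^ (-α * nn n)
    have hh : 0 < h := by positivity
    have hhN : √2 ^ nn n * h * (nn n + 1) ≤ 1 / 4 := by
      refine le_trans ?_ e1
      gcongr
      nlinarith
    have B := block_res hs hk hY hD0 hh hbb hrN hform hD4 hhN hr
    obtain ⟨i, hi⟩ := Nat.exists_eq_add_of_le hrN
    have hGS : 2 ^ i / 2 ≤ ‖GS k (rr α n) i‖ := by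
      apply GS_ge (j := j)
      have : (2:ℝ) ^ rr α n / 2 ^ nn n / 2 * 2 ^ i = 1 / 2 := by
        rw [hi, pow_add]; field_simp
      rw [← this]; gcongr
    have hww : D * k / (4 * π) ≤ ‖Gh k * ww (sig α) k t (2 ^ nn n)‖ := by
      rw [hi] at hform
      have hw' := ww_high (k := k) i t hform
      rw [← hi] at hw'
      rw [hw', norm_mul, norm_mul, norm_mul, norm_mul, norm_e3, one_mul, Complex.norm_real, Real.norm_eq_abs,
        abs_of_pos (bb_pos α n)]
      have hb := bb_pos α n
      have e5 : 1 ≤ h * (√2 ^ rr α n * 2 ^ i) := by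
        have h2 : √2 ^ rr α n * √2 ^ rr α n ≤ (h * 2 ^ nn n) * √2 ^ rr α n := by gcongr
        rw [s2_mul, hi, pow_add] at h2
        have h3 : (0:ℝ) < 2 ^ rr α n := by positivity
        have : (2:ℝ) ^ rr α n * 1 ≤ 2 ^ rr α n * (h * (√2 ^ rr α n * 2 ^ i)) := by linarith
        exact le_of_mul_le_mul_left this h3
      calc D * k / (4 * π) = (1 / (2 * π)) * (k * D * 1 / 2) := by field_simp; norm_num
        _ ≤ (1 / (2 * π)) * (k * D * (h * (√2 ^ rr α n * 2 ^ i)) / 2) := by gcongr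
        _ = (1 / (2 * π)) * (bb α n * √2 ^ rr α n * (2 ^ i / 2)) := by rw [hbb]; ring
        _ ≤ _ := by gcongr
    set c := Gh k * ww (sig α) k t (2 ^ nn n)
    have hp : D / (8 * π) * ‖(Y t).1‖ ≤ ‖FF k c (Y t)‖ := by
      refine le_trans ?_ (norm_snd_le _)
      rw [FF, norm_neg, norm_mul, norm_mul, norm_2Ik hk]
      calc D / (8 * π) * ‖(Y t).1‖ = 1 / (2 * k) * (D * k / (4 * π) * ‖(Y t).1‖) := by field_simp; ring
        _ ≤ _ := by gcongr
    refine bad_num (B := ‖Y (t + 2 ^ nn n : ℕ) - Y t‖) hD0 hDle hε hp (A := ‖(Y t).1‖) (y := ‖Y t‖) ?_ ?_ ?_ ?_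
    · have := norm_fst_le (Y t - (1, 0))
      simp only [Prod.fst_sub] at this
      have h2 := norm_sub_norm_le (1:ℂ) (Y t).1
      rw [norm_sub_rev, norm_one] at h2
      linarith
    · have h2 := norm_sub_norm_le (Y t) (1, 0)
      have : ‖((1:ℂ), (0:ℂ))‖ = 1 := by simp
      linarith
    · have : FF k c (Y t) = (Y (t + 2 ^ nn n : ℕ) - Y t) - (Y (t + 2 ^ nn n : ℕ) - Y t - FF k c (Y t)) := by abel
      rw [this]
      exact (norm_sub_le _ _).trans (by gcongr)
    · have : Y (t + 2 ^ nn n : ℕ) - Y t = (Y (t + 2 ^ nn n : ℕ) - (1,0)) - (Y t - (1, 0)) := by abel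
      rw [this]
      refine (norm_sub_le _ _).trans ?_
      linarith
  rw [dist_eq_norm] at n1 n2 n3 n4
  obtain ⟨β, hβ⟩ := RS_ge k (rr α n)
  cases β
  · exact key false _ (sig_Q α n) hβ n3 (by
      rw [show 3 * 2 ^ nn n + 2 ^ nn n = 4 * 2 ^ nn n by ring]; exact n4)
  · exact key true _ (sig_P α n) hβ n1 (by
      rw [show 2 ^ nn n + 2 ^ nn n = 2 * 2 ^ nn n by ring]; exact n2)

end KR

namespace KR
open scoped ENNReal NNReal Topology

theorem limsup_cover {d : ℝ} (hd : 0 < d) (δ : ℕ → ℝ) (hδ0 : ∀ n, 0 ≤ δ n) (hδ : Tendsto δ atTop (𝓝 0))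
    (c : ℕ → ℕ) (t : ∀ n, Fin (c n) → Set ℝ) (S : Set ℝ)
    (hS : ∀ x ∈ S, ∃ᶠ n in atTop, ∃ i, x ∈ t n i)
    (ht : ∀ n i, Metric.ediam (t n i) ≤ ENNReal.ofReal (δ n))
    (hsum : Summable fun n => (c n : ℝ) * δ n ^ d) : μH[d] S ≠ ⊤ := by
  set r : ℕ → ℝ≥0∞ := fun n0 => ⨆ m ≥ n0, ENNReal.ofReal (δ m) with hr
  have hr0 : Tendsto r atTop (𝓝 0) := by
    have h1 : Tendsto (fun n => ENNReal.ofReal (δ n)) atTop (𝓝 0) := by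
      simpa using ENNReal.tendsto_ofReal hδ
    have h2 := h1.limsup_eq
    rw [limsup_eq_iInf_iSup_of_nat] at h2
    rw [← h2]
    apply tendsto_atTop_iInf
    intro a b hab
    exact iSup_mono fun m => iSup_mono' fun h => ⟨hab.trans h, le_rfl⟩
  have key := Measure.hausdorffMeasure_le_liminf_tsum (β := ℕ) (ι := fun n0 => Σ m : ℕ, Fin (c (n0 + m)))
    d S (l := atTop) r hr0 (fun n0 p => t (n0 + p.1) p.2)
    (Eventually.of_forall fun n0 p => (ht _ _).trans
      (le_iSup₂ (f := fun m (_ : m ≥ n0) => ENNReal.ofReal (δ m)) (n0 + p.1) (Nat.le_add_right _ _)))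
    (Eventually.of_forall fun n0 x hx => by
      obtain ⟨n, hn, i, hi⟩ := (frequently_atTop.1 (hS x hx)) n0
      obtain ⟨m, rfl⟩ := Nat.exists_eq_add_of_le hn
      exact mem_iUnion.2 ⟨⟨m, i⟩, hi⟩)
  have hb : ∀ n0 : ℕ, (∑' p : (Σ m : ℕ, Fin (c (n0 + m))), Metric.ediam (t (n0 + p.1) p.2) ^ d)
      ≤ ∑' n, ENNReal.ofReal ((c n : ℝ) * δ n ^ d) := by
    intro n0
    rw [ENNReal.tsum_sigma']
    refine le_trans (ENNReal.tsum_le_tsum fun m => ?_)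
      (ENNReal.tsum_comp_le_tsum_of_injective (add_right_injective n0) fun n => ENNReal.ofReal ((c n : ℝ) * δ n ^ d))
    rw [tsum_fintype]
    calc _ ≤ ∑ i : Fin (c (n0+m)), ENNReal.ofReal (δ (n0+m) ^ d) := by
            refine Finset.sum_le_sum fun i _ => ?_
            rw [← ENNReal.ofReal_rpow_of_nonneg (hδ0 _) hd.le]
            exact ENNReal.rpow_le_rpow (ht _ _) hd.le
      _ = _ := by
            rw [Finset.sum_const, Finset.card_univ, Fintype.card_fin, ENNReal.ofReal_mul (by positivity),
              ENNReal.ofReal_natCast, nsmul_eq_mul]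
  have h3 : μH[d] S ≤ ∑' n, ENNReal.ofReal ((c n : ℝ) * δ n ^ d) := by
    refine key.trans ((liminf_le_liminf (Eventually.of_forall hb)).trans ?_)
    rw [liminf_const]
  refine (h3.trans_lt ?_).ne
  rw [← ENNReal.ofReal_tsum_of_nonneg (fun n => mul_nonneg (by positivity) (rpow_nonneg (hδ0 n) d)) hsum]
  exact ENNReal.ofReal_lt_top

theorem sin_round (x : ℝ) : |x - π * round (x / π)| ≤ π / 2 * |sin x| := by
  have h1 : |x - π * round (x / π)| ≤ π / 2 := by
    have := abs_sub_round (x / π)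
    have h2 : x - π * round (x / π) = π * (x / π - round (x / π)) := by field_simp
    rw [h2, abs_mul, abs_of_pos pi_pos]; nlinarith [pi_pos]
  have h2 := mul_abs_le_abs_sin h1
  have h3 : |sin (x - π * round (x / π))| = |sin x| := by
    rw [mul_comm, Real.sin_sub_int_mul_pi, abs_mul]; simp
  rw [h3] at h2
  have := mul_le_mul_of_nonneg_left h2 (show 0 ≤ π / 2 by positivity)
  calc _ = π / 2 * (2 / π * |x - π * round (x / π)|) := by field_simp
    _ ≤ _ := this

theorem nn_inj : Function.Injective nn := nn_strict.injective

theorem sum_aux {α d : ℝ} (h1 : α < 1) (hd : 2 * (1 - α) < d) (hd1 : d < 1) (K : ℕ) :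
    Summable fun n => ((K * 2 ^ rr α n + 1 : ℕ) : ℝ) * (π * (nn n : ℝ) ^ 4 / 2 ^ nn n) ^ d := by
  set q : ℝ := (2:ℝ) ^ (2 * (1 - α) - d) with hq
  have hq1 : q < 1 := Real.rpow_lt_one_of_one_lt_of_neg (by norm_num) (by linarith)
  have hq0 : 0 < q := by positivity
  have s1 : Summable fun N : ℕ => (N:ℝ) ^ 4 * q ^ N :=
    summable_pow_mul_geometric_of_norm_lt_one 4 (by rwa [Real.norm_eq_abs, abs_of_pos hq0])
  have s2 := (s1.comp_injective nn_inj).mul_left ((K + 1) * 4 : ℝ)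
  refine Summable.of_nonneg_of_le (fun n => by positivity) (fun n => ?_) s2
  simp only [Function.comp]
  have e1 : (2:ℝ) ^ rr α n ≤ (2:ℝ) ^ (2 * (1 - α) * nn n) := by
    rw [← Real.rpow_natCast]
    exact Real.rpow_le_rpow_of_exponent_le (by norm_num) (rr_le' h1 n)
  have hN : (1:ℝ) ≤ nn n := by
    have := nn_ge n; exact_mod_cast (by omega : 1 ≤ nn n)
  have e2 : (π * (nn n : ℝ) ^ 4) ^ d ≤ 4 * (nn n:ℝ) ^ 4 := by
    have h : (1:ℝ) ≤ π * (nn n : ℝ) ^ 4 := by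
      have := one_le_pow₀ hN (n := 4); nlinarith [pi_gt_three]
    refine (Real.rpow_le_rpow_of_exponent_le h hd1.le).trans ?_
    rw [Real.rpow_one]; gcongr; exact pi_lt_four.le
  have e3 : (((2:ℝ) ^ nn n) ^ d)⁻¹ * (2:ℝ) ^ (2 * (1 - α) * nn n) = q ^ nn n := by
    rw [hq, ← Real.rpow_natCast, ← Real.rpow_natCast, ← Real.rpow_mul (by norm_num), ← Real.rpow_mul (by norm_num),
      ← Real.rpow_neg (by norm_num), ← Real.rpow_add (by norm_num)]
    congr 1; ring
  have e4 : ((K * 2 ^ rr α n + 1 : ℕ) : ℝ) ≤ (K + 1) * 2 ^ rr α n := by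
    push_cast
    nlinarith [one_le_pow₀ (show (1:ℝ) ≤ 2 by norm_num) (n := rr α n)]
  rw [Real.div_rpow (by positivity) (by positivity)]
  calc _ ≤ ((K + 1) * (2:ℝ) ^ (2 * (1 - α) * nn n)) * (4 * (nn n:ℝ) ^ 4 / ((2:ℝ) ^ nn n) ^ d) := by
          gcongr
          exact e4.trans (by gcongr)
    _ = _ := by rw [← e3]; field_simp

theorem delta_tendsto : Tendsto (fun n => π * (nn n : ℝ) ^ 4 / 2 ^ nn n) atTop (𝓝 0) := by
  have h := (tendsto_pow_const_div_const_pow_of_one_lt 4 (show (1:ℝ) < 2 by norm_num)).comp nn_tendsto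
  have := h.const_mul π
  simpa [Function.comp_def, mul_div_assoc] using this

/-- The exceptional set. -/
def Exc (V : ℝ → ℝ) : Set ℝ := {k : ℝ | 0 < k ∧
          ¬ ∃ u : ℝ → ℂ, SchrodingerSolution V (k ^ 2) u ∧
            HasWKBAsymptotics V k u atTop}

theorem upper_K {α d : ℝ} (h0 : 1/2 < α) (h1 : α < 1) (hd : 2 * (1 - α) < d) (hd1 : d < 1) (K : ℕ) (hK : 1 ≤ K) :
    μH[d] (Exc (VV (sig α)) ∩ Iic (K:ℝ)) ≠ ⊤ := by
  refine limsup_cover (by linarith) (fun n => π * (nn n : ℝ) ^ 4 / 2 ^ nn n) (fun n => by positivity) delta_tendsto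
    (fun n => K * 2 ^ rr α n + 1)
    (fun n j => Metric.closedBall (π * (j : ℕ) / 2 ^ rr α n) (π / 2 * ((nn n : ℝ) ^ 4 / 2 ^ nn n))) _ ?_ ?_ (sum_aux h1 hd hd1 K)
  · rintro k ⟨⟨hk0, hk⟩, hkK⟩
    have hf : ∃ᶠ n in atTop, |sin (k * 2 ^ rr α n)| < thr α n := by
      by_contra hcon
      rw [not_frequently] at hcon
      exact hk (good h0 h1 hk0 (hcon.mono fun n hn => not_lt.1 hn))
    refine hf.mono fun n hn => ?_
    set R : ℝ := 2 ^ rr α n with hR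
    have hR1 : 1 ≤ R := one_le_pow₀ (by norm_num)
    have h2 := sin_round (k * R)
    set j : ℤ := round (k * R / π) with hj
    have hj0 : 0 ≤ j := by
      rw [hj, round_eq]
      apply Int.floor_nonneg.2; positivity
    have hkK' : k ≤ K := hkK
    have hK' : (1:ℝ) ≤ K := by exact_mod_cast hK
    have hjK : j ≤ K * 2 ^ rr α n := by
      have h3 : (j:ℝ) ≤ k * R / π + 1/2 := by
        rw [hj, round_eq]; exact Int.floor_le _
      have h4 : k * R / π ≤ K * R / 3 := by
        have := pi_gt_three
        gcongr
      have h5 : 1 ≤ (K:ℝ) * R := one_le_mul_of_one_le_of_one_le hK' hR1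
      have h6 : (j:ℝ) < K * R + 1 := by linarith
      have h7 : (j:ℝ) < ((K * 2 ^ rr α n + 1 : ℤ) : ℝ) := by push_cast; rw [← hR]; exact h6
      have := Int.cast_lt.1 h7
      omega
    clear_value j
    lift j to ℕ using hj0
    have hjK' : j < K * 2 ^ rr α n + 1 := by
      have : j ≤ K * 2 ^ rr α n := by exact_mod_cast hjK
      omega
    refine ⟨⟨j, hjK'⟩, ?_⟩
    rw [Metric.mem_closedBall, Real.dist_eq]
    have h3 : |k - π * (j:ℕ) / R| = |k * R - π * (j:ℕ)| / R := by
      rw [eq_div_iff (by positivity)]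
      nth_rewrite 2 [← abs_of_pos (show 0 < R by positivity)]
      rw [← abs_mul]; congr 1; field_simp
    simp only
    rw [h3, div_le_iff₀ (by positivity)]
    push_cast at h2
    refine h2.trans ?_
    have : thr α n = (nn n : ℝ) ^ 4 / 2 ^ nn n * R := by rw [thr]; ring
    rw [this] at hn
    rw [mul_assoc]
    exact mul_le_mul_of_nonneg_left hn.le (by positivity)
  · intro n i
    rw [Real.closedBall_eq_Icc, Real.ediam_Icc]
    apply ENNReal.ofReal_le_ofReal
    apply le_of_eq; ring

theorem upper {α : ℝ} (h0 : 1/2 < α) (h1 : α < 1) :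
    dimH (Exc (VV (sig α))) ≤ ENNReal.ofReal (2 * (1 - α)) := by
  have hU : Exc (VV (sig α)) ⊆ ⋃ K : ℕ, Exc (VV (sig α)) ∩ Iic ((K+1:ℕ):ℝ) := by
    intro k hk
    obtain ⟨K, hK⟩ := exists_nat_ge k
    exact mem_iUnion.2 ⟨K, hk, hK.trans (by push_cast; linarith)⟩
  refine (dimH_mono hU).trans ?_
  rw [dimH_iUnion]
  refine iSup_le fun K => ?_
  refine le_of_forall_gt_imp_ge_of_dense fun e he => ?_
  rcases le_or_gt 1 e with h | h
  · obtain ⟨d, hd, hd1⟩ := exists_between (show 2 * (1 - α) < 1 by linarith)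
    have hd0 : 0 ≤ d := by linarith
    have := dimH_le_of_hausdorffMeasure_ne_top (d := ⟨d, hd0⟩) (upper_K h0 h1 hd hd1 (K+1) (by omega))
    refine this.trans (le_trans ?_ h)
    exact ENNReal.coe_le_one_iff.2 hd1.le
  · lift e to ℝ≥0 using (h.trans ENNReal.one_lt_top).ne
    have hd : 2 * (1 - α) < e := by
      have := (ENNReal.ofReal_lt_iff_lt_toReal (by linarith) ENNReal.coe_ne_top).1 he
      simpa using this
    exact dimH_le_of_hausdorffMeasure_ne_top (upper_K h0 h1 hd (by exact_mod_cast h) (K+1) (by omega))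
end KR

namespace KR
open scoped ENNReal NNReal Topology

/-- number of digits used so far -/
def mm (L : ℕ → ℕ) (i : ℕ) : ℕ := ∑ j ∈ Finset.range i, L j

theorem mm_succ (L : ℕ → ℕ) (i : ℕ) : mm L (i+1) = mm L i + L i := Finset.sum_range_succ _ _

/-- digit blocks -/
noncomputable def dig (L : ℕ → ℕ) (i : ℕ) (x : ℝ) : ℤ := ⌊2 ^ mm L (i+1) * x⌋ - 2 ^ L i * ⌊2 ^ mm L i * x⌋

theorem dig_nonneg (L : ℕ → ℕ) (i : ℕ) (x : ℝ) : 0 ≤ dig L i x := by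
  have h := Int.floor_le (2 ^ mm L i * x)
  rw [dig, sub_nonneg, Int.le_floor, mm_succ]
  push_cast
  rw [pow_add, mul_comm (2 ^ mm L i) (2 ^ L i), mul_assoc]
  gcongr

theorem dig_lt (L : ℕ → ℕ) (i : ℕ) (x : ℝ) : dig L i x < 2 ^ L i := by
  have h := Int.lt_floor_add_one (2 ^ mm L i * x)
  rw [dig, sub_lt_iff_lt_add, Int.floor_lt, mm_succ]
  push_cast
  rw [pow_add, mul_comm (2 ^ mm L i) (2 ^ L i), mul_assoc]
  have : (0:ℝ) < 2 ^ L i := by positivity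
  nlinarith

/-- terms -/
noncomputable def tt (P L : ℕ → ℕ) (x : ℝ) (i : ℕ) : ℝ := dig L i x / 2 ^ (P i + L i)

theorem tt_nonneg (P L : ℕ → ℕ) (x : ℝ) (i : ℕ) : 0 ≤ tt P L x i := by
  have : (0:ℝ) ≤ dig L i x := by exact_mod_cast dig_nonneg L i x
  unfold tt; positivity

theorem tt_le (P L : ℕ → ℕ) (x : ℝ) (i : ℕ) : tt P L x i ≤ 1 / 2 ^ P i := by
  have : (dig L i x : ℝ) ≤ 2 ^ L i := by exact_mod_cast (dig_lt L i x).le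
  rw [tt, pow_add, div_le_div_iff₀ (by positivity) (by positivity)]
  have : (0:ℝ) < 2 ^ P i := by positivity
  nlinarith

theorem P_add {P L : ℕ → ℕ} (hP : ∀ i, P i + L i + 4 ≤ P (i+1)) (i j : ℕ) : P i + j ≤ P (i + j) := by
  induction j with
  | zero => simp
  | succ j ih => have := hP (i + j); rw [← add_assoc i j 1]; omega

theorem tt_tail {P L : ℕ → ℕ} (hP : ∀ i, P i + L i + 4 ≤ P (i+1)) (x : ℝ) (i : ℕ) :
    Summable (fun j => tt P L x (i + j)) ∧ 0 ≤ ∑' j, tt P L x (i + j) ∧ ∑' j, tt P L x (i + j) ≤ 2 / 2 ^ P i := by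
  have hg : Summable fun j : ℕ => 1 / (2:ℝ) ^ P i * (1 / 2) ^ j := summable_geometric_two.mul_left _
  have hle : ∀ j, tt P L x (i + j) ≤ 1 / (2:ℝ) ^ P i * (1 / 2) ^ j := fun j => by
    refine (tt_le P L x _).trans ?_
    rw [one_div_pow, one_div_mul_one_div, ← pow_add]
    exact one_div_le_one_div_of_le (by positivity) (pow_le_pow_right₀ (by norm_num) (P_add hP i j))
  have hs := Summable.of_nonneg_of_le (fun j => tt_nonneg P L x (i+j)) hle hg
  refine ⟨hs, tsum_nonneg fun j => tt_nonneg _ _ _ _, (hs.tsum_le_tsum hle hg).trans ?_⟩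
  rw [tsum_mul_left, tsum_geometric_two]
  apply le_of_eq; ring

/-- the coding map -/
noncomputable def GG (P L : ℕ → ℕ) (x : ℝ) : ℝ := ∑' i, tt P L x i

theorem GG_split {P L : ℕ → ℕ} (hP : ∀ i, P i + L i + 4 ≤ P (i+1)) (x : ℝ) (i : ℕ) :
    GG P L x = ∑ j ∈ Finset.range i, tt P L x j + ∑' j, tt P L x (i + j) := by
  have hs : Summable (tt P L x) := by simpa using (tt_tail hP x 0).1
  rw [GG, ← hs.sum_add_tsum_nat_add i]
  simp_rw [add_comm i]

theorem GG_bd {P L : ℕ → ℕ} (hP0 : 4 ≤ P 0) (hP : ∀ i, P i + L i + 4 ≤ P (i+1)) (x : ℝ) :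
    0 ≤ GG P L x ∧ GG P L x ≤ 1 / 2 := by
  have h := tt_tail hP x 0
  simp only [zero_add] at h
  refine ⟨h.2.1, h.2.2.trans ?_⟩
  rw [div_le_div_iff₀ (by positivity) (by norm_num)]
  have : (2:ℝ) ^ 4 ≤ 2 ^ P 0 := pow_le_pow_right₀ (by norm_num) hP0
  linarith

theorem PL_mono {P L : ℕ → ℕ} (hP : ∀ i, P i + L i + 4 ≤ P (i+1)) : Monotone fun i => P i + L i :=
  monotone_nat_of_le_succ fun i => by have := hP i; show P i + L i ≤ P (i+1) + L (i+1); omega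

theorem GG_reso {P L : ℕ → ℕ} (hP0 : 4 ≤ P 0) (hP : ∀ i, P i + L i + 4 ≤ P (i+1)) (x : ℝ) (i : ℕ) :
    ∃ j : ℤ, |π * (1 / 4 + GG P L x) * 2 ^ (P i + L i) - π * j| ≤ 2 ^ (P i + L i) / 2 ^ P (i+1) * 8 := by
  have hint : ∃ z : ℤ, (z:ℝ) = (∑ j ∈ Finset.range (i+1), tt P L x j) * 2 ^ (P i + L i) := by
    refine ⟨∑ j ∈ Finset.range (i+1), dig L j x * 2 ^ (P i + L i - (P j + L j)), ?_⟩
    push_cast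
    rw [Finset.sum_mul]
    refine Finset.sum_congr rfl fun j hj => ?_
    have : P j + L j ≤ P i + L i := PL_mono hP (Nat.lt_succ_iff.1 (Finset.mem_range.1 hj))
    obtain ⟨e, he⟩ := Nat.exists_eq_add_of_le this
    rw [tt, he, Nat.add_sub_cancel_left, pow_add _ (P j + L j) e]
    field_simp
  obtain ⟨z, hz⟩ := hint
  have h2 : 2 ≤ P i + L i := by have := P_add hP 0 i; rw [zero_add] at this; omega
  obtain ⟨e, he⟩ := Nat.exists_eq_add_of_le h2
  refine ⟨z + 2 ^ e, ?_⟩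
  have ht := tt_tail hP x (i+1)
  have : π * (1 / 4 + GG P L x) * 2 ^ (P i + L i) - π * ((z + 2 ^ e : ℤ) : ℝ)
      = π * (∑' j, tt P L x (i + 1 + j)) * 2 ^ (P i + L i) := by
    push_cast
    rw [GG_split hP x (i+1), hz, he, pow_add]
    ring
  rw [this, abs_of_nonneg (by have := ht.2.1; positivity)]
  calc π * (∑' j, tt P L x (i + 1 + j)) * 2 ^ (P i + L i) ≤ 4 * (2 / 2 ^ P (i+1)) * 2 ^ (P i + L i) := by
        have := ht.2.2
        have := ht.2.1
        have := pi_lt_four.le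
        gcongr
    _ = _ := by ring

theorem GG_sep {P L : ℕ → ℕ} (hP : ∀ i, P i + L i + 4 ≤ P (i+1)) (hL : ∀ i, 1 ≤ L i) {x y : ℝ} (hx : x ∈ Ico (0:ℝ) 1)
    (hy : y ∈ Ico (0:ℝ) 1) (hxy : x < y) : ∃ i, ∃ D : ℝ, 1 ≤ D ∧ D ≤ 2 ^ L i ∧ y - x ≤ 2 * D / 2 ^ mm L (i+1) ∧
      D / 2 ^ (P i + L i) ≤ 2 * (GG P L y - GG P L x) := by
  classical
  have hex : ∃ i, ⌊2 ^ mm L i * x⌋ ≠ ⌊2 ^ mm L i * y⌋ := by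
    by_contra! hcon
    have hm : ∀ i, i ≤ mm L i := fun i => by
      induction i with
      | zero => simp
      | succ i ih => rw [mm_succ]; have := hL i; omega
    obtain ⟨i, hi⟩ := pow_unbounded_of_one_lt (1 / (y - x)) (show (1:ℝ) < 2 by norm_num)
    have h1 : 1 / (y - x) < 2 ^ mm L i := hi.trans_le (pow_le_pow_right₀ (by norm_num) (hm i))
    rw [div_lt_iff₀ (by linarith)] at h1
    have h2 := Int.abs_sub_lt_one_of_floor_eq_floor (hcon i)
    rw [abs_sub_comm, ← mul_sub] at h2
    have := le_abs_self (2 ^ mm L i * (y - x))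
    linarith
  have h0 : ⌊2 ^ mm L 0 * x⌋ = ⌊2 ^ mm L 0 * y⌋ := by
    simp only [mm, Finset.range_zero, Finset.sum_empty, pow_zero, one_mul]
    rw [Int.floor_eq_zero_iff.2 hx, Int.floor_eq_zero_iff.2 hy]
  obtain ⟨i, hi⟩ : ∃ i, Nat.find hex = i + 1 := Nat.exists_eq_succ_of_ne_zero fun h => by
    have := Nat.find_spec hex; rw [h] at this; exact this h0
  have hne := Nat.find_spec hex
  rw [hi] at hne
  have heq : ∀ j ≤ i, ⌊2 ^ mm L j * x⌋ = ⌊2 ^ mm L j * y⌋ := fun j hj => by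
    by_contra hc
    have := Nat.find_min' hex hc
    omega
  have hdig : ∀ j < i, tt P L x j = tt P L y j := fun j hj => by
    rw [tt, tt, dig, dig, heq j hj.le, heq (j+1) hj]
  have hD : dig L i y - dig L i x = ⌊2 ^ mm L (i+1) * y⌋ - ⌊2 ^ mm L (i+1) * x⌋ := by
    rw [dig, dig, heq i le_rfl]; ring
  have hle : ⌊2 ^ mm L (i+1) * x⌋ ≤ ⌊2 ^ mm L (i+1) * y⌋ := Int.floor_le_floor (by gcongr)
  have hD1 : 1 ≤ dig L i y - dig L i x := by rw [hD]; omega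
  have hD1' : (1:ℝ) ≤ dig L i y - dig L i x := by exact_mod_cast hD1
  refine ⟨i, (dig L i y - dig L i x : ℝ), hD1', ?_, ?_, ?_⟩
  · have := dig_lt L i y
    have h2 := dig_nonneg L i x
    have : dig L i y - dig L i x ≤ 2 ^ L i := by omega
    exact_mod_cast this
  · rw [le_div_iff₀ (by positivity)]
    have hDr : (dig L i y - dig L i x : ℝ) = ⌊2 ^ mm L (i+1) * y⌋ - ⌊2 ^ mm L (i+1) * x⌋ := by exact_mod_cast hD
    have a1 := Int.lt_floor_add_one (2 ^ mm L (i+1) * y)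
    have a2 := Int.floor_le (2 ^ mm L (i+1) * x)
    linarith
  · rw [GG_split hP y (i+1), GG_split hP x (i+1), Finset.sum_range_succ, Finset.sum_range_succ,
      Finset.sum_congr rfl (fun j hj => hdig j (Finset.mem_range.1 hj))]
    have b1 := (tt_tail hP x (i+1)).2.2
    have b2 := (tt_tail hP y (i+1)).2.1
    have b3 : tt P L y i - tt P L x i = (dig L i y - dig L i x : ℝ) / 2 ^ (P i + L i) := by
      rw [tt, tt]; ring
    have b4 : 2 * (2 / (2:ℝ) ^ P (i+1)) ≤ (dig L i y - dig L i x : ℝ) / 2 ^ (P i + L i) := by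
      have : (2:ℝ) ^ (P i + L i + 4) ≤ 2 ^ P (i+1) := pow_le_pow_right₀ (by norm_num) (hP i)
      rw [pow_add] at this
      rw [← mul_div_assoc, div_le_div_iff₀ (by positivity) (by positivity)]
      have : (0:ℝ) < 2 ^ (P i + L i) := by positivity
      nlinarith
    linarith

theorem GG_holder {P L : ℕ → ℕ} (hP : ∀ i, P i + L i + 4 ≤ P (i+1)) (hL : ∀ i, 1 ≤ L i) {s : ℝ} (hs0 : 0 < s)
    (hs1 : s < 1) (hm : ∀ i, s * P i ≤ mm L i + 9) {x y : ℝ} (hx : x ∈ Ico (0:ℝ) 1)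
    (hy : y ∈ Ico (0:ℝ) 1) (hxy : x < y) : y - x ≤ 2048 * (GG P L y - GG P L x) ^ s ∧ GG P L x < GG P L y := by
  obtain ⟨i, D, hD1, hD2, h1, h2⟩ := GG_sep hP hL hx hy hxy
  have hpos : 0 < D / 2 ^ (P i + L i) := by positivity
  refine ⟨?_, by linarith⟩
  have h3 : (D / 2 ^ (P i + L i)) ^ s ≤ 2 * (GG P L y - GG P L x) ^ s := by
    refine (Real.rpow_le_rpow hpos.le h2 hs0.le).trans ?_
    rw [Real.mul_rpow (by norm_num) (by linarith)]
    have : (2:ℝ) ^ s ≤ 2 := by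
      have := Real.rpow_le_rpow_of_exponent_le (show (1:ℝ) ≤ 2 by norm_num) hs1.le
      simpa using this
    have : 0 ≤ (GG P L y - GG P L x) ^ s := Real.rpow_nonneg (by linarith) _
    nlinarith
  refine h1.trans ?_
  have h4 : 2 * D / 2 ^ mm L (i+1) ≤ 1024 * (D / 2 ^ (P i + L i)) ^ s := by
    have e1 : D ≤ D ^ s * (2:ℝ) ^ (L i * (1 - s)) := by
      calc D = D ^ s * D ^ (1 - s) := by
            rw [← Real.rpow_add (by linarith)]; simp
        _ ≤ D ^ s * ((2:ℝ) ^ L i) ^ (1 - s) := by gcongr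
        _ = _ := by rw [← Real.rpow_natCast, ← Real.rpow_mul (by norm_num)]
    have e2 : (2:ℝ) ^ (L i * (1 - s)) * (1 / 2 ^ mm L (i+1)) ≤ 512 * (2:ℝ) ^ (-(s * (P i + L i))) := by
      have : (512:ℝ) = (2:ℝ) ^ (9:ℝ) := by norm_num
      rw [this, one_div, ← Real.rpow_natCast, ← Real.rpow_neg (by norm_num), ← Real.rpow_add (by norm_num),
        ← Real.rpow_add (by norm_num)]
      apply Real.rpow_le_rpow_of_exponent_le (by norm_num)
      rw [mm_succ]; push_cast
      linarith [hm i]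
    have e3 : (D / 2 ^ (P i + L i)) ^ s = D ^ s * (2:ℝ) ^ (-(s * (P i + L i))) := by
      rw [Real.div_rpow (by linarith) (by positivity), ← Real.rpow_natCast, ← Real.rpow_mul (by norm_num),
        div_eq_mul_inv, ← Real.rpow_neg (by norm_num)]
      push_cast; congr 2; ring
    rw [e3]
    have hDs : 0 < D ^ s := by positivity
    calc 2 * D / 2 ^ mm L (i+1) = 2 * D * (1 / 2 ^ mm L (i+1)) := by ring
      _ ≤ 2 * (D ^ s * (2:ℝ) ^ (L i * (1 - s))) * (1 / 2 ^ mm L (i+1)) := by gcongr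
      _ = 2 * D ^ s * ((2:ℝ) ^ (L i * (1 - s)) * (1 / 2 ^ mm L (i+1))) := by ring
      _ ≤ 2 * D ^ s * (512 * (2:ℝ) ^ (-(s * (P i + L i)))) := by gcongr
      _ = _ := by ring
  linarith

theorem GG_dim {P L : ℕ → ℕ} (hP : ∀ i, P i + L i + 4 ≤ P (i+1)) (hL : ∀ i, 1 ≤ L i) {s : ℝ} (hs0 : 0 < s)
    (hs1 : s < 1) (hm : ∀ i, s * P i ≤ mm L i + 9) :
    ENNReal.ofReal s ≤ dimH ((fun x => π * (1 / 4 + GG P L x)) '' Ico (0:ℝ) 1) := by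
  set F : ℝ → ℝ := fun x => π * (1 / 4 + GG P L x) with hF
  have hmono : StrictMonoOn F (Ico 0 1) := fun x hx y hy hxy => by
    have := (GG_holder hP hL hs0 hs1 hm hx hy hxy).2
    simp only [hF]; have := pi_pos; gcongr
  have hinj := hmono.injOn
  have hlt : ∀ x ∈ Ico (0:ℝ) 1, ∀ y ∈ Ico (0:ℝ) 1, x < y → |x - y| ≤ 2048 * |F x - F y| ^ s := by
    intro x hx y hy hxy
    have h := GG_holder hP hL hs0 hs1 hm hx hy hxy
    rw [abs_sub_comm, abs_of_pos (by linarith), abs_sub_comm, abs_of_pos (sub_pos.2 (hmono hx hy hxy))]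
    refine h.1.trans ?_
    have h5 : GG P L y - GG P L x ≤ F y - F x := by simp only [hF]; nlinarith [pi_gt_three, h.2]
    exact mul_le_mul_of_nonneg_left (Real.rpow_le_rpow (by linarith [h.2]) h5 hs0.le) (by norm_num)
  have habs : ∀ x ∈ Ico (0:ℝ) 1, ∀ y ∈ Ico (0:ℝ) 1, |x - y| ≤ 2048 * |F x - F y| ^ s := by
    intro x hx y hy
    rcases lt_trichotomy x y with h | h | h
    · exact hlt x hx y hy h
    · subst h; simp; positivity
    · have := hlt y hy x hx h
      rwa [abs_sub_comm, abs_sub_comm (F x)]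
  have hH : HolderOnWith 2048 s.toNNReal (Function.invFunOn F (Ico 0 1)) (F '' Ico 0 1) := by
    rintro _ ⟨x, hx, rfl⟩ _ ⟨y, hy, rfl⟩
    rw [hinj.leftInvOn_invFunOn hx, hinj.leftInvOn_invFunOn hy, edist_dist, edist_dist, Real.dist_eq, Real.dist_eq]
    have := habs x hx y hy
    calc ENNReal.ofReal |x - y| ≤ ENNReal.ofReal (2048 * |F x - F y| ^ s) := ENNReal.ofReal_le_ofReal this
      _ = _ := by
        rw [ENNReal.ofReal_mul (by norm_num), Real.coe_toNNReal _ hs0.le, ENNReal.ofReal_rpow_of_nonneg (abs_nonneg _) hs0.le]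
        congr 1
        simp
  have h1 := hH.dimH_image_le (by simpa using hs0)
  have h2 : Function.invFunOn F (Ico 0 1) '' (F '' Ico 0 1) = Ico 0 1 := by
    rw [← image_comp]
    have : EqOn (Function.invFunOn F (Ico 0 1) ∘ F) id (Ico 0 1) := fun x hx => hinj.leftInvOn_invFunOn hx
    rw [this.image_eq, image_id]
  have h3 : dimH (Ico (0:ℝ) 1) = 1 := by
    rw [Real.dimH_of_nonempty_interior (by simp)]; simp
  rw [h2, h3] at h1
  change _ ≤ _ / ENNReal.ofReal s at h1
  rw [ENNReal.le_div_iff_mul_le (Or.inl (by simpa using hs0)) (Or.inl ENNReal.ofReal_ne_top), one_mul] at h1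
  exact h1

end KR

namespace KR
open scoped ENNReal NNReal Topology

/-- starting positions of free blocks -/
def PP (n0 : ℕ) : ℕ → ℕ
  | 0 => 4
  | i+1 => nn (n0 + i) + 4

theorem lower_s {α s : ℝ} (h0 : 1/2 < α) (h1 : α < 1) (hs0 : 0 < s) (hs : s < 2 * (1 - α)) :
    ENNReal.ofReal s ≤ dimH (Exc (VV (sig α))) := by
  obtain ⟨n0, hn⟩ := exists_nat_ge (6 / s + 1 / (2 * (1 - α) - s))
  have hb : 0 < 2 * (1 - α) - s := by linarith
  have hn1 : 6 ≤ s * n0 := by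
    have : 6 / s ≤ n0 := le_trans (by have : 0 < 1 / (2 * (1 - α) - s) := by positivity
                                      linarith) hn
    rw [div_le_iff₀ hs0] at this; linarith
  have hn2 : 1 ≤ (2 * (1 - α) - s) * n0 := by
    have : 1 / (2 * (1 - α) - s) ≤ n0 := le_trans (by have : 0 < 6 / s := by positivity
                                                      linarith) hn
    rw [div_le_iff₀ hb] at this; linarith
  have hM : ∀ i, 6 ≤ s * nn (n0 + i) := fun i => by
    have : (n0:ℝ) ≤ nn (n0 + i) := by
      have := nn_ge (n0 + i); exact_mod_cast (by omega : n0 ≤ nn (n0 + i))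
    nlinarith
  have hPb : ∀ i, (PP n0 i : ℝ) ≤ (2 * (1 - α) - s) * nn (n0 + i) + 4 := by
    intro i
    cases i with
    | zero => simp only [PP]; push_cast; nlinarith [Nat.cast_nonneg (α := ℝ) (nn (n0 + 0))]
    | succ i =>
      simp only [PP]; rw [← add_assoc, nn_succ]; push_cast
      have : (0:ℝ) ≤ nn (n0 + i) := Nat.cast_nonneg _
      have h2 : 1 ≤ (2 * (1 - α) - s) * ((n0:ℝ) + i + 4) := by
        have : (0:ℝ) ≤ i := Nat.cast_nonneg _
        nlinarith
      nlinarith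
  set L : ℕ → ℕ := fun i => rr α (n0 + i) - PP n0 i with hL
  have hgap : ∀ i, (PP n0 i : ℝ) + (s * nn (n0 + i) - 5) < rr α (n0 + i) := fun i => by
    have := rr_gt α (n0 + i); have := hPb i; linarith
  have hle : ∀ i, PP n0 i + 1 ≤ rr α (n0 + i) := fun i => by
    have h2 := hgap i; have h3 := hM i
    have : (PP n0 i : ℝ) < rr α (n0 + i) := by linarith
    exact_mod_cast this
  have hR : ∀ i, PP n0 i + L i = rr α (n0 + i) := fun i => by
    have := hle i; simp only [hL]; omega
  have hL1 : ∀ i, 1 ≤ L i := fun i => by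
    have := hle i; simp only [hL]; omega
  have hP : ∀ i, PP n0 i + L i + 4 ≤ PP n0 (i+1) := fun i => by
    rw [hR]; simp only [PP]; have := rr_le h0 (n0 + i); omega
  have hm : ∀ i, s * PP n0 i ≤ mm L i + 9 := by
    intro i
    cases i with
    | zero => simp only [PP, mm]; push_cast; simp; linarith
    | succ i =>
      have h2 := hgap i
      have h3 : (PP n0 i : ℝ) + L i = rr α (n0 + i) := by exact_mod_cast hR i
      rw [mm_succ]; simp only [PP]; push_cast
      have : (0:ℝ) ≤ mm L i := Nat.cast_nonneg _
      nlinarith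
  refine (GG_dim hP hL1 hs0 (by linarith) hm).trans (dimH_mono ?_)
  rintro _ ⟨x, hx, rfl⟩
  have hG := GG_bd (P := PP n0) (L := L) le_rfl hP x
  have hk1 : π / 4 ≤ π * (1 / 4 + GG (PP n0) L x) := by nlinarith [pi_pos]
  have hk2 : π * (1 / 4 + GG (PP n0) L x) ≤ 3 * π / 4 := by nlinarith [pi_pos]
  refine ⟨lt_of_lt_of_le (by positivity) hk1, bad h0 h1 hk1 hk2 (Eventually.frequently ?_)⟩
  refine eventually_atTop.2 ⟨n0, fun n hn => ?_⟩
  obtain ⟨i, rfl⟩ := Nat.exists_eq_add_of_le hn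
  obtain ⟨j, hj⟩ := GG_reso (P := PP n0) (L := L) le_rfl hP x i
  refine ⟨j, ?_⟩
  rw [hR] at hj
  refine hj.trans (le_of_eq ?_)
  simp only [PP]; rw [pow_add]; field_simp; norm_num

theorem lower {α : ℝ} (h0 : 1/2 < α) (h1 : α < 1) :
    ENNReal.ofReal (2 * (1 - α)) ≤ dimH (Exc (VV (sig α))) := by
  refine le_of_forall_lt_imp_le_of_dense fun e he => ?_
  lift e to ℝ≥0 using (he.trans ENNReal.ofReal_lt_top).ne
  rcases eq_or_lt_of_le (zero_le (a := e)) with h | h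
  · rw [← h]; simp
  · have hd : (e:ℝ) < 2 * (1 - α) := by
      have := (ENNReal.lt_ofReal_iff_toReal_lt ENNReal.coe_ne_top).1 he
      simpa using this
    have := lower_s h0 h1 (s := e) (by exact_mod_cast h) hd
    simpa using this
end KR

/-- **Kriecherbauer–Remling example.** For every `1/2 < α < 1` there is a potential
`|V(x)| ≤ C(1+|x|)^{-α}` such that the set of momenta `k > 0` at which no solution of
`-u'' + V u = k² u` has WKB asymptotics at `+∞` has Hausdorff dimension exactly
`2(1-α)`. -/
theorem kriecherbauer_remling_example
    (α : ℝ) (hα1 : 1 / 2 < α) (hα2 : α < 1) :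
    ∃ (C : ℝ) (V : ℝ → ℝ),
      Measurable V ∧ LocallyIntegrable V ∧
      (∀ x : ℝ, |V x| ≤ C * (1 + |x|) ^ (-α)) ∧
      dimH {k : ℝ | 0 < k ∧
          ¬ ∃ u : ℝ → ℂ, SchrodingerSolution V (k ^ 2) u ∧
            HasWKBAsymptotics V k u atTop}
        = ENNReal.ofReal (2 * (1 - α)) := by
  have hc := KR.V_cont (α := α) (by linarith)
  exact ⟨1, KR.VV (KR.sig α), hc.measurable, hc.locallyIntegrable, KR.V_decay (by linarith) hα2,
    le_antisymm (KR.upper hα1 hα2) (KR.lower hα1 hα2)⟩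
end

section
/- Let 1 ≤ p < 2 and let g : ℝ → ℂ be measurable with ∫_ℝ |g(x)|^p dx < ∞. Then for Lebesgue-almost every k ∈ ℝ, the limit lim_{N→∞} ∫₀^N g(x)·e^{ikx} dx exists (as a finite complex number). -/
open Real Set MeasureTheory Filter

open FourierTransform SchwartzMap in
theorem zmp_planch (h : ℝ → ℂ) (h1 : Integrable h) (h2 : MemLp h 2) :
    eLpNorm (𝓕 h) 2 = eLpNorm h 2 := by
  set H := h2.toLp h with hH
  have hc : Continuous (𝓕 h) :=
    VectorFourier.fourierIntegral_continuous Real.continuous_fourierChar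
      (by fun_prop) h1
  have key : ∀ᵐ x, (𝓕 H : Lp ℂ 2 (volume : Measure ℝ)) x = 𝓕 h x := by
    apply ae_eq_of_integral_contDiff_smul_eq
    · exact (Lp.memLp (𝓕 H)).locallyIntegrable (by norm_num)
    · exact hc.locallyIntegrable
    intro φ hφ hφc
    have hφc' : HasCompactSupport (fun x => (φ x : ℂ)) :=
      hφc.comp_left (g := fun x : ℝ => (x : ℂ)) (by simp)
    set ψ : 𝓢(ℝ, ℂ) := hφc'.toSchwartzMap (Complex.ofRealCLM.contDiff.comp hφ) with hψ
    have e1 := congrArg (fun T => T ψ) (Lp.fourier_toTemperedDistribution_eq H)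
    simp only [TemperedDistribution.fourier_apply, Lp.toTemperedDistribution_apply] at e1
    have e2 : ∫ x, (𝓕 ψ) x • H x = ∫ x, (𝓕 (ψ : ℝ → ℂ)) x • h x := by
      apply integral_congr_ae
      filter_upwards [h2.coeFn_toLp] with x hx
      rw [hx, SchwartzMap.fourier_coe]
    have e3 : ∫ x, (𝓕 (ψ : ℝ → ℂ)) x • h x = ∫ x, ψ x • 𝓕 h x := by
      have := VectorFourier.integral_fourierIntegral_smul_eq_flip (e := Real.fourierChar)
        (L := innerₗ ℝ) (μ := volume) (ν := volume) (f := (ψ : ℝ → ℂ)) (g := h)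
        Real.continuous_fourierChar (by exact continuous_inner) ψ.integrable h1
      rw [flip_innerₗ] at this
      exact this
    have e4 : ∀ u : ℝ → ℂ, ∫ x, φ x • u x = ∫ x, ψ x • u x := by
      intro u; rfl
    rw [e4, e4, ← e1, e2, e3]
  rw [← eLpNorm_congr_ae key]
  have := Lp.norm_fourier_eq H
  rw [Lp.norm_def, Lp.norm_def, ENNReal.toReal_eq_toReal_iff' (Lp.eLpNorm_ne_top _) (Lp.eLpNorm_ne_top _)] at this
  rw [this]
  exact eLpNorm_congr_ae h2.coeFn_toLp

theorem zmp_l2 (h : ℝ → ℂ) (h1 : Integrable h) (h2 : MemLp h 2) :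
    ∫⁻ k : ℝ, ‖∫ x, h x * Complex.exp (Complex.I * k * x)‖ₑ ^ 2 ≤
      ENNReal.ofReal (2 * π) * ∫⁻ x, ‖h x‖ₑ ^ 2 := by
  have e := zmp_planch h h1 h2
  have hp := Real.pi_pos
  have hc : Continuous (FourierTransform.fourier h) :=
    VectorFourier.fourierIntegral_continuous Real.continuous_fourierChar
      (by fun_prop) h1
  rw [eLpNorm_eq_lintegral_rpow_enorm_toReal (by norm_num) (by norm_num), eLpNorm_eq_lintegral_rpow_enorm_toReal (by norm_num) (by norm_num)] at e
  simp only [ENNReal.toReal_ofNat, one_div] at e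
  have e' := (ENNReal.rpow_left_injective (x := (2:ℝ)⁻¹) (by norm_num)) e
  simp only [ENNReal.rpow_ofNat] at e'
  rw [← e']
  have m := Real.map_volume_mul_left (a := -(2 * π)⁻¹) (by simp)
  have e5 : ∀ k : ℝ, ∫ x, h x * Complex.exp (Complex.I * k * x) = FourierTransform.fourier h (-(2 * π)⁻¹ * k) := by
    intro k
    rw [Real.fourier_real_eq_integral_exp_smul]
    congr 1; ext x
    rw [smul_eq_mul, mul_comm]
    congr 2
    push_cast
    field_simp
  simp_rw [e5]
  rw [← lintegral_map (μ := volume) (f := fun y => ‖FourierTransform.fourier h y‖ₑ ^ 2) (g := fun k : ℝ => -(2 * π)⁻¹ * k)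
    (by fun_prop) (by fun_prop), m, lintegral_smul_measure]
  have : |(-(2 * π)⁻¹)⁻¹| = 2 * π := by
    rw [inv_neg, inv_inv, abs_neg, abs_of_pos (by positivity)]
  rw [this, smul_eq_mul]

theorem zmp_det (f : ℝ → ℂ) (hf : ∀ a b, IntervalIntegrable f volume a b) (F : ℝ → ℝ)
    (hF : Continuous F) (hFm : StrictMono F) (hF0 : F 0 = 0) (M : ℝ) (hM : ∀ x, F x ≤ M)
    (B r : ℝ) (hr : r < 1) (hr0 : 0 ≤ r)
    (hB : ∀ (m j : ℕ) (X Y : ℝ), F X = j / 2 ^ m → F Y = (j + 1) / 2 ^ m →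
      ‖∫ x in X..Y, f x‖ ≤ B * r ^ m) :
    ∃ l, Tendsto (fun N : ℝ => ∫ x in (0:ℝ)..N, f x) atTop (nhds l) := by
  set Φ : ℝ → ℂ := fun N => ∫ x in (0:ℝ)..N, f x with hΦ
  have hΦc : Continuous Φ := intervalIntegral.continuous_primitive hf 0
  have hsub : ∀ a b, Φ b - Φ a = ∫ x in a..b, f x := fun a b =>
    intervalIntegral.integral_interval_sub_left (hf _ _) (hf _ _)
  have hpt : ∀ (m : ℕ) (x : ℝ), 0 ≤ x → ∃ y, F y = (⌊2 ^ m * F x⌋₊ : ℝ) / 2 ^ m := by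
    intro m x hx
    have h0 : 0 ≤ F x := hF0 ▸ hFm.monotone hx
    have : (⌊2 ^ m * F x⌋₊ : ℝ) / 2 ^ m ∈ Icc (F 0) (F x) := by
      rw [hF0]
      refine ⟨by positivity, ?_⟩
      rw [div_le_iff₀ (by positivity), mul_comm]
      exact Nat.floor_le (by positivity)
    obtain ⟨y, -, hy⟩ := intermediate_value_Icc hx hF.continuousOn this
    exact ⟨y, hy⟩
  -- distance bound
  have hdist : ∀ (m : ℕ) (x y : ℝ), 0 ≤ x → F y = (⌊2 ^ m * F x⌋₊ : ℝ) / 2 ^ m →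
      dist (Φ y) (Φ x) ≤ |B| * r * r ^ m / (1 - r) := by
    intro m x y hx hy
    have h0 : 0 ≤ F x := hF0 ▸ hFm.monotone hx
    choose z hz using fun m => hpt m x hx
    have hzy : z m = y := hFm.injective (by rw [hz, hy])
    rw [← hzy]
    refine dist_le_of_le_geometric_of_tendsto r (|B| * r) (f := fun n => Φ (z n)) hr ?_ ?_ m
    · intro n
      have hfl : ⌊2 ^ (n+1) * F x⌋₊ = 2 * ⌊2 ^ n * F x⌋₊ ∨ ⌊2 ^ (n+1) * F x⌋₊ = 2 * ⌊2 ^ n * F x⌋₊ + 1 := by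
        have a1 := Nat.floor_le (a := 2 ^ n * F x) (by positivity)
        have a2 := Nat.lt_floor_add_one (2 ^ n * F x)
        have b1 := Nat.floor_le (a := 2 ^ (n+1) * F x) (by positivity)
        have b2 := Nat.lt_floor_add_one (2 ^ (n+1) * F x)
        rw [pow_succ] at b1 b2 ⊢
        generalize ⌊2 ^ n * F x⌋₊ = a at *
        generalize ⌊2 ^ n * 2 * F x⌋₊ = b at *
        have c1 : (b : ℝ) < 2 * a + 2 := by linarith
        have c2 : (2 * a : ℝ) < b + 1 := by linarith
        have c1' : b < 2 * a + 2 := by exact_mod_cast c1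
        have c2' : 2 * a < b + 1 := by exact_mod_cast c2
        omega
      rcases hfl with h | h
      · have : z (n+1) = z n := by
          apply hFm.injective
          rw [hz, hz, h, pow_succ]; push_cast; field_simp
        rw [this, dist_self]; positivity
      · rw [dist_comm, dist_eq_norm, hsub]
        calc _ ≤ B * r ^ (n+1) := by
              apply hB (n+1) (2 * ⌊2 ^ n * F x⌋₊)
              · rw [hz, pow_succ]; push_cast; field_simp
              · rw [hz, h]; push_cast; rfl
          _ ≤ |B| * r ^ (n+1) := by gcongr; exact le_abs_self B
          _ = _ := by ring
    · refine (hΦc.tendsto x).comp ?_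
      have hzx : ∀ n, z n ≤ x := by
        intro n
        rw [← hFm.le_iff_le, hz, div_le_iff₀ (by positivity), mul_comm]
        exact Nat.floor_le (by positivity)
      refine tendsto_order.2 ⟨?_, fun b hb => Eventually.of_forall fun n => (hzx n).trans_lt hb⟩
      intro a ha
      have hlt := hFm ha
      have : Tendsto (fun n : ℕ => (2⁻¹ : ℝ) ^ n) atTop (nhds 0) :=
        tendsto_pow_atTop_nhds_zero_of_lt_one (by norm_num) (by norm_num)
      filter_upwards [this.eventually_lt_const (sub_pos.2 hlt)] with n hn
      rw [← hFm.lt_iff_lt, hz, lt_div_iff₀ (by positivity)]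
      have a2 := Nat.lt_floor_add_one (2 ^ n * F x)
      rw [inv_pow, inv_lt_iff_one_lt_mul₀ (by positivity)] at hn
      nlinarith
  have hcau : ∀ m : ℕ, ∃ A : ℝ, 0 ≤ A ∧ ∀ x, A ≤ x → ⌊2 ^ m * F x⌋₊ = ⌊2 ^ m * F A⌋₊ := by
    intro m
    have hfin : ((fun x => ⌊2 ^ m * F x⌋₊) '' Ici (0:ℝ)).Finite := by
      apply (Set.finite_Iic ⌊2 ^ m * M⌋₊).subset
      rintro _ ⟨x, -, rfl⟩
      apply Nat.floor_mono
      gcongr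
      exact hM x
    obtain ⟨A, hA, hA'⟩ := Set.exists_max_image (Ici (0:ℝ) |>.image fun x => ⌊2 ^ m * F x⌋₊) id hfin
      ⟨_, 0, by simp, rfl⟩
    obtain ⟨A, hA0, rfl⟩ := hA
    refine ⟨A, hA0, fun x hx => le_antisymm ?_ ?_⟩
    · exact hA' _ ⟨x, le_trans hA0 hx, rfl⟩
    · apply Nat.floor_mono
      gcongr
      exact hFm.monotone hx
  apply cauchy_map_iff_exists_tendsto.1
  rw [Metric.cauchy_iff]
  refine ⟨inferInstance, fun ε hε => ?_⟩
  have hlim : Tendsto (fun m : ℕ => |B| * r * r ^ m / (1 - r)) atTop (nhds 0) := by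
    have := ((tendsto_pow_atTop_nhds_zero_of_lt_one hr0 hr).const_mul (|B| * r)).div_const (1 - r)
    simpa using this
  obtain ⟨m, hm⟩ := (hlim.eventually_lt_const (half_pos hε)).exists
  obtain ⟨A, hA0, hA⟩ := hcau m
  obtain ⟨y, hy⟩ := hpt m A hA0
  refine ⟨Φ '' Ici A, image_mem_map (Ici_mem_atTop A), ?_⟩
  rintro _ ⟨x, hx, rfl⟩ _ ⟨x', hx', rfl⟩
  have d1 := hdist m x y (hA0.trans hx) (by rw [hy, hA x hx])
  have d2 := hdist m x' y (hA0.trans hx') (by rw [hy, hA x' hx'])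
  have := dist_triangle_left (Φ x) (Φ x') (Φ y)
  linarith

theorem zmp_piece (p : ℝ) (hp1 : 1 ≤ p) (hp2 : p < 2)
    (g : ℝ → ℂ) (hmeas : Measurable g) (hLp : Integrable (fun x => ‖g x‖ ^ p))
    (hg : ∀ a b, IntervalIntegrable g volume a b)
    (a b d L : ℝ) (hab : a ≤ b) (hL : 0 < L) (hd : ∫ x in a..b, ‖g x‖ ^ p ≤ d) :
    ∃ u : ℝ → ℂ, Continuous u ∧
      ∫⁻ k, ‖u k‖ₑ ^ 2 ≤ ENNReal.ofReal (2 * π * (L ^ (2 - p) * d)) ∧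
      ∀ k : ℝ, ‖∫ x in a..b, g x * Complex.exp (Complex.I * k * x)‖ ≤ L ^ (1 - p) * d + ‖u k‖ := by
  have hexp : ∀ k x : ℝ, ‖Complex.exp (Complex.I * k * x)‖ = 1 := by
    intro k x
    rw [mul_assoc, ← Complex.ofReal_mul, Complex.norm_exp_I_mul_ofReal]
  have hgI : Integrable ((Ioc a b).indicator g) :=
    (integrable_indicator_iff measurableSet_Ioc).2
      ((intervalIntegrable_iff_integrableOn_Ioc_of_le hab).1 (hg a b))
  have hpI : Integrable ((Ioc a b).indicator (fun x => ‖g x‖ ^ p)) :=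
    hLp.indicator measurableSet_Ioc
  have hpe : ∫ x, (Ioc a b).indicator (fun x => ‖g x‖ ^ p) x ≤ d := by
    rw [integral_indicator measurableSet_Ioc, ← intervalIntegral.integral_of_le hab]
    exact hd
  set E : Set ℝ := {x | ‖g x‖ ≤ L} with hE
  have hEm : MeasurableSet E := measurableSet_le hmeas.norm measurable_const
  set h : ℝ → ℂ := E.indicator ((Ioc a b).indicator g) with hh
  have hI : Integrable h := hgI.indicator hEm
  have hsq : ∀ x, ‖h x‖ ^ 2 ≤ L ^ (2 - p) * (Ioc a b).indicator (fun x => ‖g x‖ ^ p) x := by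
    intro x
    have hn : 0 ≤ L ^ (2 - p) * (Ioc a b).indicator (fun x => ‖g x‖ ^ p) x :=
      mul_nonneg (by positivity) (indicator_nonneg (fun _ _ => by positivity) _)
    by_cases hx : x ∈ E
    · by_cases hx' : x ∈ Ioc a b
      · rw [hh, indicator_of_mem hx, indicator_of_mem hx', indicator_of_mem hx']
        rcases (norm_nonneg (g x)).eq_or_lt with h0 | h0
        · rw [← h0]; simp; positivity
        · calc ‖g x‖ ^ 2 = ‖g x‖ ^ (2 - p) * ‖g x‖ ^ p := by
                rw [← Real.rpow_add h0]; norm_num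
            _ ≤ _ := by
                gcongr
                exact hx
      · rw [hh, indicator_of_mem hx, indicator_of_notMem hx']
        simpa using hn
    · rw [hh, indicator_of_notMem hx]
      simpa using hn
  have hbig : ∀ x, ‖(Ioc a b).indicator g x - h x‖ ≤ L ^ (1 - p) * (Ioc a b).indicator (fun x => ‖g x‖ ^ p) x := by
    intro x
    have hn : 0 ≤ L ^ (1 - p) * (Ioc a b).indicator (fun x => ‖g x‖ ^ p) x :=
      mul_nonneg (by positivity) (indicator_nonneg (fun _ _ => by positivity) _)
    by_cases hx : x ∈ E
    · rw [hh, indicator_of_mem hx]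
      simpa using hn
    · rw [hh, indicator_of_notMem hx, sub_zero]
      by_cases hx' : x ∈ Ioc a b
      · rw [indicator_of_mem hx', indicator_of_mem hx']
        have hx2 : L < ‖g x‖ := not_le.1 hx
        have h0 : 0 < ‖g x‖ := hL.trans hx2
        calc ‖g x‖ = ‖g x‖ ^ (1 - p) * ‖g x‖ ^ p := by
                rw [← Real.rpow_add h0]; norm_num
            _ ≤ _ := by
                gcongr ?_ * _
                exact Real.rpow_le_rpow_of_nonpos hL hx2.le (by linarith)
      · rw [indicator_of_notMem hx']
        simpa using hn
  have hI2 : Integrable (fun x => ‖h x‖ ^ 2) := by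
    refine (hpI.const_mul (L ^ (2 - p))).mono' (hI.aestronglyMeasurable.norm.pow 2) ?_
    filter_upwards with x
    rw [Real.norm_of_nonneg (by positivity)]
    exact hsq x
  have hM2 : MemLp h 2 := (memLp_two_iff_integrable_sq_norm hI.aestronglyMeasurable).2 hI2
  have hint : ∀ (f : ℝ → ℂ) (k : ℝ), Integrable f → Integrable (fun x : ℝ => f x * Complex.exp (Complex.I * k * x)) := by
    intro f k hf
    refine hf.mono (hf.aestronglyMeasurable.mul (by fun_prop)) ?_
    filter_upwards with x
    rw [norm_mul, hexp, mul_one]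
  refine ⟨fun k => ∫ x, h x * Complex.exp (Complex.I * k * x), ?_, ?_, ?_⟩
  · refine continuous_of_dominated (bound := fun x => ‖h x‖) ?_ ?_ hI.norm ?_
    · exact fun k => (hint h k hI).aestronglyMeasurable
    · intro k
      filter_upwards with x
      rw [norm_mul, hexp, mul_one]
    · filter_upwards with x
      fun_prop
  · refine (zmp_l2 h hI hM2).trans ?_
    rw [ENNReal.ofReal_mul (by positivity : (0:ℝ) ≤ 2 * π)]
    gcongr
    have : ∀ x, ‖h x‖ₑ ^ 2 = ENNReal.ofReal (‖h x‖ ^ 2) := by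
      intro x
      rw [ENNReal.ofReal_pow (norm_nonneg _), ofReal_norm_eq_enorm]
    simp_rw [this]
    rw [← ofReal_integral_eq_lintegral_ofReal hI2 (Eventually.of_forall fun x => by positivity)]
    apply ENNReal.ofReal_le_ofReal
    calc _ ≤ ∫ x, L ^ (2 - p) * (Ioc a b).indicator (fun x => ‖g x‖ ^ p) x :=
          integral_mono hI2 (hpI.const_mul _) hsq
      _ ≤ _ := by
          rw [integral_const_mul]
          gcongr
  · intro k
    have e1 : ∫ x in a..b, g x * Complex.exp (Complex.I * k * x) =
        (∫ x, ((Ioc a b).indicator g x - h x) * Complex.exp (Complex.I * k * x)) +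
        ∫ x, h x * Complex.exp (Complex.I * k * x) := by
      rw [← integral_add (hint (fun x => (Ioc a b).indicator g x - h x) k (hgI.sub hI)) (hint h k hI),
        intervalIntegral.integral_of_le hab, ← integral_indicator measurableSet_Ioc]
      congr 1; ext x
      by_cases hx' : x ∈ Ioc a b
      · rw [indicator_of_mem hx', indicator_of_mem hx']; ring
      · rw [indicator_of_notMem hx', indicator_of_notMem hx']; ring
    rw [e1]
    refine (norm_add_le _ _).trans ?_
    gcongr
    calc _ ≤ ∫ x, L ^ (1 - p) * (Ioc a b).indicator (fun x => ‖g x‖ ^ p) x := by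
          refine norm_integral_le_of_norm_le (hpI.const_mul _) ?_
          filter_upwards with x
          rw [norm_mul, hexp, mul_one]
          exact hbig x
      _ ≤ _ := by
          rw [integral_const_mul]
          gcongr

theorem zygmund_menshov_paley
    (p : ℝ) (hp1 : 1 ≤ p) (hp2 : p < 2)
    (g : ℝ → ℂ) (hmeas : Measurable g)
    (hLp : Integrable (fun x => ‖g x‖ ^ p)) :
    ∀ᵐ k : ℝ, ∃ l : ℂ,
      Tendsto (fun N : ℝ => ∫ x in (0:ℝ)..N, g x * Complex.exp (Complex.I * k * x))
        atTop (nhds l) := by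
  have hloc : ∀ a b, IntervalIntegrable g volume a b := by
    intro a b
    have h1 : IntervalIntegrable (fun x => 1 + ‖g x‖ ^ p) volume a b :=
      intervalIntegrable_const.add hLp.intervalIntegrable
    refine h1.mono_fun hmeas.aestronglyMeasurable ?_
    filter_upwards with x
    rw [Real.norm_of_nonneg (by positivity : 0 ≤ 1 + ‖g x‖ ^ p)]
    rcases le_total ‖g x‖ 1 with h | h
    · have : 0 ≤ ‖g x‖ ^ p := by positivity
      linarith
    · have := Real.rpow_le_rpow_of_exponent_le h hp1
      rw [Real.rpow_one] at this
      linarith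
  set F : ℝ → ℝ := fun x => (∫ t in (0:ℝ)..x, ‖g t‖ ^ p) + arctan x with hF
  have hpi : ∀ a b, IntervalIntegrable (fun x => ‖g x‖ ^ p) volume a b :=
    fun a b => hLp.intervalIntegrable
  have hFc : Continuous F :=
    (intervalIntegral.continuous_primitive hpi 0).add continuous_arctan
  have hFsub : ∀ a b, F b - F a = (∫ t in a..b, ‖g t‖ ^ p) + (arctan b - arctan a) := by
    intro a b
    rw [← intervalIntegral.integral_interval_sub_left (hpi 0 b) (hpi 0 a)]
    simp only [hF]; ring
  have hFm : StrictMono F := by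
    intro a b hab
    have h1 := hFsub a b
    have h2 : 0 ≤ ∫ t in a..b, ‖g t‖ ^ p :=
      intervalIntegral.integral_nonneg hab.le (fun _ _ => by positivity)
    have h3 := Real.arctan_strictMono hab
    linarith
  have hF0 : F 0 = 0 := by simp [hF]
  set M : ℝ := (∫ t, ‖g t‖ ^ p) + π with hMdef
  have hI0 : 0 ≤ ∫ t, ‖g t‖ ^ p := integral_nonneg (fun _ => by positivity)
  have hM0 : 0 ≤ M := by have := Real.pi_pos; positivity
  have hM : ∀ x, F x ≤ M := by
    intro x
    have h1 := Real.arctan_lt_pi_div_two x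
    have h2 := Real.pi_pos
    have h3 : ∫ t in (0:ℝ)..x, ‖g t‖ ^ p ≤ ∫ t, ‖g t‖ ^ p := by
      rcases le_total 0 x with h | h
      · rw [intervalIntegral.integral_of_le h]
        exact setIntegral_le_integral hLp (Eventually.of_forall fun _ => by positivity)
      · rw [intervalIntegral.integral_of_ge h]
        have : 0 ≤ ∫ t in Ioc x 0, ‖g t‖ ^ p := integral_nonneg (fun _ => by positivity)
        linarith
    simp only [hF, hMdef]; linarith
  set q : ℝ := (2:ℝ) ^ (-(1/2):ℝ) with hq
  have hq0 : 0 < q := by positivity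
  have hq1 : q < 1 := Real.rpow_lt_one_of_one_lt_of_neg (by norm_num) (by norm_num)
  have hqq : q ^ 2 = 2⁻¹ := by
    rw [hq, ← Real.rpow_natCast, ← Real.rpow_mul (by norm_num)]
    norm_num
  set s : ℝ := q ^ ((2 - p) / 2) with hs
  have hs0 : 0 < s := by positivity
  have hs1 : s < 1 := Real.rpow_lt_one hq0.le hq1 (by linarith)
  have hpow : ∀ m : ℕ, (q ^ m) ^ (2 - p) = s ^ m * s ^ m := by
    intro m
    rw [← mul_pow, hs, ← Real.rpow_add hq0, ← Real.rpow_natCast, ← Real.rpow_natCast,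
      ← Real.rpow_mul hq0.le, ← Real.rpow_mul hq0.le]
    congr 1; ring
  have hpow1 : ∀ m : ℕ, (q ^ m) ^ (1 - p) * (2 ^ m)⁻¹ ≤ q ^ m := by
    intro m
    have : ((2:ℝ) ^ m)⁻¹ = q ^ m * q ^ m := by
      rw [← mul_pow, ← pow_two, hqq, inv_pow]
    rw [this, ← mul_assoc]
    have h2 : (q ^ m) ^ (1 - p) * q ^ m = (q ^ m) ^ (2 - p) := by
      nth_rewrite 2 [← Real.rpow_one (q ^ m)]
      rw [← Real.rpow_add (by positivity)]; congr 1; ring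
    rw [h2]
    have h3 : (q ^ m) ^ (2 - p) ≤ 1 :=
      Real.rpow_le_one (by positivity) (pow_le_one₀ hq0.le hq1.le) (by linarith)
    have : 0 < q ^ m := by positivity
    nlinarith
  have hpiece : ∀ m j : ℕ, ∃ u : ℝ → ℂ, Continuous u ∧
      ∫⁻ k, ‖u k‖ₑ ^ 2 ≤ ENNReal.ofReal (2 * π * ((q ^ m) ^ (2 - p) * (2 ^ m)⁻¹)) ∧
      ∀ X Y, F X = j / 2 ^ m → F Y = (j + 1) / 2 ^ m → ∀ k : ℝ,
        ‖∫ x in X..Y, g x * Complex.exp (Complex.I * k * x)‖ ≤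
          (q ^ m) ^ (1 - p) * (2 ^ m)⁻¹ + ‖u k‖ := by
    intro m j
    by_cases hex : ∃ X Y, F X = j / 2 ^ m ∧ F Y = (j + 1) / 2 ^ m
    · obtain ⟨X, Y, hX, hY⟩ := hex
      have hXY : X ≤ Y := by
        rw [← hFm.le_iff_le, hX, hY]; gcongr; linarith
      obtain ⟨u, h1, h2, h3⟩ := zmp_piece p hp1 hp2 g hmeas hLp hloc X Y (2 ^ m)⁻¹ (q ^ m) hXY
        (by positivity) (by
          have h1 := hFsub X Y
          have h2 := Real.arctan_strictMono.monotone hXY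
          have h3 : F Y - F X = (2 ^ m)⁻¹ := by rw [hX, hY]; ring
          linarith)
      refine ⟨u, h1, h2, ?_⟩
      intro X' Y' hX' hY' k
      rw [hFm.injective (hX'.trans hX.symm), hFm.injective (hY'.trans hY.symm)]
      exact h3 k
    · refine ⟨0, continuous_zero, by simp, ?_⟩
      intro X Y hX hY
      exact absurd ⟨X, Y, hX, hY⟩ hex
  choose u huc hu2 hub using hpiece
  set n : ℕ → ℕ := fun m => ⌊2 ^ m * M⌋₊ with hn
  set T : ℝ → ENNReal := fun k => ∑' m : ℕ, ENNReal.ofReal ((s ^ m)⁻¹) *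
    ∑ j ∈ Finset.range (n m), ‖u m j k‖ₑ ^ 2 with hT
  have hTint : ∫⁻ k, T k ≠ ⊤ := by
    have hmeasu : ∀ m j, Measurable (fun k => ‖u m j k‖ₑ ^ 2) := fun m j =>
      ((huc m j).measurable.enorm).pow_const 2
    rw [hT, lintegral_tsum (fun m => by
      exact ((Finset.measurable_fun_sum _ fun j _ => hmeasu m j).const_mul _).aemeasurable)]
    have hle : ∀ m, ∫⁻ k, ENNReal.ofReal ((s ^ m)⁻¹) * ∑ j ∈ Finset.range (n m), ‖u m j k‖ₑ ^ 2
        ≤ ENNReal.ofReal (2 * π * M * s ^ m) := by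
      intro m
      rw [lintegral_const_mul _ (Finset.measurable_fun_sum _ fun j _ => hmeasu m j),
        lintegral_finsetSum _ (fun j _ => hmeasu m j)]
      calc _ ≤ ENNReal.ofReal ((s ^ m)⁻¹) * ∑ j ∈ Finset.range (n m),
              ENNReal.ofReal (2 * π * ((q ^ m) ^ (2 - p) * (2 ^ m)⁻¹)) := by
            gcongr; exact hu2 _ _
        _ = ENNReal.ofReal ((s ^ m)⁻¹ * ((n m : ℝ) * (2 * π * ((q ^ m) ^ (2 - p) * (2 ^ m)⁻¹)))) := by
            rw [Finset.sum_const, Finset.card_range, nsmul_eq_mul,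
              ENNReal.ofReal_mul (by positivity : (0:ℝ) ≤ (s ^ m)⁻¹), ENNReal.ofReal_mul (by positivity : (0:ℝ) ≤ n m),
              ENNReal.ofReal_natCast]
        _ ≤ _ := by
            apply ENNReal.ofReal_le_ofReal
            rw [hpow]
            have : (n m : ℝ) ≤ 2 ^ m * M := Nat.floor_le (by positivity)
            have hp := Real.pi_pos
            calc _ ≤ (s ^ m)⁻¹ * ((2 ^ m * M) * (2 * π * (s ^ m * s ^ m * (2 ^ m)⁻¹))) := by gcongr
              _ = _ := by field_simp
    refine ne_top_of_le_ne_top ?_ (ENNReal.tsum_le_tsum hle)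
    have hsum : Summable (fun m : ℕ => 2 * π * M * s ^ m) :=
      (summable_geometric_of_lt_one hs0.le hs1).mul_left _
    exact hsum.tsum_ofReal_ne_top
  have hTm : AEMeasurable T := by
    apply Measurable.aemeasurable
    refine Measurable.tsum fun m => Measurable.const_mul ?_ _
    exact Finset.measurable_fun_sum _ fun j _ => ((huc m j).measurable.enorm).pow_const 2
  filter_upwards [ae_lt_top' hTm hTint] with k hk
  set r : ℝ := max q (√s) with hr
  have hrs : √s < 1 := by rw [Real.sqrt_lt' one_pos]; simpa using hs1
  refine zmp_det (fun x : ℝ => g x * Complex.exp (Complex.I * k * x)) ?_ F hFc hFm hF0 M hM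
    (1 + √(T k).toReal) r (max_lt hq1 hrs) (le_max_of_le_left hq0.le) ?_
  · intro a b
    exact (hloc a b).mul_continuousOn (by fun_prop)
  · intro m j X Y hX hY
    have hj : j < n m := by
      have h1 : ((j:ℝ) + 1) / 2 ^ m ≤ M := hY ▸ hM Y
      rw [div_le_iff₀ (by positivity)] at h1
      apply Nat.lt_of_succ_le
      apply Nat.le_floor
      push_cast; linarith
    have h1 : ENNReal.ofReal ((s ^ m)⁻¹) * ‖u m j k‖ₑ ^ 2 ≤ T k := by
      refine le_trans ?_ (ENNReal.le_tsum m)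
      gcongr
      exact Finset.single_le_sum (f := fun j => ‖u m j k‖ₑ ^ 2) (fun _ _ => zero_le) (Finset.mem_range.2 hj)
    have h2 : (s ^ m)⁻¹ * ‖u m j k‖ ^ 2 ≤ (T k).toReal := by
      have := ENNReal.toReal_mono hk.ne h1
      rwa [ENNReal.toReal_mul, ENNReal.toReal_ofReal (by positivity), ENNReal.toReal_pow,
        toReal_enorm] at this
    have h3 : ‖u m j k‖ ≤ √(T k).toReal * √s ^ m := by
      rw [inv_mul_le_iff₀ (by positivity)] at h2
      apply abs_le_of_sq_le_sq' _ (by positivity) |>.2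
      rw [mul_pow, Real.sq_sqrt ENNReal.toReal_nonneg, ← pow_mul, mul_comm m 2, pow_mul, Real.sq_sqrt hs0.le]
      linarith
    calc _ ≤ (q ^ m) ^ (1 - p) * (2 ^ m)⁻¹ + ‖u m j k‖ := hub m j X Y hX hY k
      _ ≤ q ^ m + √(T k).toReal * √s ^ m := add_le_add (hpow1 m) h3
      _ ≤ r ^ m + √(T k).toReal * r ^ m := by
          gcongr
          · exact le_max_left _ _
          · exact le_max_right _ _
      _ = _ := by ring
end

section
/- Let V : [0,∞) → ℝ be continuous with ∫₀^∞ |V(x)| dx < ∞, and let k > 0. Then there exists a twice continuously differentiable solution u : [0,∞) → ℂ of −u'' + V u = k²u such that u(x)·e^{−ikx} → 1 as x → +∞. Moreover, every twice continuously differentiable solution of −u'' + V u = k²u on [0,∞) is bounded. -/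
open Real Set MeasureTheory Filter

/-- `u : ℝ → ℂ` is a twice continuously differentiable solution of
`-u'' + V u = E u` on the half-line `[0,∞)`. -/
def HalfLineSolution (V : ℝ → ℝ) (E : ℝ) (u : ℝ → ℂ) : Prop :=
  ∃ u' u'' : ℝ → ℂ,
    (∀ x ∈ Ici (0 : ℝ), HasDerivAt u (u' x) x) ∧
    (∀ x ∈ Ici (0 : ℝ), HasDerivAt u' (u'' x) x) ∧
    ContinuousOn u'' (Ici (0 : ℝ)) ∧
    (∀ x ∈ Ici (0 : ℝ), -u'' x + (V x : ℂ) * u x = (E : ℂ) * u x)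

lemma tail_hasDerivAt {E : Type*} [NormedAddCommGroup E] [NormedSpace ℝ E] [CompleteSpace E]
    (h : ℝ → E) (hc : Continuous h) (hi : Integrable h) (x : ℝ) :
    HasDerivAt (fun x => ∫ t in Ioi x, h t) (-h x) x := by
  have e : (fun x => ∫ t in Ioi x, h t) = fun x => (∫ t in Ioi (0:ℝ), h t) - ∫ t in (0:ℝ)..x, h t := by
    funext x
    rw [← intervalIntegral.integral_Ioi_sub_Ioi' hi.integrableOn hi.integrableOn]
    abel
  rw [e]
  have := (hc.integral_hasStrictDerivAt 0 x).hasDerivAt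
  exact this.const_sub _

lemma tail_tendsto {E : Type*} [NormedAddCommGroup E] [NormedSpace ℝ E] [CompleteSpace E]
    (h : ℝ → E) (hi : Integrable h) :
    Tendsto (fun x => ∫ t in Ioi x, h t) atTop (nhds 0) := by
  have e : (fun x => ∫ t in Ioi x, h t) = fun x => (∫ t in Ioi (0:ℝ), h t) - ∫ t in (0:ℝ)..x, h t := by
    funext x
    rw [← intervalIntegral.integral_Ioi_sub_Ioi' hi.integrableOn hi.integrableOn]
    abel
  rw [e]
  have := intervalIntegral_tendsto_integral_Ioi (0:ℝ) hi.integrableOn tendsto_id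
  simpa using this.const_sub (∫ t in Ioi (0:ℝ), h t)

open BoundedContinuousFunction in
lemma exists_ode {E : Type*} [NormedAddCommGroup E] [NormedSpace ℝ E] [CompleteSpace E]
    (f : ℝ → E → E) (hf : Continuous (fun p : ℝ × E => f p.1 p.2)) (h0 : ∀ x, f x 0 = 0)
    (g : ℝ → ℝ) (hg : Continuous g) (hgi : Integrable g) 
    (hfg : ∀ x y z, ‖f x y - f x z‖ ≤ g x * ‖y - z‖) (hg0 : ∀ x, 0 ≤ g x) (y0 : E) :
    ∃ y : ℝ → E, (∀ x, HasDerivAt y (f x (y x)) x) ∧ Tendsto y atTop (nhds y0) := by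
  set Q : ℝ → ℝ := fun x => ∫ t in Ioi x, g t with hQ
  have hQd : ∀ x, HasDerivAt Q (-g x) x := tail_hasDerivAt g hg hgi
  have hQt : Tendsto Q atTop (nhds 0) := tail_tendsto g hgi
  have hQc : Continuous Q := continuous_iff_continuousAt.2 fun x => (hQd x).continuousAt
  have hQ0 : ∀ x, 0 ≤ Q x := fun x => integral_nonneg hg0
  have hQM : ∀ x, Q x ≤ ∫ t, g t := fun x =>
    setIntegral_le_integral hgi (Eventually.of_forall hg0)
  set w : ℝ → ℝ := fun x => Real.exp (2 * Q x) with hw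
  have hwc : Continuous w := by fun_prop
  have hw0 : ∀ x, 0 < w x := fun x => Real.exp_pos _
  have hw1 : ∀ x, 1 ≤ w x := fun x => Real.one_le_exp (by linarith [hQ0 x])
  have hwM : ∀ x, w x ≤ Real.exp (2 * ∫ t, g t) := fun x => Real.exp_le_exp.2 (by linarith [hQM x])
  have hfn : ∀ x y, ‖f x y‖ ≤ g x * ‖y‖ := fun x y => by simpa [h0] using hfg x y 0
  have hgw : Integrable (fun t => g t * w t) := by
    refine hgi.mul_bdd (c := Real.exp (2 * ∫ t, g t)) hwc.aestronglyMeasurable (Eventually.of_forall fun x => ?_)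
    rw [Real.norm_of_nonneg (hw0 x).le]; exact hwM x
  have hgwI : ∀ x, ∫ t in Ioi x, g t * w t ≤ w x / 2 := by
    intro x
    have hd : ∀ t, HasDerivAt (fun t => -(w t / 2)) (g t * w t) t := by
      intro t
      have := ((((hQd t).const_mul 2).exp).div_const 2).neg
      refine HasDerivAt.congr_deriv (f := fun t => -(w t / 2)) this ?_
      simp only [hw]; ring
    have ht : Tendsto (fun t => -(w t / 2)) atTop (nhds (-(1/2))) := by
      have := (((Real.continuous_exp.tendsto _).comp (hQt.const_mul 2)).div_const 2).neg
      simpa using this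
    rw [integral_Ioi_of_hasDerivAt_of_tendsto' (fun t _ => hd t) hgw.integrableOn ht]
    linarith
  have hcomp : ∀ z : ℝ →ᵇ E, Continuous (fun t => f t (w t • z t)) := fun z =>
    hf.comp (continuous_id.prodMk (hwc.smul z.continuous))
  have hint : ∀ z : ℝ →ᵇ E, Integrable (fun t => f t (w t • z t)) := by
    intro z
    refine (hgw.mul_const ‖z‖).mono' (hcomp z).aestronglyMeasurable (Eventually.of_forall fun t => ?_)
    refine (hfn _ _).trans ?_
    rw [norm_smul, Real.norm_of_nonneg (hw0 t).le, ← mul_assoc]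
    exact mul_le_mul_of_nonneg_left (z.norm_coe_le_norm t) (mul_nonneg (hg0 t) (hw0 t).le)
  let J : (ℝ →ᵇ E) → ℝ → E := fun z x => y0 - ∫ t in Ioi x, f t (w t • z t)
  have hJd : ∀ z x, HasDerivAt (J z) (f x (w x • z x)) x := by
    intro z x
    have := (tail_hasDerivAt _ (hcomp z) (hint z) x).const_sub y0
    simpa using this
  have hJc : ∀ z, Continuous (J z) := fun z => 
    continuous_iff_continuousAt.2 fun x => (hJd z x).continuousAt
  have hdiff : ∀ z z' x, ‖J z x - J z' x‖ ≤ w x / 2 * ‖z - z'‖ := by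
    intro z z' x
    have : J z x - J z' x = ∫ t in Ioi x, (f t (w t • z' t) - f t (w t • z t)) := by
      rw [integral_sub (hint z').integrableOn (hint z).integrableOn]
      simp only [J]; abel
    rw [this]
    calc _ ≤ ∫ t in Ioi x, (g t * w t) * ‖z - z'‖ := by
            refine norm_integral_le_of_norm_le (hgw.mul_const _).integrableOn (Eventually.of_forall fun t => ?_)
            refine (hfg _ _ _).trans ?_
            rw [← smul_sub, norm_smul, Real.norm_of_nonneg (hw0 t).le, ← mul_assoc, norm_sub_rev]
            exact mul_le_mul_of_nonneg_left ((z - z').norm_coe_le_norm t) (mul_nonneg (hg0 t) (hw0 t).le)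
      _ = (∫ t in Ioi x, g t * w t) * ‖z - z'‖ := integral_mul_const _ _
      _ ≤ _ := mul_le_mul_of_nonneg_right (hgwI x) (norm_nonneg _)
  have hJ0 : ∀ x, J 0 x = y0 := by intro x; simp [J, h0]
  have hwi : ∀ x, ‖(w x)⁻¹‖ = (w x)⁻¹ := fun x => Real.norm_of_nonneg (inv_nonneg.2 (hw0 x).le)
  have hb : ∀ z x, ‖(w x)⁻¹ • J z x‖ ≤ ‖y0‖ + ‖z‖ := by
    intro z x
    have h1 := hdiff z 0 x
    rw [hJ0, sub_zero] at h1
    have h2 : ‖J z x‖ ≤ ‖y0‖ + w x / 2 * ‖z‖ := by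
      have := norm_le_norm_add_norm_sub' (J z x) y0
      linarith
    rw [norm_smul, hwi, inv_mul_le_iff₀ (hw0 x)]
    nlinarith [hw1 x, hw0 x, norm_nonneg y0, norm_nonneg z, mul_nonneg (hw0 x).le (norm_nonneg z), mul_nonneg (sub_nonneg.2 (hw1 x)) (norm_nonneg y0)]
  let T : (ℝ →ᵇ E) → (ℝ →ᵇ E) := fun z =>
    BoundedContinuousFunction.ofNormedAddCommGroup (fun x => (w x)⁻¹ • J z x)
      ((hwc.inv₀ fun x => (hw0 x).ne').smul (hJc z)) _ (hb z)
  have hT : ContractingWith (1/2) T := by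
    refine ⟨by rw [← NNReal.coe_lt_coe]; norm_num, LipschitzWith.of_dist_le_mul fun z z' => ?_⟩
    rw [BoundedContinuousFunction.dist_le (by positivity)]
    intro x
    change dist ((w x)⁻¹ • J z x) ((w x)⁻¹ • J z' x) ≤ _
    rw [dist_eq_norm, dist_eq_norm, ← smul_sub, norm_smul, hwi, inv_mul_le_iff₀ (hw0 x)]
    refine (hdiff z z' x).trans (le_of_eq ?_)
    push_cast; ring
  set z := ContractingWith.fixedPoint T hT
  have hz : T z = z := hT.fixedPoint_isFixedPt
  have hzx : ∀ x, w x • z x = J z x := by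
    intro x
    have : (w x)⁻¹ • J z x = z x := DFunLike.congr_fun hz x
    rw [← this, smul_inv_smul₀ (hw0 x).ne']
  refine ⟨J z, fun x => ?_, ?_⟩
  · rw [← hzx]; exact hJd z x
  · simpa using (tail_tendsto _ (hint z)).const_sub y0

lemma weid_exists (V : ℝ → ℝ) (hVc : ContinuousOn V (Ici (0 : ℝ)))
    (hL1 : IntegrableOn (fun x => |V x|) (Ici (0 : ℝ)))
    (k : ℝ) (hk : 0 < k) :
    ∃ u : ℝ → ℂ, HalfLineSolution V (k ^ 2) u ∧
      Tendsto (fun x : ℝ => u x * Complex.exp (-(Complex.I * k * x))) atTop (nhds 1) := by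
  set W : ℝ → ℝ := fun x => V (max x 0) * Real.exp (min x 0) with hW
  have hWc : Continuous W := by
    have : Continuous fun x : ℝ => V (max x 0) :=
      hVc.comp_continuous (by fun_prop) fun x => mem_Ici.2 (le_max_right _ _)
    exact this.mul (by fun_prop)
  have hWV : ∀ x, 0 ≤ x → W x = V x := fun x hx => by simp [hW, hx]
  have hWi : Integrable W := by
    rw [← integrableOn_univ, ← Iic_union_Ici (a := (0:ℝ)), integrableOn_union]
    constructor
    · refine IntegrableOn.congr_fun (f := fun x => V 0 * Real.exp x) ((integrableOn_exp_Iic 0).const_mul (V 0)) (fun x hx => ?_) measurableSet_Iic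
      have hx : x ≤ 0 := hx
      simp [hW, hx]
    · have : IntegrableOn V (Ici 0) := by
        refine (integrable_norm_iff (hVc.aestronglyMeasurable measurableSet_Ici)).1 hL1
      exact this.congr_fun (fun x hx => (hWV x hx).symm) measurableSet_Ici
  have hk' : (k : ℂ) ≠ 0 := by exact_mod_cast hk.ne'
  have hI := Complex.I_ne_zero
  let e : ℝ → ℂ := fun x => Complex.exp (Complex.I * k * x)
  let e' : ℝ → ℂ := fun x => Complex.exp (-(Complex.I * k * x))
  have hee : ∀ x, e x * e' x = 1 := fun x => by simp [e, e', ← Complex.exp_add]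
  have hec : Continuous e := by fun_prop
  have hec' : Continuous e' := by fun_prop
  have hen : ∀ x, ‖e x‖ = 1 := fun x => by simp [e, Complex.norm_exp]
  have hen' : ∀ x, ‖e' x‖ = 1 := fun x => by simp [e', Complex.norm_exp]
  have hlin : ∀ x : ℝ, HasDerivAt (fun x : ℝ => Complex.I * k * (x:ℂ)) (Complex.I * k) x := fun x => by
    simpa using (Complex.ofRealCLM.hasDerivAt (x := x)).const_mul (Complex.I * k)
  have hed : ∀ x, HasDerivAt e (e x * (Complex.I * k)) x := fun x => (hlin x).cexp
  have hed' : ∀ x, HasDerivAt e' (e' x * -(Complex.I * k)) x := fun x => (hlin x).neg.cexp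
  let c : ℝ → ℂ := fun x => (W x : ℂ) / (2 * Complex.I * k)
  have hcc : Continuous c := by
    simp only [c]; fun_prop
  have hcn : ∀ x, ‖c x‖ = |W x| / (2 * k) := fun x => by simp [c, abs_of_pos hk]
  let f : ℝ → ℂ × ℂ → ℂ × ℂ := fun x y =>
    (c x * (y.1 * e x + y.2 * e' x) * e' x, -(c x * (y.1 * e x + y.2 * e' x) * e x))
  obtain ⟨y, hy, hyt⟩ := exists_ode f (by simp only [f]; fun_prop) (by simp [f])
    (fun x => |W x| / k) (by fun_prop) (hWi.abs.div_const k) (by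
      intro x y z
      have h1 : ‖(y.1 - z.1) * e x + (y.2 - z.2) * e' x‖ ≤ 2 * ‖y - z‖ := by
        refine (norm_add_le _ _).trans ?_
        rw [norm_mul, norm_mul, hen, hen', mul_one, mul_one]
        have := norm_fst_le (y - z)
        have := norm_snd_le (y - z)
        simp only [Prod.fst_sub, Prod.snd_sub] at *
        linarith
      have h2 : ‖c x * ((y.1 - z.1) * e x + (y.2 - z.2) * e' x)‖ ≤ |W x| / k * ‖y - z‖ := by
        rw [norm_mul, hcn]
        refine (mul_le_mul_of_nonneg_left h1 (by positivity)).trans (le_of_eq ?_)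
        field_simp
      rw [Prod.norm_def]
      refine max_le ?_ ?_
      · have : (f x y - f x z).1 = c x * ((y.1 - z.1) * e x + (y.2 - z.2) * e' x) * e' x := by
          simp only [f, Prod.fst_sub]; ring
        rw [this, norm_mul, hen', mul_one]; exact h2
      · have : (f x y - f x z).2 = -(c x * ((y.1 - z.1) * e x + (y.2 - z.2) * e' x) * e x) := by
          simp only [f, Prod.snd_sub]; ring
        rw [this, norm_neg, norm_mul, hen, mul_one]; exact h2)
    (fun x => by positivity) (1, 0)
  have ha : ∀ x, HasDerivAt (fun x => (y x).1) (f x (y x)).1 x := fun x => (hy x).fst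
  have hb : ∀ x, HasDerivAt (fun x => (y x).2) (f x (y x)).2 x := fun x => (hy x).snd
  have hat : Tendsto (fun x => (y x).1) atTop (nhds 1) := (continuous_fst.tendsto _).comp hyt
  have hbt : Tendsto (fun x => (y x).2) atTop (nhds 0) := (continuous_snd.tendsto _).comp hyt
  let u : ℝ → ℂ := fun x => (y x).1 * e x + (y x).2 * e' x
  let u' : ℝ → ℂ := fun x => Complex.I * k * ((y x).1 * e x - (y x).2 * e' x)
  have hud : ∀ x, HasDerivAt u (u' x) x := by
    intro x
    refine HasDerivAt.congr_deriv (f := u) (((ha x).mul (hed x)).add ((hb x).mul (hed' x))) ?_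
    simp only [u', f]; ring
  have hud' : ∀ x, HasDerivAt u' ((W x - k ^ 2) * u x) x := by
    intro x
    refine HasDerivAt.congr_deriv (f := u') ((((ha x).mul (hed x)).sub ((hb x).mul (hed' x))).const_mul (Complex.I * k)) ?_
    have h2 : 2 * Complex.I * k * c x = W x := by simp only [c]; field_simp
    have h3 := hee x
    simp only [u, f]
    rw [← h2]
    linear_combination ((2 * Complex.I * k * c x * ((y x).1 * e x + (y x).2 * e' x))) * h3 + ((k ^2 * ((y x).1 * e x + (y x).2 * e' x))) * Complex.I_sq
  refine ⟨u, ⟨u', fun x => (W x - k ^ 2) * u x, fun x _ => hud x, fun x _ => hud' x, ?_, ?_⟩, ?_⟩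
  · have : Continuous u := continuous_iff_continuousAt.2 fun x => (hud x).continuousAt
    exact Continuous.continuousOn (by fun_prop)
  · intro x hx
    simp only [hWV x hx]
    push_cast; ring
  · have h1 : Tendsto (fun x => (y x).2 * (e' x * e' x)) atTop (nhds 0) := by
      rw [tendsto_zero_iff_norm_tendsto_zero] at hbt ⊢
      simpa [hen'] using hbt
    have h2 := hat.add h1
    rw [add_zero] at h2
    refine h2.congr fun x => ?_
    change _ = ((y x).1 * e x + (y x).2 * e' x) * e' x
    linear_combination (-(y x).1) * hee x

lemma weid_bdd (V : ℝ → ℝ) (hVc : ContinuousOn V (Ici (0 : ℝ)))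
    (hL1 : IntegrableOn (fun x => |V x|) (Ici (0 : ℝ)))
    (k : ℝ) (hk : 0 < k) (u : ℝ → ℂ) (hu : HalfLineSolution V (k ^ 2) u) :
      ∃ C : ℝ, ∀ x ∈ Ici (0 : ℝ), ‖u x‖ ≤ C := by
  obtain ⟨u', u'', h1, h2, -, h4⟩ := hu
  have hWc : Continuous fun x : ℝ => |V (max x 0)| :=
    (hVc.comp_continuous (by fun_prop) fun x => mem_Ici.2 (le_max_right _ _)).abs
  set G : ℝ → ℝ := fun x => ∫ t in (0:ℝ)..x, |V (max t 0)| with hG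
  have hGd : ∀ x, HasDerivAt G |V (max x 0)| x := fun x =>
    (hWc.integral_hasStrictDerivAt 0 x).hasDerivAt
  set M := ∫ t in Ici (0:ℝ), |V t|
  have hGM : ∀ x, 0 ≤ x → G x ≤ M := by
    intro x hx
    simp only [hG]
    rw [intervalIntegral.integral_of_le hx]
    rw [setIntegral_congr_fun (g := fun t => |V t|) measurableSet_Ioc (fun t ht => by
      simp [ht.1.le])]
    exact setIntegral_mono_set hL1 (Eventually.of_forall fun _ => abs_nonneg _)
      (Eventually.of_forall fun t ht => ht.1.le)
  let F : ℝ → ℝ := fun x => ‖u' x‖ ^ 2 + k ^ 2 * ‖u x‖ ^ 2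
  let F' : ℝ → ℝ := fun x => 2 * inner ℝ (u' x) (u'' x) + k ^ 2 * (2 * inner ℝ (u x) (u' x))
  have hF : ∀ x, 0 ≤ x → HasDerivAt F (F' x) x := fun x hx =>
    (h2 x hx).norm_sq.add ((h1 x hx).norm_sq.const_mul _)
  have hF' : ∀ x, 0 ≤ x → F' x ≤ |V x| / k * F x := by
    intro x hx
    have e : u'' x = ((V x - k ^ 2 : ℝ) : ℝ) • u x := by
      have := h4 x hx
      rw [Complex.real_smul]; push_cast at *
      linear_combination -this
    have e2 : F' x = 2 * V x * inner ℝ (u' x) (u x) := by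
      simp only [F', e]
      rw [inner_smul_right, real_inner_comm (u' x) (u x)]
      ring
    rw [e2]
    have h5 := abs_real_inner_le_norm (u' x) (u x)
    have h6 : 2 * V x * inner ℝ (u' x) (u x) ≤ 2 * |V x| * (‖u' x‖ * ‖u x‖) := by
      refine (le_abs_self _).trans ?_
      rw [abs_mul, abs_mul, abs_two]
      gcongr
    refine h6.trans ?_
    rw [div_mul_eq_mul_div, le_div_iff₀ hk]
    simp only [F]
    nlinarith [mul_nonneg (abs_nonneg (V x)) (sq_nonneg (‖u' x‖ - k * ‖u x‖))]
  let H : ℝ → ℝ := fun x => F x * Real.exp (-(G x / k))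
  have hH : ∀ x, 0 ≤ x → HasDerivAt H (F' x * Real.exp (-(G x / k)) + F x * (Real.exp (-(G x / k)) * -(|V (max x 0)| / k))) x :=
    fun x hx => (hF x hx).mul ((hGd x).div_const k).neg.exp
  have hanti : AntitoneOn H (Ici 0) := by
    refine antitoneOn_of_deriv_nonpos (convex_Ici 0) (fun x hx => (hH x hx).continuousAt.continuousWithinAt) ?_ ?_
    · intro x hx
      rw [interior_Ici] at hx
      exact (hH x (le_of_lt hx)).differentiableAt.differentiableWithinAt
    · intro x hx
      rw [interior_Ici] at hx
      have hx : 0 ≤ x := le_of_lt hx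
      rw [(hH x hx).deriv, max_eq_left hx]
      have := mul_le_mul_of_nonneg_right (hF' x hx) (Real.exp_pos (-(G x / k))).le
      linarith
  have hF0 : 0 ≤ F 0 := by simp only [F]; positivity
  refine ⟨Real.sqrt (F 0 * Real.exp (M / k)) / k, fun x hx => ?_⟩
  have hx : 0 ≤ x := hx
  have h7 : H x ≤ H 0 := hanti (mem_Ici.2 le_rfl) hx hx
  have h8 : H 0 = F 0 := by simp [H, hG]
  rw [h8] at h7
  have h9 : F x ≤ F 0 * Real.exp (M / k) := by
    have : F x = H x * Real.exp (G x / k) := by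
      simp only [H]; rw [mul_assoc, ← Real.exp_add]; simp
    rw [this]
    have := hGM x hx
    gcongr
  rw [le_div_iff₀ hk]
  apply Real.le_sqrt_of_sq_le
  refine le_trans ?_ h9
  simp only [F]
  nlinarith [sq_nonneg ‖u' x‖]

/-- **Weidmann's theorem (short-range scattering).** If `V ∈ L¹(0,∞)` is continuous
and `k > 0`, then `-u'' + V u = k² u` has a solution with `u(x)e^{-ikx} → 1` as
`x → ∞`, and every twice continuously differentiable solution is bounded on `[0,∞)`. -/
theorem weidmann_short_range
    (V : ℝ → ℝ) (hVc : ContinuousOn V (Ici (0 : ℝ)))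
    (hL1 : IntegrableOn (fun x => |V x|) (Ici (0 : ℝ)))
    (k : ℝ) (hk : 0 < k) :
    (∃ u : ℝ → ℂ, HalfLineSolution V (k ^ 2) u ∧
      Tendsto (fun x : ℝ => u x * Complex.exp (-(Complex.I * k * x))) atTop (nhds 1)) ∧
    (∀ u : ℝ → ℂ, HalfLineSolution V (k ^ 2) u →
      ∃ C : ℝ, ∀ x ∈ Ici (0 : ℝ), ‖u x‖ ≤ C) :=
  ⟨weid_exists V hVc hL1 k hk, weid_bdd V hVc hL1 k hk⟩
end

section
/- For all real numbers a and b and every p with 1 < p < ∞, setting q = p/(p−1), the inequality a/p + b/q + (log p)/p + (log q)/q − log 2 ≤ log((e^a + e^b)/2) holds; moreover, for p = 1 + e^{b−a} (so that q = 1 + e^{a−b}) the two sides are equal, i.e. the supremum of the left-hand side over p ∈ (1,∞) equals log((e^a + e^b)/2). -/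
open Real Set

/-- **Young-inequality optimization lemma for the Bethe-lattice sum rule.** For all
real `a, b` and `1 < p < ∞`, with `q = p/(p-1)`,
`a/p + b/q + (log p)/p + (log q)/q - log 2 ≤ log((eᵃ + eᵇ)/2)`, with equality at
`p = 1 + e^{b-a}` (for which `q = 1 + e^{a-b}`); hence the supremum of the left-hand
side over `p ∈ (1,∞)` equals `log((eᵃ + eᵇ)/2)`. -/
theorem young_optimization (a b : ℝ) :
    (∀ p : ℝ, 1 < p →
      a / p + b / (p / (p - 1)) + Real.log p / p +
          Real.log (p / (p - 1)) / (p / (p - 1)) - Real.log 2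
        ≤ Real.log ((Real.exp a + Real.exp b) / 2)) ∧
    ((1 + Real.exp (b - a)) / ((1 + Real.exp (b - a)) - 1) = 1 + Real.exp (a - b)) ∧
    (a / (1 + Real.exp (b - a)) + b / (1 + Real.exp (a - b)) +
        Real.log (1 + Real.exp (b - a)) / (1 + Real.exp (b - a)) +
        Real.log (1 + Real.exp (a - b)) / (1 + Real.exp (a - b)) - Real.log 2
      = Real.log ((Real.exp a + Real.exp b) / 2)) ∧
    IsGreatest
      ((fun p : ℝ =>
          a / p + b / (p / (p - 1)) + Real.log p / p +
            Real.log (p / (p - 1)) / (p / (p - 1)) - Real.log 2) '' Ioi 1)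
      (Real.log ((Real.exp a + Real.exp b) / 2)) := by
  have hS : 0 < Real.exp a + Real.exp b := by positivity
  have hL : Real.log ((Real.exp a + Real.exp b) / 2)
      = Real.log (Real.exp a + Real.exp b) - Real.log 2 :=
    Real.log_div hS.ne' two_ne_zero
  have key : ∀ x r : ℝ, 0 < r →
      (x + Real.log r - Real.log (Real.exp a + Real.exp b)) / r
        ≤ Real.exp x / (Real.exp a + Real.exp b) - 1 / r := by
    intro x r hr
    have h := Real.log_le_sub_one_of_pos (x := r * Real.exp x / (Real.exp a + Real.exp b))
      (by positivity)
    rw [Real.log_div (by positivity) hS.ne', Real.log_mul hr.ne' (by positivity),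
      Real.log_exp] at h
    rw [div_le_iff₀ hr]
    have e : (Real.exp x / (Real.exp a + Real.exp b) - 1 / r) * r
        = r * Real.exp x / (Real.exp a + Real.exp b) - 1 := by
      field_simp
    rw [e]; linarith
  have h1 : ∀ p : ℝ, 1 < p →
      a / p + b / (p / (p - 1)) + Real.log p / p +
          Real.log (p / (p - 1)) / (p / (p - 1)) - Real.log 2
        ≤ Real.log ((Real.exp a + Real.exp b) / 2) := by
    intro p hp
    have hp0 : 0 < p := by linarith
    have hp1 : 0 < p - 1 := by linarith
    have hq : 0 < p / (p - 1) := by positivity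
    have hpq : 1 / p + 1 / (p / (p - 1)) = 1 := by field_simp; ring
    have k1 := key a p hp0
    have k2 := key b _ hq
    have hsum : Real.exp a / (Real.exp a + Real.exp b)
        + Real.exp b / (Real.exp a + Real.exp b) = 1 := by
      rw [← add_div, div_self hS.ne']
    rw [hL]
    generalize p / (p - 1) = q at *
    generalize Real.log (Real.exp a + Real.exp b) = L at *
    have : L = L * (1 / p) + L * (1 / q) := by rw [← mul_add, hpq, mul_one]
    have e1 : (a + Real.log p - L) / p = a / p + Real.log p / p - L * (1 / p) := by ring
    have e2 : (b + Real.log q - L) / q = b / q + Real.log q / q - L * (1 / q) := by ring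
    linarith
  have h2 : (1 + Real.exp (b - a)) / ((1 + Real.exp (b - a)) - 1) = 1 + Real.exp (a - b) := by
    rw [add_sub_cancel_left, Real.exp_sub, Real.exp_sub]
    field_simp
    ring
  have h3 : a / (1 + Real.exp (b - a)) + b / (1 + Real.exp (a - b)) +
        Real.log (1 + Real.exp (b - a)) / (1 + Real.exp (b - a)) +
        Real.log (1 + Real.exp (a - b)) / (1 + Real.exp (a - b)) - Real.log 2
      = Real.log ((Real.exp a + Real.exp b) / 2) := by
    have eP : 1 + Real.exp (b - a) = (Real.exp a + Real.exp b) / Real.exp a := by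
      rw [Real.exp_sub]; field_simp
    have eQ : 1 + Real.exp (a - b) = (Real.exp a + Real.exp b) / Real.exp b := by
      rw [Real.exp_sub]; field_simp; ring
    rw [hL, eP, eQ, Real.log_div hS.ne' (Real.exp_ne_zero a),
      Real.log_div hS.ne' (Real.exp_ne_zero b), Real.log_exp, Real.log_exp]
    field_simp
    ring
  refine ⟨h1, h2, h3, ⟨1 + Real.exp (b - a), ?_, ?_⟩, ?_⟩
  · simp only [mem_Ioi]
    linarith [Real.exp_pos (b - a)]
  · simp only [h2]
    exact h3
  · rintro _ ⟨p, hp, rfl⟩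
    exact h1 p hp
end
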